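/- The set F₀([0,1]⁵ ∖ ℚ⁵) of all closed zero-dimensional subsets of [0,1]⁵ ∖ ℚ⁵ is Game Σ⁰₂-hard. -/

import Mathlib

open Set Filter Topology TopologicalSpace

/-- `DimLE X n` : the topological (covering) dimension of `X` is at most `n`, i.e. every
finite open cover of `X` admits an open shrinking (refinement) of order at most `n + 1`. -/
def DimLE (X : Type*) [TopologicalSpace X] (n : ℕ) : Prop :=
  ∀ (k : ℕ) (U : Fin k → Set X), (∀ i, IsOpen (U i)) → (⋃ i, U i) = Set.univ →
    ∃ V : Fin k → Set X, (∀ i, IsOpen (V i)) ∧ (∀ i, V i ⊆ U i) ∧ (⋃ i, V i) = Set.univ ∧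
      ∀ x : X, ({i | x ∈ V i}).ncard ≤ n + 1

/-- The collection `F(X)` of closed subsets of `X`. -/
abbrev Cl (X : Type*) [TopologicalSpace X] : Type _ := {F : Set X // IsClosed F}

/-- `F₀(X)` : the set of all closed zero-dimensional subsets of `X`. -/
def F0 (X : Type*) [TopologicalSpace X] : Set (Cl X) := {F | DimLE (↥F.1) 0}

/-- The Vietoris topology on subsets of `Y`. -/
def vietoris (Y : Type*) [TopologicalSpace Y] : TopologicalSpace (Set Y) :=
  TopologicalSpace.generateFrom
    ({S | ∃ U : Set Y, IsOpen U ∧ S = {A : Set Y | A ⊆ U}} ∪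
     {S | ∃ U : Set Y, IsOpen U ∧ S = {A : Set Y | (A ∩ U).Nonempty}})

/-- A topology `τ` on `F(X)` is admissible if it is induced, via `F ↦ closure (e '' F)`,
by the Vietoris topology on some metrizable compactification `Y` of `X` (with embedding `e`). -/
def IsAdmissible (X : Type*) [tX : TopologicalSpace X] (τ : TopologicalSpace (Cl X)) : Prop :=
  ∃ (Y : Type) (tY : TopologicalSpace Y) (_ : @CompactSpace Y tY)
    (_ : @TopologicalSpace.MetrizableSpace Y tY) (e : X → Y),
      @Topology.IsEmbedding X Y tX tY e ∧
      τ = (@vietoris Y tY).induced (fun F : Cl X => @closure Y tY (e '' F.1))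

/-- An analytic space: a separable metrizable space which is empty or a continuous image
of the Baire space `ℕ → ℕ`. -/
def IsAnalyticSpace (X : Type*) [TopologicalSpace X] : Prop :=
  TopologicalSpace.MetrizableSpace X ∧ TopologicalSpace.SeparableSpace X ∧
    (IsEmpty X ∨ ∃ f : (ℕ → ℕ) → X, Continuous f ∧ Function.Surjective f)

/-- `Σ¹₂` subsets of a topological space: projections of co-analytic sets. -/
def IsSigma12 {W : Type*} [TopologicalSpace W] (s : Set W) : Prop :=
  ∃ B : Set (W × (ℕ → ℕ)), MeasureTheory.AnalyticSet Bᶜ ∧ s = {w | ∃ y, (w, y) ∈ B}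

/-- `Σ¹₂`-hardness (with Cantor space `2^ω = ℕ → Bool` as source). -/
def Sigma12Hard {W : Type*} [TopologicalSpace W] (A : Set W) : Prop :=
  ∀ A' : Set (ℕ → Bool), IsSigma12 A' →
    ∃ φ : (ℕ → Bool) → W, Continuous φ ∧ A' = φ ⁻¹' A

/-- `Π¹₁`-hardness. -/
def Pi11Hard {W : Type*} [TopologicalSpace W] (A : Set W) : Prop :=
  ∀ A' : Set (ℕ → Bool), MeasureTheory.AnalyticSet A'ᶜ →
    ∃ φ : (ℕ → Bool) → W, Continuous φ ∧ A' = φ ⁻¹' A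

/-- The additive Borel classes `Σ⁰ξ` : `Σ⁰₁` consists of the open sets, and for `ξ > 1`,
`Σ⁰ξ` consists of countable unions of sets whose complements are in some `Σ⁰η`, `η < ξ`. -/
inductive SigmaOrd {W : Type*} [TopologicalSpace W] : Ordinal.{0} → Set W → Prop
  | basic (s : Set W) : IsOpen s → SigmaOrd 1 s
  | union (ξ : Ordinal.{0}) (η : ℕ → Ordinal.{0}) (f : ℕ → Set W) (hξ : 1 < ξ)
      (hη : ∀ n, η n < ξ) (h : ∀ n, SigmaOrd (η n) (f n)ᶜ) : SigmaOrd ξ (⋃ n, f n)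

/-- The run produced when player I follows the strategy `σ` and player II plays `β`. -/
def playI (σ : List ℕ → ℕ) (β : ℕ → ℕ) : ℕ → ℕ := fun n =>
  if n % 2 = 0 then σ (List.ofFn fun i : Fin (n / 2) => β i) else β (n / 2)

/-- Player I has a winning strategy in the game `G_A`. -/
def PlayerIWins (A : Set (ℕ → ℕ)) : Prop :=
  ∃ σ : List ℕ → ℕ, ∀ β : ℕ → ℕ, playI σ β ∈ A

/-- The game operator `Game B` applied to `B ⊆ W × ω^ω`. -/
def GameOp {W : Type*} (B : Set (W × (ℕ → ℕ))) : Set W :=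
  {w | PlayerIWins {γ | (w, γ) ∈ B}}

/-- `Game Σ⁰ξ`-hardness. -/
def GameSigmaHard (ξ : Ordinal.{0}) {W : Type*} [TopologicalSpace W] (A : Set W) : Prop :=
  ∀ A' : Set (ℕ → Bool),
    (∃ B : Set ((ℕ → Bool) × (ℕ → ℕ)), SigmaOrd ξ B ∧ A' = GameOp B) →
    ∃ φ : (ℕ → Bool) → W, Continuous φ ∧ A' = φ ⁻¹' A

/-- The space `[0,1]⁵ ∖ ℚ⁵` : points of the cube `[0,1]⁵` having at least one
irrational coordinate. -/
def cubeMinusQ5 : Set (Fin 5 → Set.Icc (0:ℝ) 1) :=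
  {x | ∃ i : Fin 5, Irrational (x i : ℝ)}


/-! ### Generic facts on zero-dimensional spaces -/

theorem DimLE.of_homeomorph {X Y : Type*} [TopologicalSpace X] [TopologicalSpace Y] {n : ℕ}
    (e : X ≃ₜ Y) (h : DimLE X n) : DimLE Y n := by
  intro k U hU hcov
  obtain ⟨V, hV, hVU, hVc, hVn⟩ := h k (fun i => e ⁻¹' U i)
    (fun i => (hU i).preimage e.continuous) (by rw [← preimage_iUnion, hcov, preimage_univ])
  refine ⟨fun i => e.symm ⁻¹' V i, fun i => (hV i).preimage e.symm.continuous, ?_, ?_, ?_⟩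
  · intro i y hy
    have := hVU i hy
    simpa using this
  · rw [← preimage_iUnion, hVc, preimage_univ]
  · intro y
    exact hVn (e.symm y)

theorem DimLE.exists_separation {X : Type*} [TopologicalSpace X] [T1Space X]
    (h : DimLE X 0) {u v : X} (huv : u ≠ v) : ∃ G : Set X, IsClopen G ∧ u ∈ G ∧ v ∉ G := by
  obtain ⟨V, hV, hVU, hVc, hVn⟩ := h 2 ![{v}ᶜ, {u}ᶜ]
    (by intro i; fin_cases i <;> simp)
    (by
      apply eq_univ_of_forall
      intro x
      by_cases hx : x = v
      · exact mem_iUnion.2 ⟨1, by simp [hx, huv.symm]⟩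
      · exact mem_iUnion.2 ⟨0, by simp [hx]⟩)
  have hd : ∀ x, x ∈ V 0 → x ∈ V 1 → False := by
    intro x h0 h1
    have : ({i | x ∈ V i} : Set (Fin 2)) = univ := by
      ext i; fin_cases i <;> simp [h0, h1]
    have h2 := hVn x
    rw [this, ncard_univ] at h2
    simp at h2
  have hc : ∀ x, x ∈ V 0 ∨ x ∈ V 1 := by
    intro x
    have : x ∈ ⋃ i, V i := by rw [hVc]; trivial
    obtain ⟨i, hi⟩ := mem_iUnion.1 this
    fin_cases i
    · exact Or.inl hi
    · exact Or.inr hi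
  have hcompl : V 0 = (V 1)ᶜ := by
    ext x
    exact ⟨fun h0 h1 => hd x h0 h1, fun h1 => (hc x).resolve_right h1⟩
  refine ⟨V 0, ⟨?_, hV 0⟩, ?_, ?_⟩
  · rw [hcompl]; exact (hV 1).isClosed_compl
  · refine (hc u).resolve_right fun hu => ?_
    have := hVU 1 hu
    simp at this
  · intro hv
    have := hVU 0 hv
    simp at this

theorem DimLE.of_clopen_basis {X : Type*} [TopologicalSpace X] [SecondCountableTopology X]
    (h : ∀ (z : X) (O : Set X), IsOpen O → z ∈ O → ∃ C, IsClopen C ∧ z ∈ C ∧ C ⊆ O) :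
    DimLE X 0 := by
  intro k U hU hcov
  have hex : ∀ z : X, ∃ (C : Set X) (i : Fin k), IsClopen C ∧ z ∈ C ∧ C ⊆ U i := by
    intro z
    have : z ∈ ⋃ i, U i := by rw [hcov]; trivial
    obtain ⟨i, hi⟩ := mem_iUnion.1 this
    obtain ⟨C, hC⟩ := h z (U i) (hU i) hi
    exact ⟨C, i, hC⟩
  choose C idx hC hz hCU using hex
  obtain ⟨T, hT, hTc⟩ := TopologicalSpace.isOpen_iUnion_countable C (fun z => (hC z).isOpen)
  have hTu : ⋃ z ∈ T, C z = univ := by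
    rw [hTc]
    exact eq_univ_of_forall fun z => mem_iUnion.2 ⟨z, hz z⟩
  rcases T.eq_empty_or_nonempty with hTe | hTne
  · have hX : ∀ x : X, False := by
      intro x
      have : x ∈ ⋃ z ∈ T, C z := by rw [hTu]; trivial
      simp [hTe] at this
    exact ⟨U, hU, fun _ => Subset.rfl, hcov, fun x => (hX x).elim⟩
  obtain ⟨f, hf⟩ := hT.exists_eq_range hTne
  let W : ℕ → Set X := disjointed fun n => C (f n)
  have hWo : ∀ n, IsOpen (W n) := by
    intro n
    change IsOpen (disjointed (fun n => C (f n)) n)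
    rw [disjointed_eq_inter_compl]
    refine (hC (f n)).isOpen.inter ?_
    exact (Set.finite_lt_nat n).isOpen_biInter fun j _ => (hC (f j)).compl.isOpen
  have hWs : ∀ n, W n ⊆ C (f n) := fun n => disjointed_subset _ n
  have hWc : ⋃ n, W n = univ := by
    change ⋃ n, disjointed _ n = _
    rw [iUnion_disjointed, ← hTu, hf, biUnion_range]
  have hWd : Pairwise (Function.onFun Disjoint W) := disjoint_disjointed _
  refine ⟨fun i => ⋃ n ∈ {n | idx (f n) = i}, W n,
    fun i => isOpen_biUnion fun n _ => hWo n, ?_, ?_, ?_⟩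
  · intro i
    refine iUnion₂_subset fun n hn => ?_
    have hn' : idx (f n) = i := hn
    exact (hWs n).trans (hn' ▸ hCU (f n))
  · refine eq_univ_of_forall fun x => ?_
    have : x ∈ ⋃ n, W n := by rw [hWc]; trivial
    obtain ⟨n, hn⟩ := mem_iUnion.1 this
    exact mem_iUnion.2 ⟨idx (f n), mem_iUnion₂.2 ⟨n, rfl, hn⟩⟩
  · intro x
    rw [zero_add, Set.ncard_le_one_iff (Set.toFinite _)]
    intro i j hi hj
    obtain ⟨n, hn, hxn⟩ := mem_iUnion₂.1 hi
    obtain ⟨m, hm, hxm⟩ := mem_iUnion₂.1 hj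
    have : n = m := by
      by_contra hne
      exact Set.disjoint_left.1 (hWd hne) hxn hxm
    rw [← hn, ← hm, this]

/-! ### A continuous function with prescribed rationality on countable sets -/

theorem exists_continuous_rational_irrational {P : Type*} [MetricSpace P] {D E : Set P}
    (hD : D.Countable) (hE : E.Countable) (hDE : ∀ z ∈ D, z ∉ E) :
    ∃ g : P → ℝ, Continuous g ∧ (∀ z, g z ∈ Set.Icc (0:ℝ) 1) ∧
      (∀ z ∈ D, ∃ q : ℚ, g z = q) ∧ (∀ z ∈ E, Irrational (g z)) := by
  rcases (D ∪ E).eq_empty_or_nonempty with he | hne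
  · refine ⟨fun _ => 0, continuous_const, fun _ => by simp, ?_, ?_⟩
    · intro z hz
      exact ⟨0, by simp⟩
    · intro z hz
      have : z ∈ D ∪ E := Or.inr hz
      simp [he] at this
  obtain ⟨z, hz⟩ := (hD.union hE).exists_eq_range hne
  let bump : ℕ → P → ℝ := fun n w => min 1 (∏ i ∈ Finset.range n, dist w (z i))
  have hb0 : ∀ n w, 0 ≤ bump n w := fun n w =>
    le_min zero_le_one (Finset.prod_nonneg fun i _ => dist_nonneg)
  have hb1 : ∀ n w, bump n w ≤ 1 := fun n w => min_le_left _ _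
  have hbc : ∀ n, Continuous (bump n) := fun n =>
    continuous_const.min (continuous_finsetProd _ fun i _ => continuous_id.dist continuous_const)
  have hbz : ∀ n k, k < n → bump n (z k) = 0 := by
    intro n k hk
    have : ∏ i ∈ Finset.range n, dist (z k) (z i) = 0 :=
      Finset.prod_eq_zero (Finset.mem_range.2 hk) (dist_self _)
    simp [bump, this]
  have hch : ∀ (n : ℕ) (f : P → ℝ), ∃ ε : ℝ, 0 ≤ ε ∧ ε ≤ 1 / 2 / 2 ^ n ∧
      (0 < bump n (z n) → (z n ∈ D → ∃ q : ℚ, f (z n) + ε * bump n (z n) = q) ∧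
        (z n ∈ E → Irrational (f (z n) + ε * bump n (z n)))) := by
    intro n f
    by_cases hb : 0 < bump n (z n)
    · have hlt : f (z n) < f (z n) + (1 / 2 / 2 ^ n) * bump n (z n) :=
        lt_add_of_pos_right _ (by positivity)
      have key : ∀ r, f (z n) < r → r < f (z n) + (1 / 2 / 2 ^ n) * bump n (z n) →
          ∃ ε : ℝ, 0 ≤ ε ∧ ε ≤ 1 / 2 / 2 ^ n ∧ f (z n) + ε * bump n (z n) = r := by
        intro r h1 h2
        refine ⟨(r - f (z n)) / bump n (z n), by
          apply div_nonneg _ hb.le; linarith, ?_, ?_⟩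
        · rw [div_le_iff₀ hb]; linarith
        · rw [div_mul_cancel₀ _ hb.ne']; ring
      by_cases hzD : z n ∈ D
      · obtain ⟨q, h1, h2⟩ := exists_rat_btwn hlt
        obtain ⟨ε, h3, h4, h5⟩ := key q h1 h2
        exact ⟨ε, h3, h4, fun _ => ⟨fun _ => ⟨q, h5⟩, fun h => absurd h (hDE _ hzD)⟩⟩
      · obtain ⟨r, hr, h1, h2⟩ := exists_irrational_btwn hlt
        obtain ⟨ε, h3, h4, h5⟩ := key r h1 h2
        exact ⟨ε, h3, h4, fun _ => ⟨fun h => absurd h hzD, fun _ => h5 ▸ hr⟩⟩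
    · exact ⟨0, le_rfl, by positivity, fun h => absurd h hb⟩
  choose e he0 he1 he2 using hch
  let f : ℕ → P → ℝ := fun n => Nat.rec (fun _ => 0) (fun k fk w => fk w + e k fk * bump k w) n
  let ε : ℕ → ℝ := fun n => e n (f n)
  have hf : ∀ n w, f n w = ∑ i ∈ Finset.range n, ε i * bump i w := by
    intro n w
    induction n with
    | zero => simp [f]
    | succ n ih => rw [Finset.sum_range_succ, ← ih]
  have hterm : ∀ n w, ‖ε n * bump n w‖ ≤ 1 / 2 / 2 ^ n := by
    intro n w
    rw [Real.norm_of_nonneg (mul_nonneg (he0 _ _) (hb0 _ _))]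
    calc ε n * bump n w ≤ ε n * 1 := mul_le_mul_of_nonneg_left (hb1 _ _) (he0 _ _)
      _ ≤ _ := by rw [mul_one]; exact he1 _ _
  have hval : ∀ k, (∑' n, ε n * bump n (z k)) = f (k + 1) (z k) := by
    intro k
    rw [hf (k + 1) (z k), tsum_eq_sum (s := Finset.range (k + 1))]
    intro b hb
    rw [hbz b k (by simpa using hb), mul_zero]
  have hkey : ∀ w ∈ D ∪ E, ∃ k, z k = w ∧ 0 < bump k (z k) := by
    intro w hw
    rw [hz] at hw
    classical
    have hex : ∃ k, z k = w := hw
    refine ⟨Nat.find hex, Nat.find_spec hex, ?_⟩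
    refine lt_min zero_lt_one (Finset.prod_pos fun i hi => dist_pos.2 fun h => ?_)
    exact Nat.find_min hex (Finset.mem_range.1 hi) (h.symm.trans (Nat.find_spec hex))
  have hs : Summable fun n : ℕ => (1 : ℝ) / 2 / 2 ^ n := summable_geometric_two' 1
  refine ⟨fun w => ∑' n, ε n * bump n w,
    continuous_tsum (fun n => continuous_const.mul (hbc n)) hs hterm, ?_, ?_, ?_⟩
  · intro w
    refine ⟨tsum_nonneg fun n => mul_nonneg (he0 _ _) (hb0 _ _), ?_⟩
    calc ∑' n, ε n * bump n w ≤ ∑' n : ℕ, (1 : ℝ) / 2 / 2 ^ n :=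
          Summable.tsum_le_tsum (fun n => (le_abs_self _).trans (hterm n w))
            (hs.of_norm_bounded fun n => hterm n w) hs
      _ = 1 := tsum_geometric_two' 1
  · intro w hw
    obtain ⟨k, rfl, hk⟩ := hkey w (Or.inl hw)
    obtain ⟨q, hq⟩ := (he2 k (f k) hk).1 hw
    exact ⟨q, by simp only [hval]; exact hq⟩
  · intro w hw
    obtain ⟨k, rfl, hk⟩ := hkey w (Or.inr hw)
    simp only [hval]
    exact (he2 k (f k) hk).2 hw

/-! ### The game as an inductive predicate on positions -/

theorem SigmaOrd.isOpen_of_lt_two {W : Type*} [TopologicalSpace W] {ξ : Ordinal.{0}} {s : Set W}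
    (h : SigmaOrd ξ s) (hξ : ξ < 2) : IsOpen s := by
  cases h with
  | basic s hs => exact hs
  | union ξ η f h1 hη hf =>
    exact absurd (Order.succ_le_of_lt h1) (by
      rw [not_le]
      have : Order.succ (1 : Ordinal.{0}) = 2 := by
        rw [Order.succ_eq_add_one, one_add_one_eq_two]
      rw [this]; exact hξ)

theorem SigmaOrd.exists_isClosed {W : Type*} [TopologicalSpace W] {B : Set W}
    (h : SigmaOrd 2 B) : ∃ C : ℕ → Set W, (∀ n, IsClosed (C n)) ∧ B = ⋃ n, C n := by
  have key : ∀ (ξ : Ordinal.{0}), ξ = 2 → SigmaOrd ξ B →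
      ∃ C : ℕ → Set W, (∀ n, IsClosed (C n)) ∧ B = ⋃ n, C n := by
    intro ξ hξ h
    cases h with
    | basic s hs => exact absurd hξ (by norm_num)
    | union ξ η f h1 hη hf =>
      exact ⟨f, fun n => isOpen_compl_iff.1 ((hf n).isOpen_of_lt_two (hξ ▸ hη n)), rfl⟩
  exact key 2 rfl h

/-- The initial segment of length `k` of `γ`, listed backwards. -/
def initSeg (γ : ℕ → ℕ) : ℕ → List ℕ
  | 0 => []
  | k + 1 => γ k :: initSeg γ k

@[simp] theorem initSeg_length (γ : ℕ → ℕ) (k : ℕ) : (initSeg γ k).length = k := by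
  induction k with
  | zero => rfl
  | succ k ih => simp [initSeg, ih]

theorem eq_of_initSeg_eq {γ γ' : ℕ → ℕ} {k : ℕ} (h : initSeg γ k = initSeg γ' k) :
    ∀ i < k, γ i = γ' i := by
  induction k with
  | zero => intro i hi; omega
  | succ k ih =>
    rw [initSeg, initSeg, List.cons.injEq] at h
    intro i hi
    rcases Nat.lt_succ_iff_lt_or_eq.1 hi with h' | h'
    · exact ih h.2 i h'
    · rw [h', h.1]

theorem getD_reverse_initSeg (γ : ℕ → ℕ) {k i : ℕ} (h : i < k) :
    (initSeg γ k).reverse.getD i 0 = γ i := by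
  induction k with
  | zero => omega
  | succ k ih =>
    rw [initSeg, List.reverse_cons]
    rcases Nat.lt_succ_iff_lt_or_eq.1 h with h' | h'
    · rw [List.getD_append _ _ _ _ (by simpa using h'), ih h']
    · subst h'
      rw [List.getD_append_right _ _ _ _ (by simp)]
      simp

theorem eq_initSeg_of_getD {γ : ℕ → ℕ} {s : List ℕ}
    (h : ∀ i < s.length, γ i = s.reverse.getD i 0) : initSeg γ s.length = s := by
  induction s with
  | nil => rfl
  | cons b s ih =>
    rw [List.length_cons, initSeg, ih, h s.length (by simp)]
    · rw [List.reverse_cons, List.getD_append_right _ _ _ _ (by simp)]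
      simp
    · intro i hi
      rw [h i (by simp; omega), List.reverse_cons, List.getD_append _ _ _ _ (by simpa using hi)]

/-- The position reached from `t` when player I uses `σ` and player II's moves are `β`;
all lists are backwards. -/
def runFrom (σ : List ℕ → ℕ) (t : List ℕ) : List ℕ → List ℕ
  | [] => t
  | b :: β => b :: σ β :: runFrom σ t β

theorem runFrom_append (σ : List ℕ → ℕ) (t bs β : List ℕ) :
    runFrom σ t (β ++ bs) = runFrom (fun l => σ (l ++ bs)) (runFrom σ t bs) β := by
  induction β with
  | nil => rfl
  | cons b β ih => simp [runFrom, ih]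

theorem length_runFrom (σ : List ℕ → ℕ) (t β : List ℕ) :
    (runFrom σ t β).length = 2 * β.length + t.length := by
  induction β with
  | nil => simp [runFrom]
  | cons b β ih => simp [runFrom, ih]; omega

theorem encode_lt_cons (b : ℕ) (β : List ℕ) :
    Encodable.encode β < Encodable.encode (b :: β) := by
  rw [Encodable.encode_list_cons]
  exact Nat.lt_succ_of_le (Nat.right_le_pair _ _)

theorem runFrom_congr {σ σ' : List ℕ → ℕ} (t : List ℕ) {β : List ℕ}
    (h : ∀ l, Encodable.encode l < Encodable.encode β → σ l = σ' l) :
    runFrom σ t β = runFrom σ' t β := by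
  induction β with
  | nil => rfl
  | cons b β ih =>
    rw [runFrom, runFrom, h β (encode_lt_cons b β),
      ih fun l hl => h l (hl.trans (encode_lt_cons b β))]

/-- The finite information `t` together with the first digits of `x` excludes membership
in `C n`. -/
def Refuted (C : ℕ → Set ((ℕ → Bool) × (ℕ → ℕ))) (x : ℕ → Bool) (n : ℕ) (t : List ℕ) : Prop :=
  ∀ (x' : ℕ → Bool) (γ : ℕ → ℕ), (∀ i < t.length, x' i = x i) → initSeg γ t.length = t →
    (x', γ) ∉ C n

open Classical in
/-- The label of the node `s` of the tree attached to the position `p`. -/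
noncomputable def childPos (C : ℕ → Set ((ℕ → Bool) × (ℕ → ℕ))) (x : ℕ → Bool)
    (p : List ℕ × ℕ) (s : List ℕ) : Option (List ℕ × ℕ) :=
  let t := runFrom (fun l => s.reverse.getD (Encodable.encode l) 0) p.1
    (Denumerable.ofNat (List ℕ) s.length)
  if Refuted C x p.2 t then some (t, p.2 + 1) else none

/-- Positions from which player I can win. -/
inductive WinPos (C : ℕ → Set ((ℕ → Bool) × (ℕ → ℕ))) (x : ℕ → Bool) : List ℕ × ℕ → Prop
  | intro (p : List ℕ × ℕ) (y : ℕ → ℕ)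
      (h : ∀ k q, childPos C x p (initSeg y k) = some q → WinPos C x q) : WinPos C x p

theorem childPos_locally_constant (C : ℕ → Set ((ℕ → Bool) × (ℕ → ℕ))) (p : List ℕ × ℕ)
    (s : List ℕ) : ∃ N, ∀ x x' : ℕ → Bool, (∀ i < N, x' i = x i) →
      childPos C x' p s = childPos C x p s := by
  refine ⟨(runFrom (fun l => s.reverse.getD (Encodable.encode l) 0) p.1
    (Denumerable.ofNat (List ℕ) s.length)).length, fun x x' h => ?_⟩
  have key : ∀ t : List ℕ, (∀ i < t.length, x' i = x i) →
      (Refuted C x' p.2 t ↔ Refuted C x p.2 t) := by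
    intro t ht
    constructor
    · intro hr z γ hz hγ
      exact hr z γ (fun i hi => (hz i hi).trans (ht i hi).symm) hγ
    · intro hr z γ hz hγ
      exact hr z γ (fun i hi => (hz i hi).trans (ht i hi)) hγ
  simp only [childPos]
  rw [propext (key _ h)]

open Classical in
theorem childPos_initSeg (C : ℕ → Set ((ℕ → Bool) × (ℕ → ℕ))) (x : ℕ → Bool) (p : List ℕ × ℕ)
    (y : ℕ → ℕ) (β : List ℕ) : childPos C x p (initSeg y (Encodable.encode β)) =
      if Refuted C x p.2 (runFrom (fun l => y (Encodable.encode l)) p.1 β) then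
        some (runFrom (fun l => y (Encodable.encode l)) p.1 β, p.2 + 1) else none := by
  have : runFrom (fun l => (initSeg y (Encodable.encode β)).reverse.getD (Encodable.encode l) 0)
      p.1 (Denumerable.ofNat (List ℕ) (initSeg y (Encodable.encode β)).length) =
      runFrom (fun l => y (Encodable.encode l)) p.1 β := by
    rw [initSeg_length, Denumerable.ofNat_encode]
    exact runFrom_congr _ fun l hl => getD_reverse_initSeg y hl
  simp only [childPos, this]

theorem mem_of_forall_not_refuted {C : ℕ → Set ((ℕ → Bool) × (ℕ → ℕ))} {n : ℕ}
    (hC : IsClosed (C n)) {x : ℕ → Bool} {γ : ℕ → ℕ}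
    (h : ∀ N, ∃ k ≥ N, ¬ Refuted C x n (initSeg γ k)) : (x, γ) ∈ C n := by
  choose k hk hr using h
  simp only [Refuted, not_forall, not_not] at hr
  choose x' γ' hx' hγ' hmem using hr
  refine hC.mem_of_tendsto (b := atTop) (f := fun N => (x' N, γ' N)) ?_
    (Eventually.of_forall hmem)
  refine Tendsto.prodMk_nhds ?_ ?_
  · refine tendsto_pi_nhds.2 fun i => tendsto_const_nhds.congr' ?_
    filter_upwards [eventually_gt_atTop i] with N hN
    exact (hx' N i (by simpa using lt_of_lt_of_le hN (hk N))).symm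
  · refine tendsto_pi_nhds.2 fun i => tendsto_const_nhds.congr' ?_
    filter_upwards [eventually_gt_atTop i] with N hN
    have := hγ' N
    rw [initSeg_length] at this
    exact (eq_of_initSeg_eq this i (lt_of_lt_of_le hN (hk N))).symm

/-- A strategy that wins from the position `p`. -/
def WinsFrom (C : ℕ → Set ((ℕ → Bool) × (ℕ → ℕ))) (x : ℕ → Bool) (p : List ℕ × ℕ)
    (σ : List ℕ → ℕ) : Prop :=
  ∀ β γ : ℕ → ℕ, (∀ i, ∃ k, runFrom σ p.1 (initSeg β i) = initSeg γ k) → ∃ n, (x, γ) ∈ C n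

/-- The bookkeeping of a strategy pieced together from strategies at labelled positions. -/
def track {Q : Type*} (lab : List ℕ → Option Q) : List ℕ → Option (Q × List ℕ)
  | [] => (lab []).map fun q => (q, [])
  | b :: β =>
    match track lab β with
    | some (q, r) => some (q, b :: r)
    | none => (lab (b :: β)).map fun q => (q, [])

theorem WinPos.exists_winsFrom {C : ℕ → Set ((ℕ → Bool) × (ℕ → ℕ))}
    (hC : ∀ n, IsClosed (C n)) {x : ℕ → Bool} {p : List ℕ × ℕ} (hp : WinPos C x p) :
    ∃ σ, WinsFrom C x p σ := by
  classical
  induction hp with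
  | intro p y h ih =>
    have hq : ∀ q, ∃ σ, ∀ k, childPos C x p (initSeg y k) = some q → WinsFrom C x q σ := by
      intro q
      by_cases hk : ∃ k, childPos C x p (initSeg y k) = some q
      · obtain ⟨k, hk⟩ := hk
        obtain ⟨σ, hσ⟩ := ih k q hk
        exact ⟨σ, fun _ _ => hσ⟩
      · exact ⟨fun _ => 0, fun k hk' => absurd ⟨k, hk'⟩ hk⟩
    choose τ hτ using hq
    set lab : List ℕ → Option (List ℕ × ℕ) :=
      fun β => childPos C x p (initSeg y (Encodable.encode β)) with hlab
    set y' : List ℕ → ℕ := fun l => y (Encodable.encode l) with hy'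
    have hlab' : ∀ β, lab β = if Refuted C x p.2 (runFrom y' p.1 β) then
        some (runFrom y' p.1 β, p.2 + 1) else none := fun β => childPos_initSeg C x p y β
    let σ : List ℕ → ℕ := fun β =>
      match track lab β with
      | some (q, r) => τ q r
      | none => y' β
    have hlabfst : ∀ β q, lab β = some q → q.1 = runFrom y' p.1 β := by
      intro β q hq
      rw [hlab'] at hq
      split_ifs at hq
      rw [← Option.some.inj hq]
    have hnone : ∀ β, track lab β = none → lab β = none ∧ runFrom σ p.1 β = runFrom y' p.1 β := by
      intro β
      induction β with
      | nil =>
        intro h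
        exact ⟨by simpa [track] using h, rfl⟩
      | cons b β ihβ =>
        intro h
        rw [track] at h
        rcases hβ : track lab β with _ | ⟨q, r⟩
        · rw [hβ] at h
          refine ⟨by simpa using h, ?_⟩
          rw [runFrom, runFrom, (ihβ hβ).2]
          simp only [σ, hβ]
        · rw [hβ] at h
          simp at h
    have hsome : ∀ β q r, track lab β = some (q, r) →
        (∃ k, childPos C x p (initSeg y k) = some q) ∧
          runFrom σ p.1 β = runFrom (τ q) q.1 r := by
      intro β
      induction β with
      | nil =>
        intro q r h
        rw [track, Option.map_eq_some_iff] at h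
        obtain ⟨q', h1, h2⟩ := h
        obtain ⟨rfl, rfl⟩ := Prod.mk.inj h2
        exact ⟨⟨_, h1⟩, by rw [runFrom, runFrom, hlabfst _ _ h1, runFrom]⟩
      | cons b β ihβ =>
        intro q r h
        rw [track] at h
        rcases hβ : track lab β with _ | ⟨q', r'⟩
        · rw [hβ] at h
          simp only [Option.map_eq_some_iff] at h
          obtain ⟨q', h1, h2⟩ := h
          obtain ⟨rfl, rfl⟩ := Prod.mk.inj h2
          refine ⟨⟨_, h1⟩, ?_⟩
          rw [runFrom, runFrom, hlabfst _ _ h1, runFrom, (hnone β hβ).2]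
          simp only [σ, hβ]
        · rw [hβ] at h
          obtain ⟨rfl, rfl⟩ := Prod.mk.inj (Option.some.inj h)
          refine ⟨(ihβ _ _ hβ).1, ?_⟩
          rw [runFrom, runFrom, (ihβ _ _ hβ).2]
          simp only [σ, hβ]
    refine ⟨σ, fun β γ hβγ => ?_⟩
    have hfirst : ∀ i, track lab (initSeg β i) = none ∨
        ∃ i0 q, track lab (initSeg β i0) = some (q, []) := by
      intro i
      induction i with
      | zero =>
        rcases h0 : track lab (initSeg β 0) with _ | ⟨q, r⟩
        · exact Or.inl rfl
        · refine Or.inr ⟨0, q, ?_⟩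
          rw [h0]
          simp only [initSeg, track, Option.map_eq_some_iff] at h0
          obtain ⟨_, _, h2⟩ := h0
          obtain ⟨rfl, rfl⟩ := Prod.mk.inj h2
          rfl
      | succ i ihi =>
        rcases ihi with ihi | ihi
        · rcases h0 : track lab (initSeg β (i + 1)) with _ | ⟨q, r⟩
          · exact Or.inl rfl
          · refine Or.inr ⟨i + 1, q, ?_⟩
            rw [h0]
            simp only [initSeg, track, ihi, Option.map_eq_some_iff] at h0
            obtain ⟨_, _, h2⟩ := h0
            obtain ⟨rfl, rfl⟩ := Prod.mk.inj h2
            rfl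
        · exact Or.inr ihi
    by_cases hall : ∀ i, track lab (initSeg β i) = none
    · refine ⟨p.2, mem_of_forall_not_refuted (hC p.2) fun N => ?_⟩
      obtain ⟨k, hk⟩ := hβγ N
      have hlen := congrArg List.length hk
      rw [length_runFrom, initSeg_length, initSeg_length] at hlen
      refine ⟨k, by omega, ?_⟩
      obtain ⟨h1, h2⟩ := hnone _ (hall N)
      rw [← hk, h2]
      intro hr
      rw [hlab', if_pos hr] at h1
      simp at h1
    · obtain ⟨i, hi⟩ := not_forall.1 hall
      obtain ⟨i0, q, h0⟩ := (hfirst i).resolve_left hi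
      have hshift : ∀ j, track lab (initSeg β (i0 + j)) =
          some (q, initSeg (fun m => β (i0 + m)) j) := by
        intro j
        induction j with
        | zero => exact h0
        | succ j ihj =>
          rw [← add_assoc, initSeg, track, ihj]
          rfl
      obtain ⟨k, hk⟩ := (hsome _ _ _ h0).1
      refine hτ q k hk (fun m => β (i0 + m)) γ fun j => ?_
      obtain ⟨l, hl⟩ := hβγ (i0 + j)
      exact ⟨l, by rw [← (hsome _ _ _ (hshift j)).2, hl]⟩

theorem reverse_initSeg (β : ℕ → ℕ) (k : ℕ) :
    (initSeg β k).reverse = List.ofFn fun i : Fin k => β i := by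
  induction k with
  | zero => simp [initSeg]
  | succ k ih =>
    rw [initSeg, List.reverse_cons, ih, List.ofFn_succ', List.concat_eq_append]
    simp

theorem initSeg_playI (σ : List ℕ → ℕ) (β : ℕ → ℕ) (i : ℕ) :
    initSeg (playI σ β) (2 * i) = runFrom (fun l => σ l.reverse) [] (initSeg β i) := by
  induction i with
  | zero => rfl
  | succ i ih =>
    rw [show 2 * (i + 1) = 2 * i + 1 + 1 by ring, initSeg, initSeg, ih]
    have h1 : playI σ β (2 * i + 1) = β i := by
      have : (2 * i + 1) / 2 = i := by omega
      simp only [playI, this]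
      rw [if_neg (by omega)]
    have h2 : playI σ β (2 * i) = σ (initSeg β i).reverse := by
      have : (2 * i) / 2 = i := by omega
      rw [reverse_initSeg]
      simp only [playI]
      rw [if_pos (by omega), this]
    rw [h1, h2]
    rfl

theorem exists_limit_of_suffix_chain {bs : ℕ → List ℕ} (h : ∀ n, bs n <:+ bs (n + 1)) :
    ∃ β : ℕ → ℕ, ∀ n, initSeg β (bs n).length = bs n := by
  classical
  have hmono : ∀ n m, n ≤ m → bs n <:+ bs m := by
    intro n m hnm
    induction m, hnm using Nat.le_induction with
    | base => exact List.suffix_refl _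
    | succ m _ ih => exact ih.trans (h m)
  have hget : ∀ n m i, n ≤ m → i < (bs n).length →
      (bs m).reverse.getD i 0 = (bs n).reverse.getD i 0 := by
    intro n m i hnm hi
    obtain ⟨l, hl⟩ := hmono n m hnm
    rw [← hl, List.reverse_append, List.getD_append _ _ _ _ (by simpa using hi)]
  refine ⟨fun i => if h : ∃ n, i < (bs n).length then
    (bs (Nat.find h)).reverse.getD i 0 else 0, fun n => eq_initSeg_of_getD fun i hi => ?_⟩
  have hex : ∃ n, i < (bs n).length := ⟨n, hi⟩
  rw [dif_pos hex]
  exact (hget _ n i (Nat.find_min' hex hi) (Nat.find_spec hex)).symm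

theorem mem_gameOp_iff_winPos {C : ℕ → Set ((ℕ → Bool) × (ℕ → ℕ))}
    (hC : ∀ n, IsClosed (C n)) (x : ℕ → Bool) :
    x ∈ GameOp (⋃ n, C n) ↔ WinPos C x ([], 0) := by
  constructor
  · rintro ⟨σ', hσ'⟩
    by_contra hnot
    set σ : List ℕ → ℕ := fun l => σ' l.reverse with hσ
    have step : ∀ (n : ℕ) (bs : List ℕ), ¬ WinPos C x (runFrom σ [] bs, n) →
        ∃ bs', bs <:+ bs' ∧ Refuted C x n (runFrom σ [] bs') ∧
          ¬ WinPos C x (runFrom σ [] bs', n + 1) := by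
      intro n bs hbs
      have : ¬ ∀ k q, childPos C x (runFrom σ [] bs, n)
          (initSeg (fun i => σ (Denumerable.ofNat (List ℕ) i ++ bs)) k) = some q →
            WinPos C x q := fun h => hbs (WinPos.intro _ _ h)
      simp only [not_forall] at this
      obtain ⟨k, q, hkq, hq⟩ := this
      rw [← Denumerable.encode_ofNat (α := List ℕ) k, childPos_initSeg] at hkq
      set β := Denumerable.ofNat (List ℕ) k
      simp only [Denumerable.ofNat_encode] at hkq
      rw [← runFrom_append] at hkq
      split_ifs at hkq with hr
      simp only [Denumerable.ofNat_encode] at hr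
      rw [← runFrom_append] at hr
      refine ⟨β ++ bs, List.suffix_append _ _, hr, ?_⟩
      rw [Option.some.inj hkq]
      exact hq
    choose! nx h1 h2 h3 using step
    let bs : ℕ → List ℕ := fun n => Nat.rec [] (fun k b => nx k b) n
    have hbs : ∀ n, ¬ WinPos C x (runFrom σ [] (bs n), n) := by
      intro n
      induction n with
      | zero => exact hnot
      | succ n ih => exact h3 n _ ih
    obtain ⟨β, hβ⟩ := exists_limit_of_suffix_chain (bs := bs) fun n => h1 n _ (hbs n)
    obtain ⟨n, hn⟩ := mem_iUnion.1 (hσ' β)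
    have hr := h2 n _ (hbs n)
    refine hr x (playI σ' β) (fun _ _ => rfl) ?_ hn
    have hlen : (runFrom σ [] (nx n (bs n))).length = 2 * (bs (n + 1)).length := by
      rw [length_runFrom]; rfl
    rw [hlen, initSeg_playI]
    exact congrArg _ (hβ (n + 1))
  · intro h
    obtain ⟨σ, hσ⟩ := h.exists_winsFrom hC
    refine ⟨fun l => σ l.reverse, fun β => mem_iUnion.2 (hσ β _ fun i => ⟨2 * i, ?_⟩)⟩
    rw [initSeg_playI]
    simp

/-! ### The nested tubes -/

/-- Left end of the tube of a node. -/
noncomputable def tubeL : List ℕ → ℝ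
  | [] => 0
  | n :: s => tubeL s + (List.rec 1 (fun k _ w => w * (1 / 2) ^ k / 4) s / 2) * (1 - (1 / 2) ^ n)

/-- Width of the tube of a node. -/
noncomputable def tubeW (s : List ℕ) : ℝ := List.rec 1 (fun k _ w => w * (1 / 2) ^ k / 4) s

/-- Right end of the tube of a node. -/
noncomputable def tubeR (s : List ℕ) : ℝ := tubeL s + tubeW s

/-- Midpoint of the tube of a node. -/
noncomputable def tubeM (s : List ℕ) : ℝ := tubeL s + tubeW s / 2

theorem tubeW_nil : tubeW [] = 1 := rfl

theorem tubeW_cons (n : ℕ) (s : List ℕ) : tubeW (n :: s) = tubeW s * (1 / 2) ^ n / 4 := rfl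

theorem tubeL_nil : tubeL [] = 0 := rfl

theorem tubeL_cons (n : ℕ) (s : List ℕ) : tubeL (n :: s) = tubeM s - 2 * tubeW (n :: s) := by
  have : tubeL (n :: s) = tubeL s + (tubeW s / 2) * (1 - (1 / 2) ^ n) := rfl
  rw [this, tubeM, tubeW_cons]; ring

theorem tubeR_cons (n : ℕ) (s : List ℕ) : tubeR (n :: s) = tubeM s - tubeW (n :: s) := by
  rw [tubeR, tubeL_cons]; ring

theorem tubeW_pos (s : List ℕ) : 0 < tubeW s := by
  induction s with
  | nil => rw [tubeW_nil]; norm_num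
  | cons n s ih => rw [tubeW_cons]; positivity

theorem tubeW_cons_le (n : ℕ) (s : List ℕ) : tubeW (n :: s) ≤ tubeW s / 4 := by
  rw [tubeW_cons]
  have h1 : ((1 : ℝ) / 2) ^ n ≤ 1 := pow_le_one₀ (by norm_num) (by norm_num)
  nlinarith [tubeW_pos s]

theorem tubeW_le_one (s : List ℕ) : tubeW s ≤ 1 := by
  induction s with
  | nil => rw [tubeW_nil]
  | cons n s ih => linarith [tubeW_cons_le n s]

theorem tubeW_cons_le_pow (n : ℕ) (s : List ℕ) : tubeW (n :: s) ≤ (1 / 2) ^ n := by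
  rw [tubeW_cons]
  have h1 : 0 ≤ ((1 : ℝ) / 2) ^ n := by positivity
  nlinarith [tubeW_le_one s, tubeW_pos s]

theorem tubeM_lt_tubeR (s : List ℕ) : tubeM s < tubeR s := by
  have := tubeW_pos s
  rw [tubeM, tubeR]; linarith

theorem tubeL_lt_tubeM (s : List ℕ) : tubeL s < tubeM s := by
  have := tubeW_pos s
  rw [tubeM]; linarith

theorem tubeL_le_cons (n : ℕ) (s : List ℕ) : tubeL s ≤ tubeL (n :: s) := by
  rw [tubeL_cons, tubeM]; linarith [tubeW_cons_le n s]

theorem tubeR_cons_lt (n : ℕ) (s : List ℕ) : tubeR (n :: s) < tubeM s := by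
  rw [tubeR_cons]; linarith [tubeW_pos (n :: s)]

theorem tubeL_nonneg (s : List ℕ) : 0 ≤ tubeL s := by
  induction s with
  | nil => rw [tubeL_nil]
  | cons n s ih => exact ih.trans (tubeL_le_cons n s)

theorem tubeR_le_one (s : List ℕ) : tubeR s ≤ 1 := by
  induction s with
  | nil => rw [tubeR, tubeL_nil, tubeW_nil]; norm_num
  | cons n s ih => linarith [tubeR_cons_lt n s, tubeM_lt_tubeR s]

theorem tubeM_pos (s : List ℕ) : 0 < tubeM s := (tubeL_nonneg s).trans_lt (tubeL_lt_tubeM s)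

theorem tube_rational (s : List ℕ) : (∃ q : ℚ, tubeL s = q) ∧ ∃ q : ℚ, tubeW s = q := by
  induction s with
  | nil => exact ⟨⟨0, by simp [tubeL_nil]⟩, ⟨1, by simp [tubeW_nil]⟩⟩
  | cons n s ih =>
    obtain ⟨⟨p, hp⟩, ⟨q, hq⟩⟩ := ih
    refine ⟨⟨p + q / 2 - 2 * (q * (1 / 2) ^ n / 4), ?_⟩, ⟨q * (1 / 2) ^ n / 4, ?_⟩⟩
    · rw [tubeL_cons, tubeM, tubeW_cons, hp, hq]; push_cast; ring
    · rw [tubeW_cons, hq]; push_cast; ring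

theorem tubeR_le_tubeL_of_lt {n m : ℕ} (h : n < m) (s : List ℕ) :
    tubeR (n :: s) ≤ tubeL (m :: s) := by
  rw [tubeR_cons, tubeL_cons, tubeW_cons, tubeW_cons]
  have h1 : ((1 : ℝ) / 2) ^ m ≤ (1 / 2) ^ (n + 1) :=
    pow_le_pow_of_le_one (by norm_num) (by norm_num) h
  rw [pow_succ] at h1
  nlinarith [tubeW_pos s]

theorem tubeL_succ (n : ℕ) (s : List ℕ) : tubeL ((n + 1) :: s) = tubeR (n :: s) := by
  rw [tubeR_cons, tubeL_cons, tubeW_cons, tubeW_cons, pow_succ]; ring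

theorem tubeL_zero (s : List ℕ) : tubeL (0 :: s) = tubeL s := by
  rw [tubeL_cons, tubeM, tubeW_cons]; ring

theorem tube_append (l s : List ℕ) : tubeL s ≤ tubeL (l ++ s) ∧ tubeR (l ++ s) ≤ tubeR s := by
  induction l with
  | nil => exact ⟨le_rfl, le_rfl⟩
  | cons n l ih =>
    exact ⟨ih.1.trans (tubeL_le_cons _ _),
      ((tubeR_cons_lt n (l ++ s)).le.trans (tubeM_lt_tubeR _).le).trans ih.2⟩

theorem encode_le_append (l s : List ℕ) : Encodable.encode s ≤ Encodable.encode (l ++ s) := by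
  induction l with
  | nil => exact le_rfl
  | cons n l ih => exact ih.trans (encode_lt_cons _ _).le

/-- `t` is a proper descendant of `s`. -/
def Below (s t : List ℕ) : Prop := ∃ l n, t = n :: (l ++ s)

theorem Below.exists_child {s t : List ℕ} (h : Below s t) : ∃ l k, t = l ++ k :: s := by
  obtain ⟨l, n, rfl⟩ := h
  rcases List.eq_nil_or_concat (n :: l) with h' | ⟨l', k, h'⟩
  · simp at h'
  · exact ⟨l', k, by
      rw [← List.cons_append, h']; simp⟩

theorem Below.tubeR_lt {s t : List ℕ} (h : Below s t) : tubeR t < tubeM s := by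
  obtain ⟨l, k, rfl⟩ := h.exists_child
  exact (tube_append l (k :: s)).2.trans_lt (tubeR_cons_lt k s)

theorem Below.encode_lt {s t : List ℕ} (h : Below s t) :
    Encodable.encode s < Encodable.encode t := by
  obtain ⟨l, n, rfl⟩ := h
  exact (encode_le_append l s).trans_lt (encode_lt_cons _ _)

theorem Below.length_lt {s t : List ℕ} (h : Below s t) : s.length < t.length := by
  obtain ⟨l, n, rfl⟩ := h
  simp only [List.length_cons, List.length_append]
  omega

theorem tube_trichotomy (s t : List ℕ) :
    s = t ∨ Below s t ∨ Below t s ∨ tubeR s ≤ tubeL t ∨ tubeR t ≤ tubeL s := by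
  induction t with
  | nil =>
    cases s with
    | nil => exact Or.inl rfl
    | cons n s => exact Or.inr (Or.inr (Or.inl ⟨s, n, by simp⟩))
  | cons m t ih =>
    have hL := tubeL_le_cons m t
    have hR : tubeR (m :: t) ≤ tubeR t := ((tubeR_cons_lt m t).trans (tubeM_lt_tubeR t)).le
    rcases ih with rfl | ⟨l, n, rfl⟩ | hb | h | h
    · exact Or.inr (Or.inl ⟨[], m, rfl⟩)
    · exact Or.inr (Or.inl ⟨n :: l, m, rfl⟩)
    · obtain ⟨l, k, rfl⟩ := hb.exists_child
      have ht := tube_append l (k :: t)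
      rcases lt_trichotomy k m with hkm | rfl | hkm
      · exact Or.inr (Or.inr (Or.inr (Or.inl (ht.2.trans (tubeR_le_tubeL_of_lt hkm t)))))
      · cases l with
        | nil => exact Or.inl rfl
        | cons n l => exact Or.inr (Or.inr (Or.inl ⟨l, n, rfl⟩))
      · exact Or.inr (Or.inr (Or.inr (Or.inr ((tubeR_le_tubeL_of_lt hkm t).trans ht.1))))
    · exact Or.inr (Or.inr (Or.inr (Or.inl (h.trans hL))))
    · exact Or.inr (Or.inr (Or.inr (Or.inr (hR.trans h))))

/-! ### The cells -/

/-- The pieces of the scaffold: pieces of walls, and rungs. -/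
abbrev Edge := (Option (List ℕ) × ℕ) ⊕ (List ℕ × Bool)

/-- First sheared coordinate. -/
def gc (z : ℝ × ℝ) : ℝ := z.1 - 2 * z.2

/-- Second sheared coordinate. -/
def hc (z : ℝ × ℝ) : ℝ := 1 - 4 * z.2

/-- The point with given sheared coordinates. -/
noncomputable def toPt (g h : ℝ) : ℝ × ℝ := (g + (1 - h) / 2, (1 - h) / 4)

@[simp] theorem gc_toPt (g h : ℝ) : gc (toPt g h) = g := by simp only [gc, toPt]; ring

@[simp] theorem hc_toPt (g h : ℝ) : hc (toPt g h) = h := by simp only [hc, toPt]; ring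

theorem toPt_gc_hc (z : ℝ × ℝ) : toPt (gc z) (hc z) = z := by
  ext <;> simp only [gc, hc, toPt] <;> ring

theorem continuous_gc : Continuous gc := by unfold gc; fun_prop

theorem continuous_hc : Continuous hc := by unfold hc; fun_prop

/-- The triangle in which the construction takes place. -/
def triB : Set (ℝ × ℝ) := {z | 0 ≤ z.2 ∧ z.2 ≤ z.1 ∧ z.2 ≤ 1 - z.1}

/-- The left base vertex. -/
def ptU : ℝ × ℝ := (0, 0)

/-- The right base vertex. -/
def ptV : ℝ × ℝ := (1, 0)

/-- Horizontal position of a wall. -/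
noncomputable def wallPos : Option (List ℕ) → ℝ
  | none => 0
  | some t => tubeR t

/-- Thickness parameter of a wall. -/
noncomputable def wallWidth : Option (List ℕ) → ℝ
  | none => 1
  | some t => tubeW t

/-- Subdivision parameter of a wall. -/
def wallD : Option (List ℕ) → ℕ
  | none => 1
  | some [] => 1
  | some (n :: _) => 2 ^ n

/-- Starting level of a wall. -/
def wallJ : Option (List ℕ) → ℕ
  | none => 1
  | some [] => 1
  | some (_ :: s) => 2 * Encodable.encode s + 4

/-- Height of the vertices of a wall. -/
noncomputable def wallHeight (t : Option (List ℕ)) (m : ℕ) : ℝ :=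
  wallD t / (wallD t * wallJ t + m)

/-- Length of the pieces of a wall. -/
noncomputable def wallLen (t : Option (List ℕ)) (m : ℕ) : ℝ :=
  wallHeight t m - wallHeight t (m + 1)

/-- Level of a rung. -/
def rungJ (s : List ℕ) (i : Bool) : ℕ := 2 * Encodable.encode s + 3 + i.toNat

/-- Width of a rung. -/
noncomputable def rungWd (s : List ℕ) : Bool → ℝ
  | false => tubeW s
  | true => tubeW s / 2

/-- Left end of a rung. -/
noncomputable def rungLeft (s : List ℕ) (i : Bool) : ℝ := tubeR s - rungWd s i

/-- The contraction attached to an edge. -/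
noncomputable def cmap : Edge → ℝ × ℝ → ℝ × ℝ
  | .inl (t, m), z =>
    toPt (wallPos t * (wallHeight t m - z.1 * wallLen t m) -
      z.2 * (wallLen t m * wallWidth t / 8)) (wallHeight t m - z.1 * wallLen t m)
  | .inr (s, i), z =>
    toPt (rungLeft s i * (1 / rungJ s i + z.2 * (1 / rungJ s i) ^ 2) +
      z.1 * rungWd s i * (1 / rungJ s i)) (1 / rungJ s i + z.2 * (1 / rungJ s i) ^ 2)

/-- A bound for the contraction ratio. -/
noncomputable def edgeSize : Edge → ℝ
  | .inl (t, m) => wallLen t m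
  | .inr (s, i) => 3 / 2 * (1 / rungJ s i)

/-! ### Basic estimates for cells -/

theorem triB_bounds {z : ℝ × ℝ} (hz : z ∈ triB) :
    0 ≤ z.2 ∧ z.2 ≤ z.1 ∧ z.2 ≤ 1 - z.1 ∧ 0 ≤ z.1 ∧ z.1 ≤ 1 ∧ z.2 ≤ 1 / 2 := by
  obtain ⟨h1, h2, h3⟩ := hz
  exact ⟨h1, h2, h3, by linarith, by linarith, by linarith⟩

theorem ptU_mem : ptU ∈ triB := by simp [ptU, triB]

theorem ptV_mem : ptV ∈ triB := by simp [ptV, triB]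

theorem eq_ptU {z : ℝ × ℝ} (hz : z ∈ triB) (h : z.1 ≤ 0) : z = ptU := by
  have := triB_bounds hz
  ext <;> simp only [ptU] <;> linarith

theorem eq_ptV {z : ℝ × ℝ} (hz : z ∈ triB) (h : 1 ≤ z.1) : z = ptV := by
  have := triB_bounds hz
  ext <;> simp only [ptV] <;> linarith

theorem wallD_pos (t : Option (List ℕ)) : 1 ≤ wallD t := by
  rcases t with _ | _ | ⟨n, s⟩ <;> simp [wallD, Nat.one_le_two_pow]

theorem wallJ_pos (t : Option (List ℕ)) : 1 ≤ wallJ t := by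
  rcases t with _ | _ | ⟨n, s⟩ <;> simp [wallJ]

theorem wallPos_nonneg (t : Option (List ℕ)) : 0 ≤ wallPos t := by
  rcases t with _ | t
  · exact le_rfl
  · exact (tubeM_pos t).le.trans (tubeM_lt_tubeR t).le

theorem wallPos_le_one (t : Option (List ℕ)) : wallPos t ≤ 1 := by
  rcases t with _ | t
  · exact zero_le_one
  · exact tubeR_le_one t

theorem wallWidth_pos (t : Option (List ℕ)) : 0 < wallWidth t := by
  rcases t with _ | t
  · exact one_pos
  · exact tubeW_pos t

theorem wallWidth_le_one (t : Option (List ℕ)) : wallWidth t ≤ 1 := by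
  rcases t with _ | t
  · exact le_rfl
  · exact tubeW_le_one t

theorem wallD_pos_real (t : Option (List ℕ)) : (1 : ℝ) ≤ wallD t := by
  exact_mod_cast wallD_pos t

theorem wallJ_pos_real (t : Option (List ℕ)) : (1 : ℝ) ≤ wallJ t := by
  exact_mod_cast wallJ_pos t

theorem wall_denom_pos (t : Option (List ℕ)) (m : ℕ) : (1 : ℝ) ≤ wallD t * wallJ t + m := by
  have h1 := wallD_pos_real t
  have h2 := wallJ_pos_real t
  have h3 : (0 : ℝ) ≤ m := Nat.cast_nonneg m
  nlinarith

theorem wallHeight_pos (t : Option (List ℕ)) (m : ℕ) : 0 < wallHeight t m := by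
  have h1 := wallD_pos_real t
  have h2 := wall_denom_pos t m
  unfold wallHeight
  positivity

theorem wallHeight_anti (t : Option (List ℕ)) {m k : ℕ} (h : m ≤ k) :
    wallHeight t k ≤ wallHeight t m := by
  have h1 := wallD_pos_real t
  have h2 := wall_denom_pos t m
  have h3 : (m : ℝ) ≤ k := by exact_mod_cast h
  unfold wallHeight
  exact div_le_div_of_nonneg_left (by linarith) (by linarith) (by linarith)

theorem wallHeight_zero (t : Option (List ℕ)) : wallHeight t 0 = 1 / wallJ t := by
  have h1 := wallD_pos_real t
  have h2 := wallJ_pos_real t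
  unfold wallHeight
  field_simp
  simp

theorem wallHeight_le (t : Option (List ℕ)) (m : ℕ) : wallHeight t m ≤ 1 / wallJ t := by
  rw [← wallHeight_zero]; exact wallHeight_anti t (Nat.zero_le m)

theorem wallHeight_le_one (t : Option (List ℕ)) (m : ℕ) : wallHeight t m ≤ 1 := by
  refine (wallHeight_le t m).trans ?_
  rw [div_le_one (by linarith [wallJ_pos_real t])]
  exact wallJ_pos_real t

theorem wallHeight_succ_lt (t : Option (List ℕ)) (m : ℕ) :
    wallHeight t (m + 1) < wallHeight t m := by
  have h1 := wallD_pos_real t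
  have h2 := wall_denom_pos t m
  unfold wallHeight
  refine div_lt_div_of_pos_left (by linarith) (by linarith) ?_
  push_cast
  linarith

theorem wallLen_pos (t : Option (List ℕ)) (m : ℕ) : 0 < wallLen t m :=
  sub_pos.2 (wallHeight_succ_lt t m)

theorem wallLen_eq (t : Option (List ℕ)) (m : ℕ) :
    wallLen t m = wallHeight t m / (wallD t * wallJ t + m + 1) := by
  have h2 := wall_denom_pos t m
  unfold wallLen wallHeight
  push_cast
  have h3 : (wallD t * wallJ t + m : ℝ) ≠ 0 := by linarith
  have h4 : (wallD t * wallJ t + m + 1 : ℝ) ≠ 0 := by linarith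
  have h5 : (wallD t * wallJ t + (m + 1) : ℝ) ≠ 0 := by linarith
  field_simp
  ring

theorem wallLen_le (t : Option (List ℕ)) (m : ℕ) :
    wallLen t m ≤ 1 / (wallD t * wallJ t + m + 1) := by
  rw [wallLen_eq]
  have h2 := wall_denom_pos t m
  exact div_le_div_of_nonneg_right (wallHeight_le_one t m) (by linarith)

theorem wallLen_le_half (t : Option (List ℕ)) (m : ℕ) : wallLen t m ≤ 1 / 2 := by
  refine (wallLen_le t m).trans ?_
  have h2 := wall_denom_pos t m
  exact one_div_le_one_div_of_le (by norm_num) (by linarith)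

theorem rungJ_ge (s : List ℕ) (i : Bool) : (3 : ℝ) ≤ rungJ s i := by
  have : 3 ≤ rungJ s i := by unfold rungJ; omega
  exact_mod_cast this

theorem rungH_pos (s : List ℕ) (i : Bool) : (0 : ℝ) < 1 / rungJ s i := by
  have := rungJ_ge s i
  positivity

theorem rungH_le (s : List ℕ) (i : Bool) : (1 : ℝ) / rungJ s i ≤ 1 / 3 :=
  one_div_le_one_div_of_le (by norm_num) (rungJ_ge s i)

theorem rungWd_pos (s : List ℕ) (i : Bool) : 0 < rungWd s i := by
  have := tubeW_pos s
  cases i <;> simp only [rungWd] <;> linarith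

theorem rungWd_le (s : List ℕ) (i : Bool) : tubeW s / 2 ≤ rungWd s i ∧ rungWd s i ≤ tubeW s := by
  have := tubeW_pos s
  cases i <;> simp only [rungWd] <;> constructor <;> linarith

theorem rungLeft_false (s : List ℕ) : rungLeft s false = tubeL s := by
  simp only [rungLeft, rungWd, tubeR]; ring

theorem rungLeft_true (s : List ℕ) : rungLeft s true = tubeM s := by
  simp only [rungLeft, rungWd, tubeR, tubeM]; ring

theorem tubeL_le_rungLeft (s : List ℕ) (i : Bool) : tubeL s ≤ rungLeft s i := by
  cases i
  · rw [rungLeft_false]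
  · rw [rungLeft_true]; exact (tubeL_lt_tubeM s).le

theorem rungLeft_nonneg (s : List ℕ) (i : Bool) : 0 ≤ rungLeft s i :=
  (tubeL_nonneg s).trans (tubeL_le_rungLeft s i)

theorem wall_facts (t : Option (List ℕ)) (m : ℕ) {z : ℝ × ℝ} (hz : z ∈ triB) :
    hc (cmap (.inl (t, m)) z) = wallHeight t m - z.1 * wallLen t m ∧
    wallHeight t (m + 1) ≤ hc (cmap (.inl (t, m)) z) ∧
    hc (cmap (.inl (t, m)) z) ≤ wallHeight t m ∧
    gc (cmap (.inl (t, m)) z) =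
      wallPos t * hc (cmap (.inl (t, m)) z) - z.2 * wallLen t m * wallWidth t / 8 ∧
    z.2 * wallLen t m ≤ hc (cmap (.inl (t, m)) z) - wallHeight t (m + 1) ∧
    0 ≤ z.2 * wallLen t m := by
  have hb := triB_bounds hz
  have hl := wallLen_pos t m
  have he : wallHeight t (m + 1) = wallHeight t m - wallLen t m := by unfold wallLen; ring
  refine ⟨by simp [cmap], ?_, ?_, ?_, ?_, by nlinarith⟩ <;> simp only [cmap, hc_toPt, gc_toPt]
  · rw [he]; nlinarith
  · nlinarith
  · ring
  · rw [he]; nlinarith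

theorem rung_facts (s : List ℕ) (i : Bool) {z : ℝ × ℝ} (hz : z ∈ triB) :
    hc (cmap (.inr (s, i)) z) = 1 / rungJ s i + z.2 * (1 / rungJ s i) ^ 2 ∧
    1 / rungJ s i ≤ hc (cmap (.inr (s, i)) z) ∧
    gc (cmap (.inr (s, i)) z) = rungLeft s i * hc (cmap (.inr (s, i)) z) +
      z.1 * rungWd s i * (1 / rungJ s i) ∧
    gc (cmap (.inr (s, i)) z) = tubeR s * hc (cmap (.inr (s, i)) z) -
      rungWd s i * ((1 - z.1) * (1 / rungJ s i) + z.2 * (1 / rungJ s i) ^ 2) ∧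
    0 ≤ z.1 * rungWd s i * (1 / rungJ s i) ∧
    0 ≤ z.2 * (1 / rungJ s i) ^ 2 ∧ 0 ≤ (1 - z.1) * ((1 : ℝ) / rungJ s i) := by
  have hb := triB_bounds hz
  have hh := rungH_pos s i
  have hw := rungWd_pos s i
  have h5 : 0 ≤ z.2 * ((1 : ℝ) / rungJ s i) ^ 2 := mul_nonneg hb.1 (by positivity)
  refine ⟨by simp [cmap], ?_, ?_, ?_, ?_, h5, ?_⟩
  · simp only [cmap, hc_toPt]; linarith
  · simp only [cmap, hc_toPt, gc_toPt]
  · simp only [cmap, hc_toPt, gc_toPt, rungLeft]; ring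
  · exact mul_nonneg (mul_nonneg hb.2.2.2.1 hw.le) hh.le
  · exact mul_nonneg (by linarith [hb.2.2.2.2.1]) hh.le

theorem rung_hc_lt (s : List ℕ) (i : Bool) {z : ℝ × ℝ} (hz : z ∈ triB) :
    hc (cmap (.inr (s, i)) z) < 1 / (rungJ s i - 1) ∧ hc (cmap (.inr (s, i)) z) ≤ 1 / 2 := by
  have hb := triB_bounds hz
  have hj := rungJ_ge s i
  have h3 := rungH_le s i
  have h0 := rungH_pos s i
  rw [(rung_facts s i hz).1]
  constructor
  · rw [lt_div_iff₀ (by linarith)]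
    set h := (1 : ℝ) / rungJ s i with hh
    have : h * rungJ s i = 1 := by rw [hh]; field_simp
    have h1 : (h + z.2 * h ^ 2) * (rungJ s i - 1) =
      h * rungJ s i - h + z.2 * h * (h * rungJ s i) - z.2 * h ^ 2 := by ring
    rw [h1, this]
    nlinarith [mul_nonneg hb.1 (sq_nonneg h)]
  · nlinarith [mul_nonneg hb.1 (sq_nonneg ((1 : ℝ) / rungJ s i))]

theorem hc_cmap_pos (e : Edge) {z : ℝ × ℝ} (hz : z ∈ triB) : 0 < hc (cmap e z) := by
  rcases e with ⟨t, m⟩ | ⟨s, i⟩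
  · exact (wallHeight_pos t (m + 1)).trans_le (wall_facts t m hz).2.1
  · exact (rungH_pos s i).trans_le (rung_facts s i hz).2.1

theorem hc_cmap_le_one (e : Edge) {z : ℝ × ℝ} (hz : z ∈ triB) : hc (cmap e z) ≤ 1 := by
  rcases e with ⟨t, m⟩ | ⟨s, i⟩
  · exact (wall_facts t m hz).2.2.1.trans (wallHeight_le_one t m)
  · linarith [(rung_hc_lt s i hz).2]

theorem mem_triB_iff (z : ℝ × ℝ) :
    z ∈ triB ↔ hc z ≤ 1 ∧ -((1 - hc z) / 4) ≤ gc z ∧ gc z ≤ hc z + (1 - hc z) / 4 := by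
  simp only [triB, mem_ofPred_eq, hc, gc]
  constructor
  · rintro ⟨h1, h2, h3⟩
    exact ⟨by linarith, by linarith, by linarith⟩
  · rintro ⟨h1, h2, h3⟩
    exact ⟨by linarith, by linarith, by linarith⟩

/-- Location of the points of a wall. -/
theorem wall_zone (t : List ℕ) (m : ℕ) {z : ℝ × ℝ} (hz : z ∈ triB) :
    tubeM t * hc (cmap (.inl (some t, m)) z) < gc (cmap (.inl (some t, m)) z) ∧
    gc (cmap (.inl (some t, m)) z) ≤ tubeR t * hc (cmap (.inl (some t, m)) z) := by
  obtain ⟨h1, h2, h3, h4, h5, h6⟩ := wall_facts (some t) m hz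
  have hp := wallHeight_pos (some t) (m + 1)
  have hw := tubeW_pos t
  rw [h4]
  simp only [wallPos, wallWidth]
  have : tubeR t = tubeM t + tubeW t / 2 := by simp only [tubeR, tubeM]; ring
  constructor
  · rw [this]; nlinarith
  · nlinarith

theorem wall_none_zone (m : ℕ) {z : ℝ × ℝ} (hz : z ∈ triB) :
    gc (cmap (.inl (none, m)) z) = - (z.2 * wallLen none m / 8) ∧
    gc (cmap (.inl (none, m)) z) ≤ 0 ∧
      - hc (cmap (.inl (none, m)) z) ≤ gc (cmap (.inl (none, m)) z) := by
  obtain ⟨h1, h2, h3, h4, h5, h6⟩ := wall_facts none m hz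
  have hp := wallHeight_pos none (m + 1)
  have : gc (cmap (.inl (none, m)) z) = - (z.2 * wallLen none m / 8) := by
    rw [h4]; simp only [wallPos, wallWidth]; ring
  rw [this]
  exact ⟨rfl, by linarith, by linarith⟩

/-- Location of the points of a rung. -/
theorem rung_zone (s : List ℕ) (i : Bool) {z : ℝ × ℝ} (hz : z ∈ triB) :
    rungLeft s i * hc (cmap (.inr (s, i)) z) ≤ gc (cmap (.inr (s, i)) z) ∧
    gc (cmap (.inr (s, i)) z) ≤ tubeR s * hc (cmap (.inr (s, i)) z) := by
  obtain ⟨h1, h2, h3, h4, h5, h6, h7⟩ := rung_facts s i hz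
  constructor
  · rw [h3]; linarith
  · rw [h4]; nlinarith [rungWd_pos s i]

theorem gc_cmap_bounds (e : Edge) {z : ℝ × ℝ} (hz : z ∈ triB) :
    |gc (cmap e z)| ≤ hc (cmap e z) ∧ gc (cmap e z) ≤ hc (cmap e z) ∧
      (0 ≤ gc (cmap e z) ∨ ∃ m, e = .inl (none, m)) := by
  have hp := hc_cmap_pos e hz
  have key : (-hc (cmap e z) ≤ gc (cmap e z) ∧ gc (cmap e z) ≤ hc (cmap e z)) ∧
      (0 ≤ gc (cmap e z) ∨ ∃ m, e = .inl (none, m)) := by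
    rcases e with ⟨t | t, m⟩ | ⟨s, i⟩
    · have := wall_none_zone m hz
      exact ⟨⟨this.2.2, by linarith [this.2.1]⟩, Or.inr ⟨m, rfl⟩⟩
    · have h := wall_zone t m hz
      have h1 := tubeM_pos t
      have h2 := tubeR_le_one t
      have h3 : 0 ≤ gc (cmap (.inl (some t, m)) z) := by nlinarith
      exact ⟨⟨by linarith, by nlinarith⟩, Or.inl h3⟩
    · have h := rung_zone s i hz
      have h1 := rungLeft_nonneg s i
      have h2 := tubeR_le_one s
      have h3 : 0 ≤ gc (cmap (.inr (s, i)) z) := by nlinarith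
      exact ⟨⟨by linarith, by nlinarith⟩, Or.inl h3⟩
  exact ⟨abs_le.2 key.1, key.1.2, key.2⟩

theorem cmap_mem (e : Edge) {z : ℝ × ℝ} (hz : z ∈ triB) : cmap e z ∈ triB := by
  have h1 := hc_cmap_le_one e hz
  obtain ⟨-, h2, h3⟩ := gc_cmap_bounds e hz
  rw [mem_triB_iff]
  refine ⟨h1, ?_, by linarith⟩
  rcases h3 with h3 | ⟨m, rfl⟩
  · linarith
  · obtain ⟨f1, f2, f3, f4, f5, f6⟩ := wall_facts none m hz
    have hb := triB_bounds hz
    have hh := wallHeight_le_one none m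
    rw [(wall_none_zone m hz).1, f1]
    nlinarith [wallLen_pos none m]

theorem edgeSize_pos (e : Edge) : 0 < edgeSize e := by
  rcases e with ⟨t, m⟩ | ⟨s, i⟩
  · exact wallLen_pos t m
  · have := rungH_pos s i
    simp only [edgeSize]; positivity

theorem edgeSize_le_half (e : Edge) : edgeSize e ≤ 1 / 2 := by
  rcases e with ⟨t, m⟩ | ⟨s, i⟩
  · exact wallLen_le_half t m
  · have := rungH_le s i
    simp only [edgeSize]; linarith

theorem dist_toPt_le (g h g' h' : ℝ) :
    dist (toPt g h) (toPt g' h') ≤ |(g - g') - (h - h') / 2| ⊔ |h - h'| / 4 := by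
  rw [Prod.dist_eq, Real.dist_eq, Real.dist_eq]
  refine max_le_max ?_ ?_
  · simp only [toPt]
    apply le_of_eq
    congr 1; ring
  · simp only [toPt]
    rw [show (1 - h) / 4 - (1 - h') / 4 = -((h - h') / 4) by ring, abs_neg, abs_div]
    norm_num

theorem dist_cmap_le (e : Edge) (z w : ℝ × ℝ) :
    dist (cmap e z) (cmap e w) ≤ edgeSize e * dist z w := by
  have h1 : |z.1 - w.1| ≤ dist z w := by
    rw [Prod.dist_eq, Real.dist_eq]; exact le_max_left _ _
  have h2 : |z.2 - w.2| ≤ dist z w := by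
    rw [Prod.dist_eq, Real.dist_eq z.2]; exact le_max_right _ _
  set d := dist z w
  have hd : 0 ≤ d := (abs_nonneg _).trans h1
  rw [abs_le] at h1 h2
  rcases e with ⟨t, m⟩ | ⟨s, i⟩
  · refine (dist_toPt_le _ _ _ _).trans ?_
    have hl := wallLen_pos t m
    have hp0 := wallPos_nonneg t
    have hp1 := wallPos_le_one t
    have hw0 := wallWidth_pos t
    have hw1 := wallWidth_le_one t
    simp only [edgeSize]
    have e1 : wallPos t * (wallHeight t m - z.1 * wallLen t m) -
        z.2 * (wallLen t m * wallWidth t / 8) -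
        (wallPos t * (wallHeight t m - w.1 * wallLen t m) -
        w.2 * (wallLen t m * wallWidth t / 8)) -
        (wallHeight t m - z.1 * wallLen t m - (wallHeight t m - w.1 * wallLen t m)) / 2 =
        wallLen t m * ((1 / 2 - wallPos t) * (z.1 - w.1) - wallWidth t / 8 * (z.2 - w.2)) := by
      ring
    have e2 : wallHeight t m - z.1 * wallLen t m - (wallHeight t m - w.1 * wallLen t m) =
        wallLen t m * -(z.1 - w.1) := by ring
    rw [e1, e2, abs_mul, abs_mul, abs_of_pos hl]
    refine max_le (mul_le_mul_of_nonneg_left ?_ hl.le) ?_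
    · have a1 : |(1 / 2 - wallPos t) * (z.1 - w.1)| ≤ 1 / 2 * d := by
        rw [abs_mul]
        exact mul_le_mul (abs_le.2 ⟨by linarith, by linarith⟩) (abs_le.2 h1) (abs_nonneg _)
          (by norm_num)
      have a2 : |wallWidth t / 8 * (z.2 - w.2)| ≤ 1 / 8 * d := by
        rw [abs_mul]
        exact mul_le_mul (abs_le.2 ⟨by linarith, by linarith⟩) (abs_le.2 h2) (abs_nonneg _)
          (by norm_num)
      have := abs_sub ((1 / 2 - wallPos t) * (z.1 - w.1)) (wallWidth t / 8 * (z.2 - w.2))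
      linarith
    · have a1 : |-(z.1 - w.1)| ≤ d := by rw [abs_neg]; exact abs_le.2 h1
      have := mul_le_mul_of_nonneg_left a1 hl.le
      nlinarith [mul_nonneg hl.le (abs_nonneg (-(z.1 - w.1)))]
  · refine (dist_toPt_le _ _ _ _).trans ?_
    have hh := rungH_pos s i
    have hh3 := rungH_le s i
    have hl0 := rungLeft_nonneg s i
    have hl1 : rungLeft s i ≤ 1 := by
      have := rungWd_pos s i
      have := tubeR_le_one s
      unfold rungLeft; linarith
    have hw0 := rungWd_pos s i
    have hw1 := (rungWd_le s i).2.trans (tubeW_le_one s)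
    simp only [edgeSize]
    set h := (1 : ℝ) / rungJ s i
    have e1 : rungLeft s i * (h + z.2 * h ^ 2) + z.1 * rungWd s i * h -
        (rungLeft s i * (h + w.2 * h ^ 2) + w.1 * rungWd s i * h) -
        (h + z.2 * h ^ 2 - (h + w.2 * h ^ 2)) / 2 =
        h * (h * (rungLeft s i - 1 / 2) * (z.2 - w.2) + rungWd s i * (z.1 - w.1)) := by ring
    have e2 : h + z.2 * h ^ 2 - (h + w.2 * h ^ 2) = h * (h * (z.2 - w.2)) := by ring
    rw [e1, e2, abs_mul, abs_mul, abs_of_pos hh]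
    have a2 : |h * (z.2 - w.2)| ≤ 1 / 3 * d := by
      rw [abs_mul]
      exact mul_le_mul (abs_le.2 ⟨by linarith, by linarith⟩) (abs_le.2 h2) (abs_nonneg _)
        (by norm_num)
    refine max_le ?_ ?_
    · have a1 : |h * (rungLeft s i - 1 / 2) * (z.2 - w.2)| ≤ 1 / 2 * d := by
        rw [abs_mul]
        exact mul_le_mul (abs_le.2 ⟨by nlinarith, by nlinarith⟩) (abs_le.2 h2) (abs_nonneg _)
          (by norm_num)
      have a3 : |rungWd s i * (z.1 - w.1)| ≤ 1 * d := by
        rw [abs_mul]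
        exact mul_le_mul (abs_le.2 ⟨by linarith, by linarith⟩) (abs_le.2 h1) (abs_nonneg _)
          (by norm_num)
      have := abs_add_le (h * (rungLeft s i - 1 / 2) * (z.2 - w.2)) (rungWd s i * (z.1 - w.1))
      calc _ ≤ h * (3 / 2 * d) := mul_le_mul_of_nonneg_left (by linarith) hh.le
        _ = _ := by ring
    · have := mul_le_mul_of_nonneg_left a2 hh.le
      nlinarith [mul_nonneg hh.le hd]

theorem continuous_cmap (e : Edge) : Continuous (cmap e) := by
  refine LipschitzWith.continuous (K := ⟨edgeSize e, (edgeSize_pos e).le⟩) ?_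
  exact LipschitzWith.of_dist_le_mul fun z w => dist_cmap_le e z w

theorem cmap_injective (e : Edge) : Function.Injective (cmap e) := by
  intro z w hzw
  have hg := congrArg gc hzw
  have hh := congrArg hc hzw
  rcases e with ⟨t, m⟩ | ⟨s, i⟩
  · simp only [cmap, gc_toPt, hc_toPt] at hg hh
    have hl := wallLen_pos t m
    have hw := wallWidth_pos t
    have h1 : z.1 = w.1 := mul_right_cancel₀ hl.ne' (by linarith)
    rw [h1] at hg
    have h2 : z.2 = w.2 := mul_right_cancel₀ (b := wallLen t m * wallWidth t / 8)
      (by positivity) (by linarith)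
    exact Prod.ext h1 h2
  · simp only [cmap, gc_toPt, hc_toPt] at hg hh
    have hp := rungH_pos s i
    have hw := rungWd_pos s i
    have h2 : z.2 = w.2 := mul_right_cancel₀ (b := ((1 : ℝ) / rungJ s i) ^ 2)
      (by positivity) (by linarith)
    rw [h2] at hg
    have h1 : z.1 = w.1 := mul_right_cancel₀ (b := rungWd s i * ((1 : ℝ) / rungJ s i))
      (by positivity) (by linarith)
    exact Prod.ext h1 h2

theorem isCompact_triB : IsCompact triB := by
  have hcl : IsClosed triB := by
    have : triB = {z : ℝ × ℝ | 0 ≤ z.2} ∩ ({z | z.2 ≤ z.1} ∩ {z | z.2 ≤ 1 - z.1}) := rfl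
    rw [this]
    exact (isClosed_le (by fun_prop) (by fun_prop)).inter
      ((isClosed_le (by fun_prop) (by fun_prop)).inter (isClosed_le (by fun_prop) (by fun_prop)))
  refine IsCompact.of_isClosed_subset (isCompact_Icc (a := ((0 : ℝ), (0 : ℝ)))
    (b := ((1 : ℝ), (1 : ℝ)))) hcl ?_
  intro z hz
  have := triB_bounds hz
  exact ⟨⟨by simp only; linarith, by simp only; linarith⟩,
    ⟨by simp only; linarith, by simp only; linarith⟩⟩

theorem dist_le_one_of_mem_triB {z w : ℝ × ℝ} (hz : z ∈ triB) (hw : w ∈ triB) :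
    dist z w ≤ 1 := by
  have h1 := triB_bounds hz
  have h2 := triB_bounds hw
  rw [Prod.dist_eq, Real.dist_eq, Real.dist_eq]
  exact max_le (abs_le.2 ⟨by linarith, by linarith⟩) (abs_le.2 ⟨by linarith, by linarith⟩)

/-! ### Incidences between cells -/

theorem wallHeight_eq_one_div {t : Option (List ℕ)} {m j : ℕ}
    (h : wallD t * j = wallD t * wallJ t + m) : wallHeight t m = 1 / j := by
  have h1 := wallD_pos_real t
  have h2 : (wallD t * wallJ t + m : ℝ) = wallD t * j := by exact_mod_cast h.symm
  unfold wallHeight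
  rw [h2, div_mul_eq_div_div, div_self (by linarith)]

theorem wall_vertex_of_height {t : Option (List ℕ)} {m : ℕ} {z : ℝ × ℝ} (hz : z ∈ triB)
    {j : ℕ} (hj : 0 < j) (h : hc (cmap (.inl (t, m)) z) = 1 / j) : z = ptU ∨ z = ptV := by
  obtain ⟨h1, h2, h3, -⟩ := wall_facts t m hz
  have hl := wallLen_pos t m
  have hD := wallD_pos_real t
  have hd := wall_denom_pos t m
  have hj' : (0 : ℝ) < j := by exact_mod_cast hj
  rw [h] at h1 h2 h3
  have h2' : wallD t * j ≤ wallD t * wallJ t + (m + 1) := by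
    have : (wallD t : ℝ) * j ≤ wallD t * wallJ t + (m + 1) := by
      unfold wallHeight at h2
      push_cast at h2
      rw [div_le_div_iff₀ (by linarith) hj'] at h2
      linarith
    exact_mod_cast this
  have h3' : wallD t * wallJ t + m ≤ wallD t * j := by
    have : (wallD t : ℝ) * wallJ t + m ≤ wallD t * j := by
      unfold wallHeight at h3
      rw [div_le_div_iff₀ hj' (by linarith)] at h3
      linarith
    exact_mod_cast this
  rcases (by omega : wallD t * j = wallD t * wallJ t + m ∨
    wallD t * j = wallD t * wallJ t + (m + 1)) with h4 | h4
  · left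
    rw [wallHeight_eq_one_div h4] at h1
    have : z.1 * wallLen t m = 0 := by linarith
    exact eq_ptU hz (by
      rcases mul_eq_zero.1 this with h | h
      · exact h.le
      · exact absurd h hl.ne')
  · right
    have h5 := wallHeight_eq_one_div h4
    have : (1 - z.1) * wallLen t m = 0 := by
      have : wallLen t m = wallHeight t m - wallHeight t (m + 1) := rfl
      linarith
    refine eq_ptV hz ?_
    rcases mul_eq_zero.1 this with h | h
    · linarith
    · exact absurd h hl.ne'

theorem tube_zone_disjoint {s t : List ℕ} (h : s ≠ t) :
    tubeR s ≤ tubeM t ∨ tubeR t ≤ tubeM s := by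
  rcases tube_trichotomy s t with h1 | h1 | h1 | h1 | h1
  · exact absurd h1 h
  · exact Or.inr h1.tubeR_lt.le
  · exact Or.inl h1.tubeR_lt.le
  · exact Or.inl (h1.trans (tubeL_lt_tubeM t).le)
  · exact Or.inr (h1.trans (tubeL_lt_tubeM s).le)

theorem Below.le_wallJ {s t : List ℕ} (h : Below s t) :
    2 * Encodable.encode s + 4 ≤ wallJ (some t) := by
  obtain ⟨l, n, rfl⟩ := h
  have := encode_le_append l s
  simp only [wallJ]
  omega

theorem wallJ_le_rungJ (s : List ℕ) (i : Bool) : wallJ (some s) ≤ rungJ s i := by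
  rcases s with _ | ⟨n, s⟩
  · simp only [wallJ, rungJ]; omega
  · have := encode_lt_cons n s
    simp only [wallJ, rungJ]; omega

theorem rungJ_injective {s s' : List ℕ} {i i' : Bool} (h : rungJ s i = rungJ s' i') :
    s = s' ∧ i = i' := by
  unfold rungJ at h
  have h1 : Encodable.encode s = Encodable.encode s' := by
    have := Bool.toNat_le i
    have := Bool.toNat_le i'
    omega
  refine ⟨Encodable.encode_injective h1, ?_⟩
  rw [h1] at h
  cases i <;> cases i' <;> simp_all

theorem rung_rung_disjoint {s s' : List ℕ} {i i' : Bool} {z z' : ℝ × ℝ} (hz : z ∈ triB)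
    (hz' : z' ∈ triB) (h : cmap (.inr (s, i)) z = cmap (.inr (s', i')) z') :
    s = s' ∧ i = i' := by
  have key : ∀ {s s' : List ℕ} {i i' : Bool} {z z' : ℝ × ℝ}, z ∈ triB → z' ∈ triB →
      cmap (.inr (s, i)) z = cmap (.inr (s', i')) z' → ¬ rungJ s i < rungJ s' i' := by
    intro s s' i i' z z' hz hz' h hlt
    have h1 := (rung_facts s i hz).2.1
    have h2 := (rung_hc_lt s' i' hz').1
    rw [← h] at h2
    have h3 : (rungJ s i : ℝ) ≤ rungJ s' i' - 1 := by
      have : rungJ s i + 1 ≤ rungJ s' i' := hlt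
      have : (rungJ s i : ℝ) + 1 ≤ rungJ s' i' := by exact_mod_cast this
      linarith
    have h4 := one_div_le_one_div_of_le (by linarith [rungJ_ge s i]) h3
    linarith
  exact rungJ_injective (le_antisymm (not_lt.1 (key hz' hz h.symm)) (not_lt.1 (key hz hz' h)))

theorem wall_wall_incidence {t t' : Option (List ℕ)} {m m' : ℕ} {z z' : ℝ × ℝ} (hz : z ∈ triB)
    (hz' : z' ∈ triB) (hne : (t, m) ≠ (t', m'))
    (h : cmap (.inl (t, m)) z = cmap (.inl (t', m')) z') :
    (z = ptU ∨ z = ptV) ∧ (z' = ptU ∨ z' = ptV) := by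
  have hp := hc_cmap_pos (.inl (t, m)) hz
  by_cases ht : t = t'
  · subst ht
    have hm : m ≠ m' := fun h => hne (by rw [h])
    have key : ∀ {m m' : ℕ} {z z' : ℝ × ℝ}, z ∈ triB → z' ∈ triB → m < m' →
        cmap (.inl (t, m)) z = cmap (.inl (t, m')) z' → z = ptV ∧ z' = ptU := by
      intro m m' z z' hz hz' hlt h
      obtain ⟨a1, a2, a3, -⟩ := wall_facts t m hz
      obtain ⟨b1, b2, b3, -⟩ := wall_facts t m' hz'
      rw [← h] at b1 b2 b3
      have h1 := wallHeight_anti t (Nat.succ_le_of_lt hlt)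
      have h2 := wallLen_pos t m
      have h3 := wallLen_pos t m'
      have h4 : wallLen t m = wallHeight t m - wallHeight t (m + 1) := rfl
      have hb := triB_bounds hz
      have hb' := triB_bounds hz'
      rw [Nat.succ_eq_add_one] at h1
      constructor
      · refine eq_ptV hz ?_
        have : (1 - z.1) * wallLen t m ≤ 0 := by nlinarith
        nlinarith
      · refine eq_ptU hz' ?_
        have : z'.1 * wallLen t m' ≤ 0 := by linarith
        nlinarith
    rcases lt_or_gt_of_ne hm with h' | h'
    · have := key hz hz' h' h
      exact ⟨Or.inr this.1, Or.inl this.2⟩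
    · have := key hz' hz h' h.symm
      exact ⟨Or.inl this.2, Or.inr this.1⟩
  · exfalso
    rcases t with _ | t <;> rcases t' with _ | t'
    · exact ht rfl
    · have h1 := wall_none_zone m hz
      have h2 := wall_zone t' m' hz'
      rw [← h] at h2
      have := tubeM_pos t'
      nlinarith
    · have h1 := wall_none_zone m' hz'
      have h2 := wall_zone t m hz
      rw [← h] at h1
      have := tubeM_pos t
      nlinarith
    · have h1 := wall_zone t m hz
      have h2 := wall_zone t' m' hz'
      rw [← h] at h2
      rcases tube_zone_disjoint (fun h => ht (congrArg some h) : t ≠ t') with h3 | h3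
      · nlinarith
      · nlinarith

theorem rung_vertexU {s : List ℕ} {i : Bool} {z : ℝ × ℝ} (hz : z ∈ triB)
    (h : gc (cmap (.inr (s, i)) z) ≤ rungLeft s i * hc (cmap (.inr (s, i)) z)) : z = ptU := by
  obtain ⟨h1, h2, h3, h4, h5, h6, h7⟩ := rung_facts s i hz
  refine eq_ptU hz ?_
  have := rungH_pos s i
  have := rungWd_pos s i
  have h8 : z.1 * (rungWd s i * (1 / rungJ s i)) ≤ 0 := by rw [← mul_assoc]; linarith
  by_contra hlt
  rw [not_le] at hlt
  have : 0 < z.1 * (rungWd s i * (1 / rungJ s i)) := by positivity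
  linarith

theorem wall_rung_incidence {t : Option (List ℕ)} {m : ℕ} {s : List ℕ} {i : Bool}
    {z z' : ℝ × ℝ} (hz : z ∈ triB) (hz' : z' ∈ triB)
    (h : cmap (.inl (t, m)) z = cmap (.inr (s, i)) z') :
    (z = ptU ∨ z = ptV) ∧ (z' = ptU ∨ z' = ptV) := by
  have hp := hc_cmap_pos (.inl (t, m)) hz
  have hrz := rung_zone s i hz'
  have hl0 := rungLeft_nonneg s i
  have hll := tubeL_le_rungLeft s i
  have hj : 0 < rungJ s i := by unfold rungJ; omega
  have hvU : gc (cmap (.inr (s, i)) z') ≤ rungLeft s i * hc (cmap (.inr (s, i)) z') →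
      (z = ptU ∨ z = ptV) ∧ (z' = ptU ∨ z' = ptV) := by
    intro h'
    have hU := rung_vertexU hz' h'
    refine ⟨wall_vertex_of_height (t := t) (m := m) hz hj ?_, Or.inl hU⟩
    rw [h, (rung_facts s i hz').1, hU]
    simp [ptU]
  rw [← h] at hvU hrz
  rcases t with _ | t
  · have := wall_none_zone m hz
    exact hvU (by nlinarith)
  have hwz := wall_zone t m hz
  rcases tube_trichotomy s t with rfl | hb | hb | hle | hle
  · obtain ⟨a1, a2, a3, a4, a5, a6⟩ := wall_facts (some s) m hz
    obtain ⟨b1, b2, b3, b4, b5, b6, b7⟩ := rung_facts s i hz'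
    rw [← h] at b1 b2 b3 b4
    simp only [wallPos, wallWidth] at a4
    have hw := rungWd_pos s i
    have hwl := (rungWd_le s i).1
    have hW := tubeW_pos s
    have hl := wallLen_pos (some s) m
    have hh := rungH_pos s i
    have hbz := triB_bounds hz
    have hbz' := triB_bounds hz'
    have heq : rungWd s i * ((1 - z'.1) * (1 / rungJ s i) + z'.2 * (1 / rungJ s i) ^ 2) =
        z.2 * wallLen (some s) m * tubeW s / 8 := by linarith
    obtain ⟨c, hc'⟩ := Nat.exists_eq_add_of_le (wallJ_le_rungJ s i)
    have hk : wallHeight (some s) (wallD (some s) * c) = 1 / rungJ s i :=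
      wallHeight_eq_one_div (by rw [hc']; ring)
    have hfin : hc (cmap (.inl (some s, m)) z) = 1 / rungJ s i →
        (1 - z'.1) * (1 / rungJ s i) ≤ 0 →
        (z = ptU ∨ z = ptV) ∧ (z' = ptU ∨ z' = ptV) := by
      intro e1 e2
      refine ⟨wall_vertex_of_height hz hj e1, Or.inr (eq_ptV hz' ?_)⟩
      by_contra hlt
      rw [not_le] at hlt
      have : 0 < (1 - z'.1) * (1 / rungJ s i) := mul_pos (by linarith) hh
      linarith
    rcases le_or_gt (wallD (some s) * c) m with hm | hm
    · have h1 := wallHeight_anti (some s) hm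
      rw [hk] at h1
      have h2 : z'.2 * (1 / rungJ s i) ^ 2 = 0 := by linarith
      have h3 : hc (cmap (.inl (some s, m)) z) = 1 / rungJ s i := by linarith
      have h4 : z.1 * wallLen (some s) m ≤ 0 := by linarith
      have h5 : z.2 * wallLen (some s) m ≤ 0 := by nlinarith
      refine hfin h3 ?_
      rw [h2, add_zero] at heq
      by_contra hlt
      rw [not_le] at hlt
      nlinarith [mul_pos hw hlt]
    · have h1 := wallHeight_anti (some s) (Nat.succ_le_of_lt hm)
      rw [hk, Nat.succ_eq_add_one] at h1
      set Y := z'.2 * ((1 : ℝ) / rungJ s i) ^ 2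
      set X := (1 - z'.1) * ((1 : ℝ) / rungJ s i)
      set A := z.2 * wallLen (some s) m
      have h2 : A ≤ Y := by linarith
      have h3 : tubeW s / 2 * (X + Y) ≤ A * tubeW s / 8 := by
        rw [← heq]; exact mul_le_mul_of_nonneg_right hwl (by linarith)
      have h4 : X + Y ≤ A / 4 := by
        by_contra hlt
        rw [not_le] at hlt
        nlinarith
      exact hfin (by linarith) (by linarith)
  · exfalso
    have h1 := hb.tubeR_lt
    cases i
    · have h2 := (wall_facts (some t) m hz).2.2.1.trans (wallHeight_le (some t) m)
      have h3 := (rung_facts s false hz').2.1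
      rw [← h] at h3
      have h4 : rungJ s false < wallJ (some t) := by
        have := hb.le_wallJ
        simp only [rungJ, Bool.toNat_false]; omega
      have h5 : (1 : ℝ) / wallJ (some t) < 1 / rungJ s false :=
        one_div_lt_one_div_of_lt (by exact_mod_cast hj) (by exact_mod_cast h4)
      linarith
    · rw [rungLeft_true] at hrz
      nlinarith
  · exfalso
    have h1 := hb.tubeR_lt
    nlinarith
  · exfalso
    have h1 := tubeL_lt_tubeM t
    nlinarith
  · exact hvU (by nlinarith)

theorem edge_incidence {e e' : Edge} {z z' : ℝ × ℝ} (hz : z ∈ triB) (hz' : z' ∈ triB)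
    (hne : e ≠ e') (h : cmap e z = cmap e' z') :
    (z = ptU ∨ z = ptV) ∧ (z' = ptU ∨ z' = ptV) := by
  rcases e with ⟨t, m⟩ | ⟨s, i⟩ <;> rcases e' with ⟨t', m'⟩ | ⟨s', i'⟩
  · exact wall_wall_incidence hz hz' (fun h => hne (congrArg Sum.inl h)) h
  · exact wall_rung_incidence hz hz' h
  · exact (wall_rung_incidence hz' hz h.symm).symm
  · obtain ⟨rfl, rfl⟩ := rung_rung_disjoint hz hz' h
    exact absurd rfl hne

theorem gc_ptU : gc ptU = 0 ∧ hc ptU = 1 := by simp [gc, hc, ptU]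

theorem gc_ptV : gc ptV = 1 ∧ hc ptV = 1 := by simp [gc, hc, ptV]

theorem hc_cmap_eq_one {e : Edge} {z : ℝ × ℝ} (hz : z ∈ triB) (h : hc (cmap e z) = 1) :
    z = ptU ∧ (e = .inl (none, 0) ∨ e = .inl (some [], 0)) := by
  rcases e with ⟨t, m⟩ | ⟨s, i⟩
  · obtain ⟨h1, h2, h3, -⟩ := wall_facts t m hz
    rw [h] at h3 h1
    have hD := wallD_pos_real t
    have hJ := wallJ_pos_real t
    have hd := wall_denom_pos t m
    have h4 : (wallD t * wallJ t + m : ℝ) ≤ wallD t := by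
      unfold wallHeight at h3
      rwa [one_le_div (by linarith)] at h3
    have hm0 : (0 : ℝ) ≤ m := Nat.cast_nonneg m
    have h5 : (m : ℝ) = 0 := by nlinarith
    have h6 : (wallJ t : ℝ) = 1 := by nlinarith
    have h7 : m = 0 := by exact_mod_cast h5
    have h8 : wallJ t = 1 := by exact_mod_cast h6
    subst h7
    rw [wallHeight_zero, h6, div_one] at h1
    have hl := wallLen_pos t 0
    refine ⟨eq_ptU hz (by nlinarith), ?_⟩
    rcases t with _ | _ | ⟨n, s⟩
    · exact Or.inl rfl
    · exact Or.inr rfl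
    · simp [wallJ] at h8
  · linarith [(rung_hc_lt s i hz).2]

theorem cmap_vertex_wall (t : Option (List ℕ)) (m : ℕ) :
    cmap (.inl (t, m)) ptU = toPt (wallPos t * wallHeight t m) (wallHeight t m) ∧
    cmap (.inl (t, m)) ptV = toPt (wallPos t * wallHeight t (m + 1)) (wallHeight t (m + 1)) := by
  constructor
  · simp [cmap, ptU]
  · simp [cmap, ptV, wallLen]

theorem cmap_vertex_rung (s : List ℕ) (i : Bool) :
    cmap (.inr (s, i)) ptU = toPt (rungLeft s i * (1 / rungJ s i)) (1 / rungJ s i) ∧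
    cmap (.inr (s, i)) ptV = toPt (tubeR s * (1 / rungJ s i)) (1 / rungJ s i) := by
  constructor
  · simp [cmap, ptU]
  · simp only [cmap, ptV, rungLeft]
    congr 1 <;> ring

theorem wallHeight_start {t : Option (List ℕ)} (h : wallJ t = 1) : wallHeight t 0 = 1 := by
  rw [wallHeight_zero, h]; simp

theorem cmap_none_ptU : cmap (.inl (none, 0)) ptU = ptU := by
  rw [(cmap_vertex_wall none 0).1, wallHeight_start rfl]
  simp [toPt, wallPos, ptU]

theorem cmap_root_ptU : cmap (.inl (some [], 0)) ptU = ptV := by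
  rw [(cmap_vertex_wall (some []) 0).1, wallHeight_start rfl]
  simp [toPt, wallPos, ptV, tubeR, tubeL_nil, tubeW_nil]

theorem ptU_ne_ptV : ptU ≠ ptV := by simp [ptU, ptV]

theorem cmap_eq_ptU {e : Edge} {z : ℝ × ℝ} (hz : z ∈ triB) (h : cmap e z = ptU) :
    e = .inl (none, 0) ∧ z = ptU := by
  obtain ⟨rfl, rfl | rfl⟩ := hc_cmap_eq_one hz (by rw [h]; exact gc_ptU.2)
  · exact ⟨rfl, rfl⟩
  · rw [cmap_root_ptU] at h
    exact absurd h.symm ptU_ne_ptV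

theorem cmap_eq_ptV {e : Edge} {z : ℝ × ℝ} (hz : z ∈ triB) (h : cmap e z = ptV) :
    e = .inl (some [], 0) ∧ z = ptU := by
  obtain ⟨rfl, rfl | rfl⟩ := hc_cmap_eq_one hz (by rw [h]; exact gc_ptV.2)
  · rw [cmap_none_ptU] at h
    exact absurd h ptU_ne_ptV
  · exact ⟨rfl, rfl⟩

/-! ### Vertices shared by cells -/

theorem wall_consecutive (t : Option (List ℕ)) (m : ℕ) :
    cmap (.inl (t, m)) ptV = cmap (.inl (t, m + 1)) ptU := by
  rw [(cmap_vertex_wall t m).2, (cmap_vertex_wall t (m + 1)).1]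

theorem rung_right_on_wall (s : List ℕ) (i : Bool) :
    ∃ m, cmap (.inr (s, i)) ptV = cmap (.inl (some s, m)) ptU := by
  obtain ⟨c, hc'⟩ := Nat.exists_eq_add_of_le (wallJ_le_rungJ s i)
  refine ⟨wallD (some s) * c, ?_⟩
  rw [(cmap_vertex_rung s i).2, (cmap_vertex_wall _ _).1,
    wallHeight_eq_one_div (j := rungJ s i) (by rw [hc']; ring)]
  rfl

/-- The wall to the left of the tube of a node. -/
def leftWall : List ℕ → Option (List ℕ)
  | [] => none
  | 0 :: s => leftWall s
  | (n + 1) :: s => some (n :: s)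

theorem leftWall_spec (s : List ℕ) :
    wallPos (leftWall s) = tubeL s ∧ wallJ (leftWall s) ≤ rungJ s false := by
  induction s with
  | nil => exact ⟨rfl, by simp [leftWall, wallJ, rungJ]⟩
  | cons n s ih =>
    have := encode_lt_cons n s
    cases n with
    | zero =>
      refine ⟨by rw [leftWall, ih.1, tubeL_zero], ?_⟩
      rw [leftWall]
      refine ih.2.trans ?_
      simp only [rungJ]; omega
    | succ n =>
      refine ⟨by rw [leftWall, wallPos, tubeL_succ], ?_⟩
      simp only [leftWall, wallJ, rungJ]; omega

theorem rung_left_on_wall (s : List ℕ) :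
    ∃ m, cmap (.inr (s, false)) ptU = cmap (.inl (leftWall s, m)) ptU := by
  obtain ⟨h1, h2⟩ := leftWall_spec s
  obtain ⟨c, hc'⟩ := Nat.exists_eq_add_of_le h2
  refine ⟨wallD (leftWall s) * c, ?_⟩
  rw [(cmap_vertex_rung s false).1, (cmap_vertex_wall _ _).1, rungLeft_false, h1,
    wallHeight_eq_one_div (j := rungJ s false) (by rw [hc']; ring)]

theorem tendsto_wall_start (s : List ℕ) :
    Tendsto (fun n => cmap (.inl (some (n :: s), 0)) ptU) atTop
      (𝓝 (cmap (.inr (s, true)) ptU)) := by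
  have h1 : ∀ n, cmap (.inl (some (n :: s), 0)) ptU =
      toPt (tubeR (n :: s) * (1 / rungJ s true)) (1 / rungJ s true) := by
    intro n
    rw [(cmap_vertex_wall _ _).1, wallHeight_zero]
    have : (wallJ (some (n :: s))) = rungJ s true := by simp [wallJ, rungJ]
    rw [this]; rfl
  have h2 : Tendsto (fun n => tubeR (n :: s)) atTop (𝓝 (tubeM s)) := by
    have h3 : Tendsto (fun n : ℕ => tubeM s - tubeW s * (1 / 2) ^ n / 4) atTop
        (𝓝 (tubeM s - tubeW s * 0 / 4)) :=
      tendsto_const_nhds.sub (((tendsto_pow_atTop_nhds_zero_of_lt_one (by norm_num)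
        (by norm_num)).const_mul _).div_const _)
    simpa [tubeR_cons, tubeW_cons] using h3
  simp only [h1]
  rw [(cmap_vertex_rung s true).1, rungLeft_true]
  have hcont : Continuous fun g : ℝ => toPt (g * (1 / rungJ s true)) (1 / rungJ s true) := by
    unfold toPt; fun_prop
  exact (hcont.tendsto _).comp h2

/-! ### The exceptional segments and the deleted set -/

/-- The segments where walls accumulate. -/
def segQ : Set (ℝ × ℝ) := {z | ∃ s : List ℕ, gc z = tubeM s * hc z ∧ 0 < hc z ∧
  hc z ≤ 1 / (2 * Encodable.encode s + 4)}

/-- The base of the deleted set. -/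
def baseD : Set (ℝ × ℝ) := {z | z = toPt 0 0 ∨ ∃ s : List ℕ, gc z = tubeM s * hc z ∧ 0 < hc z ∧
  hc z < 1 / (2 * Encodable.encode s + 4) ∧ ∃ q : ℚ, hc z = q}

/-- The deleted set. -/
inductive InD : ℝ × ℝ → Prop
  | base (z : ℝ × ℝ) : z ∈ baseD → InD z
  | map (e : Edge) (z : ℝ × ℝ) : InD z → InD (cmap e z)

theorem rungJ_true (s : List ℕ) : (rungJ s true : ℝ) = 2 * Encodable.encode s + 4 := by
  simp only [rungJ, Bool.toNat_true]; push_cast; ring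

theorem segQ_cmap {e : Edge} {z : ℝ × ℝ} (hz : z ∈ triB) {s : List ℕ}
    (hg : gc (cmap e z) = tubeM s * hc (cmap e z))
    (hh : hc (cmap e z) ≤ 1 / (2 * Encodable.encode s + 4)) :
    z = ptU ∧ e = .inr (s, true) := by
  have hp := hc_cmap_pos e hz
  have hM := tubeM_lt_tubeR s
  have hL := tubeL_lt_tubeM s
  rcases e with ⟨t | t, m⟩ | ⟨t, i⟩
  · exfalso
    have h1 := wall_none_zone m hz
    nlinarith [tubeM_pos s]
  · exfalso
    have h1 := wall_zone t m hz
    rw [hg] at h1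
    have h2 : tubeM t < tubeM s := lt_of_mul_lt_mul_right h1.1 hp.le
    have h3 : tubeM s ≤ tubeR t := le_of_mul_le_mul_right h1.2 hp
    have h4 := tubeL_lt_tubeM t
    rcases tube_trichotomy s t with rfl | hb | hb | hle | hle
    · exact lt_irrefl _ h2
    · linarith [hb.tubeR_lt]
    · linarith [hb.tubeR_lt]
    · linarith
    · linarith
  · have h1 := rung_zone t i hz
    have h2 := (rung_facts t i hz).2.1
    have hll := tubeL_le_rungLeft t i
    have h1' := h1
    rw [hg] at h1'
    have h4 : rungLeft t i ≤ tubeM s := le_of_mul_le_mul_right h1'.1 hp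
    have h3 : tubeM s ≤ tubeR t := le_of_mul_le_mul_right h1'.2 hp
    have h5 : (2 * Encodable.encode s + 4 : ℝ) ≤ rungJ t i := by
      have := h2.trans hh
      rwa [one_div_le_one_div (by linarith [rungJ_ge t i]) (by positivity)] at this
    have h6 : 2 * Encodable.encode s + 4 ≤ rungJ t i := by exact_mod_cast h5
    have hi := Bool.toNat_le i
    rcases tube_trichotomy s t with rfl | hb | hb | hle | hle
    · cases i
      · simp only [rungJ, Bool.toNat_false] at h6
        omega
      · exact ⟨rung_vertexU hz (by rw [rungLeft_true, hg]), rfl⟩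
    · linarith [hb.tubeR_lt]
    · have := hb.encode_lt
      simp only [rungJ] at h6
      omega
    · linarith
    · linarith

theorem segQ_cmap_vertex {e : Edge} {z : ℝ × ℝ} (hz : z ∈ triB) (h : cmap e z ∈ segQ) :
    z = ptU ∧ ∃ s, e = .inr (s, true) := by
  obtain ⟨s, hg, -, hh⟩ := h
  exact ⟨(segQ_cmap hz hg hh).1, s, (segQ_cmap hz hg hh).2⟩

theorem cmap_notMem_baseD {e : Edge} {z : ℝ × ℝ} (hz : z ∈ triB) : cmap e z ∉ baseD := by
  rintro (h | ⟨s, hg, -, hlt, -⟩)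
  · have := hc_cmap_pos e hz
    rw [h] at this
    simp at this
  · obtain ⟨rfl, rfl⟩ := segQ_cmap hz hg hlt.le
    rw [(cmap_vertex_rung s true).1, hc_toPt, rungJ_true] at hlt
    exact lt_irrefl _ hlt

theorem hc_segQ_lt {z : ℝ × ℝ} (h : z ∈ segQ) : 0 < hc z ∧ hc z ≤ 1 / 4 := by
  obtain ⟨s, -, hp, hh⟩ := h
  exact ⟨hp, hh.trans (one_div_le_one_div_of_le (by norm_num) (by
    have : (0 : ℝ) ≤ Encodable.encode s := Nat.cast_nonneg _
    linarith))⟩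

theorem ptU_notMem_segQ : ptU ∉ segQ := fun h => by
  have := (hc_segQ_lt h).2
  rw [gc_ptU.2] at this
  norm_num at this

theorem ptV_notMem_segQ : ptV ∉ segQ := fun h => by
  have := (hc_segQ_lt h).2
  rw [gc_ptV.2] at this
  norm_num at this

theorem baseD_hc_lt {z : ℝ × ℝ} (h : z ∈ baseD) : hc z < 1 := by
  rcases h with rfl | ⟨s, hg, hp, hlt, hq⟩
  · simp
  · have := (hc_segQ_lt ⟨s, hg, hp, hlt.le⟩).2
    linarith

theorem segQ_subset_triB {z : ℝ × ℝ} (h : z ∈ segQ) : z ∈ triB := by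
  have h1 := hc_segQ_lt h
  obtain ⟨s, hg, hp, hh⟩ := h
  have h2 := tubeM_pos s
  have h3 := tubeM_lt_tubeR s
  have h4 := tubeR_le_one s
  rw [mem_triB_iff, hg]
  refine ⟨by linarith, by nlinarith, by nlinarith⟩

theorem baseD_subset_triB {z : ℝ × ℝ} (h : z ∈ baseD) : z ∈ triB := by
  rcases h with rfl | ⟨s, hg, hp, hlt, hq⟩
  · rw [mem_triB_iff]; norm_num
  · exact segQ_subset_triB ⟨s, hg, hp, hlt.le⟩

theorem InD.mem_triB {z : ℝ × ℝ} (h : InD z) : z ∈ triB := by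
  induction h with
  | base z hz => exact baseD_subset_triB hz
  | map e z _ ih => exact cmap_mem e ih

theorem InD.ne_vertex {z : ℝ × ℝ} (h : InD z) : z ≠ ptU ∧ z ≠ ptV := by
  induction h with
  | base z hz =>
    have := baseD_hc_lt hz
    constructor
    · rintro rfl
      rw [gc_ptU.2] at this
      exact lt_irrefl _ this
    · rintro rfl
      rw [gc_ptV.2] at this
      exact lt_irrefl _ this
  | map e z hD ih =>
    exact ⟨fun h => ih.1 (cmap_eq_ptU hD.mem_triB h).2, fun h => ih.1 (cmap_eq_ptV hD.mem_triB h).2⟩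

theorem InD.cmap_iff {e : Edge} {z : ℝ × ℝ} (hz : z ∈ triB) : InD (cmap e z) ↔ InD z := by
  refine ⟨fun h => ?_, InD.map e z⟩
  generalize hw : cmap e z = w at h
  cases h with
  | base _ h' => exact absurd (hw ▸ h') (cmap_notMem_baseD hz)
  | map e' z' h' =>
    by_cases hee : e = e'
    · subst hee
      rwa [cmap_injective e hw]
    · rcases (edge_incidence hz h'.mem_triB hee hw).2 with h1 | h1
      · exact absurd h1 h'.ne_vertex.1
      · exact absurd h1 h'.ne_vertex.2

theorem not_inD_of_infinite_address {z : ℕ → ℝ × ℝ} {e : ℕ → Edge} (hz : ∀ i, z i ∈ triB)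
    (h : ∀ i, z i = cmap (e i) (z (i + 1))) : ¬ InD (z 0) := by
  have key : ∀ w, InD w → ∀ (z : ℕ → ℝ × ℝ) (e : ℕ → Edge), (∀ i, z i ∈ triB) →
      (∀ i, z i = cmap (e i) (z (i + 1))) → z 0 ≠ w := by
    intro w hw
    induction hw with
    | base w hw =>
      intro z e hz h h0
      rw [← h0, h 0] at hw
      exact cmap_notMem_baseD (hz 1) hw
    | map e' w hw ih =>
      intro z e hz h h0
      rw [h 0] at h0
      by_cases hee : e 0 = e'
      · rw [hee] at h0
        exact ih (fun i => z (i + 1)) (fun i => e (i + 1)) (fun i => hz _) (fun i => h _)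
          (cmap_injective e' h0)
      · rcases (edge_incidence (hz _) hw.mem_triB hee h0).2 with h1 | h1
        · exact hw.ne_vertex.1 h1
        · exact hw.ne_vertex.2 h1
  exact fun hD => key _ hD z e hz h rfl

/-! ### Local finiteness of cells -/

/-- Edges with bounded indices. -/
def boundedEdges (M : ℕ) : Set Edge :=
  Sum.inl '' (({none, some []} ∪ Set.image2 (fun n s => some (n :: s)) (Iic M)
    {s | Encodable.encode s ≤ M}) ×ˢ Iic M) ∪
  Sum.inr '' ({s | Encodable.encode s ≤ M} ×ˢ univ)

theorem finite_encode_le (M : ℕ) : {s : List ℕ | Encodable.encode s ≤ M}.Finite :=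
  (finite_Iic M).preimage Encodable.encode_injective.injOn

theorem finite_boundedEdges (M : ℕ) : (boundedEdges M).Finite := by
  have h := finite_encode_le M
  refine Set.Finite.union (Set.Finite.image _ (Set.Finite.prod (Set.Finite.union
    (Set.toFinite _) (Set.Finite.image2 _ (finite_Iic M) h)) (finite_Iic M)))
    (Set.Finite.image _ (h.prod finite_univ))

theorem mem_boundedEdges_none {M m : ℕ} (h : m ≤ M) : .inl (none, m) ∈ boundedEdges M :=
  Or.inl ⟨(none, m), ⟨Or.inl (by simp), h⟩, rfl⟩

theorem mem_boundedEdges_root {M m : ℕ} (h : m ≤ M) : .inl (some [], m) ∈ boundedEdges M :=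
  Or.inl ⟨(some [], m), ⟨Or.inl (by simp), h⟩, rfl⟩

theorem mem_boundedEdges_cons {M m n : ℕ} {s : List ℕ} (h : m ≤ M) (hn : n ≤ M)
    (hs : Encodable.encode s ≤ M) : .inl (some (n :: s), m) ∈ boundedEdges M :=
  Or.inl ⟨(some (n :: s), m), ⟨Or.inr ⟨n, hn, s, hs, rfl⟩, h⟩, rfl⟩

theorem mem_boundedEdges_rung {M : ℕ} {s : List ℕ} (i : Bool)
    (hs : Encodable.encode s ≤ M) : .inr (s, i) ∈ boundedEdges M :=
  Or.inr ⟨(s, i), ⟨hs, mem_univ _⟩, rfl⟩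

theorem nat_le_of_real {a b : ℕ} {r : ℝ} (h1 : (a : ℝ) ≤ r) (h2 : r ≤ b) : a ≤ b := by
  exact_mod_cast h1.trans h2

theorem finite_edgeSize {ε : ℝ} (hε : 0 < ε) : {e | ε ≤ edgeSize e}.Finite := by
  obtain ⟨M, hM⟩ := exists_nat_ge (2 / ε)
  refine (finite_boundedEdges M).subset ?_
  have hM' : 1 / ε ≤ M := le_trans (by gcongr; norm_num) hM
  have hwall : ∀ t m, ε ≤ edgeSize (.inl (t, m)) → wallD t * wallJ t + m + 1 ≤ M := by
    intro t m h
    have h1 := wall_denom_pos t m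
    have h2 := h.trans (wallLen_le t m)
    rw [le_div_iff₀ (by linarith)] at h2
    have h3 : (wallD t * wallJ t + m + 1 : ℝ) ≤ 1 / ε := by
      rw [le_div_iff₀ hε]; linarith
    exact_mod_cast h3.trans hM'
  rintro (⟨t | (_ | ⟨n, s⟩), m⟩ | ⟨s, i⟩) h
  · exact mem_boundedEdges_none (by have := hwall _ _ h; omega)
  · exact mem_boundedEdges_root (by have := hwall _ _ h; omega)
  · have h1 := hwall _ _ h
    have h2 : n < 2 ^ n := Nat.lt_two_pow_self
    simp only [wallD, wallJ] at h1
    refine mem_boundedEdges_cons (by omega) ?_ ?_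
    · nlinarith
    · nlinarith
  · refine mem_boundedEdges_rung i ?_
    rw [mem_ofPred_eq] at h
    simp only [edgeSize] at h
    have h0 := rungJ_ge s i
    rw [← mul_div_assoc, mul_one, le_div_iff₀ (by linarith)] at h
    have h1 : (rungJ s i : ℝ) ≤ 2 / ε := by rw [le_div_iff₀ hε]; linarith
    have h2 : rungJ s i ≤ M := by exact_mod_cast h1.trans hM
    unfold rungJ at h2
    omega

theorem wall_cons_near (n : ℕ) (s : List ℕ) (m : ℕ) {w : ℝ × ℝ} (hw : w ∈ triB) :
    |gc (cmap (.inl (some (n :: s), m)) w) - tubeM s * hc (cmap (.inl (some (n :: s), m)) w)| ≤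
      2 * (1 / 2) ^ n ∧
    hc (cmap (.inl (some (n :: s), m)) w) ≤ 1 / (2 * Encodable.encode s + 4) := by
  have h1 := wall_zone (n :: s) m hw
  have h2 := (wall_facts (some (n :: s)) m hw).2.2.1.trans (wallHeight_le _ _)
  have h3 := hc_cmap_pos (.inl (some (n :: s), m)) hw
  have h4 := hc_cmap_le_one (.inl (some (n :: s), m)) hw
  have h5 := tubeW_cons_le_pow n s
  have h6 := tubeW_pos (n :: s)
  have h7 : tubeM (n :: s) = tubeM s - 3 / 2 * tubeW (n :: s) := by
    have := tubeL_cons n s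
    rw [tubeM, this]; ring
  rw [h7, tubeR_cons] at h1
  constructor
  · rw [abs_le]
    constructor <;> nlinarith
  · simpa [wallJ] using h2

theorem eventually_not_wall_cons {z : ℝ × ℝ} (hz : z ∉ segQ) (hp : 0 < hc z) (s : List ℕ) :
    ∃ N, ∀ᶠ p in 𝓝 z, ¬ (gc p = tubeM s * hc p ∧ 0 < hc p ∧
        hc p ≤ 1 / (2 * Encodable.encode s + 4)) ∧
      ∀ n m, ∀ w ∈ triB, cmap (.inl (some (n :: s), m)) w = p → n ≤ N := by
  have hcont : Continuous fun p => |gc p - tubeM s * hc p| :=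
    (continuous_gc.sub (continuous_const.mul continuous_hc)).abs
  by_cases hh : hc z ≤ 1 / (2 * Encodable.encode s + 4)
  · have hne : gc z - tubeM s * hc z ≠ 0 := fun h => hz ⟨s, by linarith, hp, hh⟩
    have hpos := abs_pos.2 hne
    obtain ⟨N, hN⟩ := exists_pow_lt_of_lt_one (show 0 < |gc z - tubeM s * hc z| / 4 by linarith)
      (show (1 / 2 : ℝ) < 1 by norm_num)
    refine ⟨N, ?_⟩
    filter_upwards [hcont.tendsto z (Ioi_mem_nhds (half_lt_self hpos))] with p hp'
    rw [mem_preimage, mem_Ioi] at hp'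
    refine ⟨fun h => ?_, fun n m w hw h => ?_⟩
    · rw [h.1, sub_self, abs_zero] at hp'
      linarith
    · by_contra hlt
      have h1 := (wall_cons_near n s m hw).1
      rw [h] at h1
      have h2 : ((1 : ℝ) / 2) ^ n ≤ (1 / 2) ^ N :=
        pow_le_pow_of_le_one (by norm_num) (by norm_num) (not_le.1 hlt).le
      linarith
  · refine ⟨0, ?_⟩
    filter_upwards [continuous_hc.tendsto z (Ioi_mem_nhds (not_le.1 hh))] with p hp'
    rw [mem_preimage, mem_Ioi] at hp'
    refine ⟨fun h => absurd h.2.2 (not_le.2 hp'), fun n m w hw h => ?_⟩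
    have h1 := (wall_cons_near n s m hw).2
    rw [h] at h1
    exact absurd h1 (not_le.2 hp')

theorem segQ_gc_bounds {z : ℝ × ℝ} (hz : z ∈ segQ) : |gc z| ≤ hc z := by
  obtain ⟨s, hg, hp, -⟩ := hz
  have h2 := tubeM_pos s
  have h3 := tubeM_lt_tubeR s
  have h4 := tubeR_le_one s
  rw [hg, abs_of_nonneg (by positivity)]
  nlinarith

theorem locally_finite_cells {z : ℝ × ℝ} (hz : z ∉ segQ) (hz0 : z ≠ toPt 0 0) :
    ∃ M, ∀ᶠ p in 𝓝 z, p ∉ segQ ∧ ∀ e, ∀ w ∈ triB, cmap e w = p → e ∈ boundedEdges M := by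
  rcases lt_or_ge (hc z) |gc z| with hlt | hge
  · refine ⟨0, ?_⟩
    filter_upwards [(isOpen_lt continuous_hc continuous_gc.abs).mem_nhds hlt] with p hp
    refine ⟨fun h => absurd (segQ_gc_bounds h) (not_le.2 hp), fun e w hw h => ?_⟩
    have := (gc_cmap_bounds e hw).1
    rw [h] at this
    exact absurd this (not_le.2 hp)
  have hp : 0 < hc z := by
    rcases (abs_nonneg (gc z)).trans hge |>.lt_or_eq with h | h
    · exact h
    · exfalso
      rw [← h] at hge
      have hg : gc z = 0 := abs_eq_zero.1 (le_antisymm hge (abs_nonneg _))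
      apply hz0
      rw [← toPt_gc_hc z, hg, ← h]
  obtain ⟨K, hK⟩ := exists_nat_ge (2 / (hc z / 2))
  choose N hN using eventually_not_wall_cons hz hp
  obtain ⟨B, hB⟩ := ((finite_encode_le K).image N).bddAbove
  obtain ⟨L, hL⟩ := exists_nat_ge ((2 : ℝ) ^ B / (hc z / 2))
  have hev : ∀ᶠ p in 𝓝 z, hc z / 2 < hc p := continuous_hc.tendsto z
    (Ioi_mem_nhds (half_lt_self hp))
  have hall := (finite_encode_le K).eventually_all (l := 𝓝 z) |>.2 fun s _ => hN s
  have hJ : ∀ J : ℝ, 0 < J → hc z / 2 ≤ 2 / J → J ≤ K := by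
    intro J hJ h
    refine le_trans ?_ hK
    rw [le_div_iff₀ hJ] at h
    rw [le_div_iff₀ (by linarith)]
    linarith
  refine ⟨K + B + L, ?_⟩
  filter_upwards [hev, hall] with p hhp hp2
  constructor
  · rintro ⟨s, h1, h2, h3⟩
    refine (hp2 s ?_).1 ⟨h1, h2, h3⟩
    have h4 : (0 : ℝ) ≤ Encodable.encode s := Nat.cast_nonneg _
    have h5 := hJ (2 * Encodable.encode s + 4) (by positivity)
      ((hhp.le.trans h3).trans (by gcongr; norm_num))
    have h6 : (Encodable.encode s : ℝ) ≤ K := by linarith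
    exact_mod_cast h6
  · rintro (⟨t, m⟩ | ⟨s, i⟩) w hw h
    · have h1 := (wall_facts t m hw).2.2.1
      rw [h] at h1
      have h2 := hhp.le.trans h1
      have hm : wallD t ≤ 2 ^ B → m ≤ L := by
        intro hd
        have hd' : (wallD t : ℝ) ≤ 2 ^ B := by exact_mod_cast hd
        have h3 := wall_denom_pos t m
        have h4 := wallD_pos_real t
        have h5 := wallJ_pos_real t
        unfold wallHeight at h2
        rw [le_div_iff₀ (by linarith)] at h2
        refine nat_le_of_real (r := (2 : ℝ) ^ B / (hc z / 2)) ?_ hL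
        rw [le_div_iff₀ (by linarith)]
        have : 0 ≤ (wallD t * wallJ t : ℝ) * (hc z / 2) := by positivity
        nlinarith
      have h2B : 1 ≤ 2 ^ B := Nat.one_le_two_pow
      rcases t with _ | (_ | ⟨n, s⟩)
      · have := hm h2B
        exact mem_boundedEdges_none (by omega)
      · have := hm h2B
        exact mem_boundedEdges_root (by omega)
      · have h3 := (wall_cons_near n s m hw).2
        rw [h] at h3
        have h4 : (0 : ℝ) ≤ Encodable.encode s := Nat.cast_nonneg _
        have h5 := hJ (2 * Encodable.encode s + 4) (by positivity)
          ((hhp.le.trans h3).trans (by gcongr; norm_num))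
        have h6 : Encodable.encode s ≤ K := by
          have h6 : (Encodable.encode s : ℝ) ≤ K := by linarith
          exact_mod_cast h6
        have h7 := (hp2 s h6).2 n m w hw h
        have h8 : n ≤ B := h7.trans (hB ⟨s, h6, rfl⟩)
        have := hm (Nat.pow_le_pow_right (by norm_num) h8)
        exact mem_boundedEdges_cons (by omega) (by omega) (by omega)
    · have h1 := (rung_facts s i hw).1
      rw [h] at h1
      have hH := rungH_pos s i
      have hH' := rungH_le s i
      have hb := triB_bounds hw
      have hz2 : w.2 ≤ 1 := by linarith [hw.2.1, hw.2.2, hw.1]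
      have h2 : hc z / 2 ≤ 2 / rungJ s i := by
        have : (2 : ℝ) / rungJ s i = 2 * (1 / rungJ s i) := by ring
        rw [this]
        nlinarith
      have h3 := hJ _ (by linarith [rungJ_ge s i]) h2
      have h4 : rungJ s i ≤ K := by exact_mod_cast h3
      unfold rungJ at h4
      exact mem_boundedEdges_rung i (by omega)

/-! ### The planar space with the deleted set removed -/

/-- The triangle with the deleted set removed. -/
abbrev Pt : Type := {z : ℝ × ℝ // z ∈ triB ∧ ¬ InD z}

/-- The contraction attached to an edge, on the punctured triangle. -/
noncomputable def ptMap (e : Edge) (z : Pt) : Pt :=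
  ⟨cmap e z.1, cmap_mem e z.2.1, fun h => z.2.2 ((InD.cmap_iff z.2.1).1 h)⟩

/-- The left base vertex. -/
def vU : Pt := ⟨ptU, ptU_mem, fun h => h.ne_vertex.1 rfl⟩

/-- The right base vertex. -/
def vV : Pt := ⟨ptV, ptV_mem, fun h => h.ne_vertex.2 rfl⟩

/-- The exceptional segments, punctured. -/
def ptQ : Set Pt := {z | z.1 ∈ segQ}

theorem vU_ne_vV : vU ≠ vV := fun h => ptU_ne_ptV (congrArg Subtype.val h)

theorem vU_notMem_ptQ : vU ∉ ptQ := ptU_notMem_segQ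

theorem vV_notMem_ptQ : vV ∉ ptQ := ptV_notMem_segQ

theorem dist_ptMap_le (e : Edge) (z w : Pt) :
    dist (ptMap e z) (ptMap e w) ≤ edgeSize e * dist z w := dist_cmap_le e z.1 w.1

theorem dist_ptMap_le_half (e : Edge) (z w : Pt) :
    dist (ptMap e z) (ptMap e w) ≤ 1 / 2 * dist z w :=
  (dist_ptMap_le e z w).trans (by gcongr; exact edgeSize_le_half e)

theorem Pt.dist_le_one (z w : Pt) : dist z w ≤ 1 := dist_le_one_of_mem_triB z.2.1 w.2.1

theorem dist_ptMap_le_size (e : Edge) (z w : Pt) : dist (ptMap e z) (ptMap e w) ≤ edgeSize e :=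
  (dist_ptMap_le e z w).trans
    (mul_le_of_le_one_right (edgeSize_pos e).le (Pt.dist_le_one z w))

theorem ptMap_injective (e : Edge) : Function.Injective (ptMap e) := fun z w h =>
  Subtype.ext (cmap_injective e (congrArg Subtype.val h))

theorem continuous_ptMap (e : Edge) : Continuous (ptMap e) :=
  ((continuous_cmap e).comp continuous_subtype_val).subtype_mk _

theorem isClosed_image_ptMap (e : Edge) {G : Set Pt} (hG : IsClosed G) :
    IsClosed (ptMap e '' G) := by
  obtain ⟨K, hK, rfl⟩ := isClosed_induced_iff.1 hG
  refine isClosed_induced_iff.2 ⟨cmap e '' (triB ∩ K),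
    ((isCompact_triB.inter_right hK).image (continuous_cmap e)).isClosed, ?_⟩
  ext p
  constructor
  · rintro ⟨w, ⟨hw, hwK⟩, h⟩
    exact ⟨⟨w, hw, fun hD => p.2.2 (h ▸ hD.map e w)⟩, hwK, Subtype.ext h⟩
  · rintro ⟨w, hw, rfl⟩
    exact ⟨w.1, ⟨w.2.1, hw⟩, rfl⟩

/-- Being one of the two base vertices. -/
def IsVertex (z : Pt) : Prop := z = vU ∨ z = vV

theorem ptMap_incidence {e e' : Edge} {z z' : Pt} (hne : e ≠ e') (h : ptMap e z = ptMap e' z') :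
    IsVertex z ∧ IsVertex z' := by
  obtain ⟨h1, h2⟩ := edge_incidence z.2.1 z'.2.1 hne (congrArg Subtype.val h)
  exact ⟨h1.imp (fun h => Subtype.ext h) fun h => Subtype.ext h,
    h2.imp (fun h => Subtype.ext h) fun h => Subtype.ext h⟩

theorem ptMap_mem_ptQ {e : Edge} {z : Pt} (h : ptMap e z ∈ ptQ) : z = vU :=
  Subtype.ext (segQ_cmap_vertex z.2.1 h).1

theorem ptMap_eq_vU {e : Edge} {z : Pt} (h : ptMap e z = vU) : e = .inl (none, 0) ∧ z = vU :=
  (cmap_eq_ptU z.2.1 (congrArg Subtype.val h)).imp_right fun h => Subtype.ext h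

theorem ptMap_eq_vV {e : Edge} {z : Pt} (h : ptMap e z = vV) : e = .inl (some [], 0) ∧ z = vU :=
  (cmap_eq_ptV z.2.1 (congrArg Subtype.val h)).imp_right fun h => Subtype.ext h

theorem ptMap_none_vU : ptMap (.inl (none, 0)) vU = vU := Subtype.ext cmap_none_ptU

theorem ptMap_root_vU : ptMap (.inl (some [], 0)) vU = vV := Subtype.ext cmap_root_ptU

theorem ptMap_wall_consecutive (t : Option (List ℕ)) (m : ℕ) :
    ptMap (.inl (t, m)) vV = ptMap (.inl (t, m + 1)) vU := Subtype.ext (wall_consecutive t m)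

theorem ptMap_rung_right (s : List ℕ) (i : Bool) :
    ∃ m, ptMap (.inr (s, i)) vV = ptMap (.inl (some s, m)) vU :=
  (rung_right_on_wall s i).imp fun _ h => Subtype.ext h

theorem ptMap_rung_left (s : List ℕ) :
    ∃ m, ptMap (.inr (s, false)) vU = ptMap (.inl (leftWall s, m)) vU :=
  (rung_left_on_wall s).imp fun _ h => Subtype.ext h

theorem tendsto_ptMap_wall (s : List ℕ) :
    Tendsto (fun n => ptMap (.inl (some (n :: s), 0)) vU) atTop
      (𝓝 (ptMap (.inr (s, true)) vU)) := by
  rw [nhds_subtype_eq_comap, tendsto_comap_iff]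
  exact tendsto_wall_start s

theorem Pt.ne_corner (z : Pt) : z.1 ≠ toPt 0 0 := fun h => z.2.2 (.base _ (Or.inl h))

theorem locally_finite_ptMap {z : Pt} (hz : z ∉ ptQ) :
    ∃ E : Set Edge, E.Finite ∧ ∀ᶠ p in 𝓝 z, p ∉ ptQ ∧ ∀ e w, ptMap e w = p → e ∈ E := by
  obtain ⟨M, hM⟩ := locally_finite_cells hz z.ne_corner
  refine ⟨_, finite_boundedEdges M, ?_⟩
  filter_upwards [continuous_subtype_val.tendsto z hM] with p hp
  exact ⟨hp.1, fun e w h => hp.2 e w.1 w.2.1 (congrArg Subtype.val h)⟩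

/-- A set which is locally constant at each point of the exceptional segments. -/
def LocConst (O : Set Pt) : Prop := ∀ q ∈ ptQ, ∀ᶠ p in 𝓝 q, (p ∈ O ↔ q ∈ O)

theorem LocConst.compl {O : Set Pt} (h : LocConst O) : LocConst Oᶜ := fun q hq =>
  (h q hq).mono fun _ hp => not_congr hp

theorem locConst_of_finite {O : Set Pt} (hO : O.Finite) (h : ∀ z ∈ O, z ∉ ptQ) : LocConst O := by
  intro q hq
  have hqO : q ∉ O := fun h' => h q h' hq
  filter_upwards [hO.isClosed.isOpen_compl.mem_nhds hqO] with p hp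
  exact iff_of_false hp hqO

theorem eventually_pos_iff {X : Type*} [TopologicalSpace X] {φ : X → ℝ} (hφ : Continuous φ) {q : X}
    (h : φ q ≠ 0) :
    ∀ᶠ p in 𝓝 q, (0 < φ p ↔ 0 < φ q) := by
  rcases h.lt_or_gt with h | h
  · filter_upwards [hφ.tendsto q (Iio_mem_nhds h)] with p hp
    exact iff_of_false (not_lt.2 (le_of_lt hp)) (not_lt.2 h.le)
  · filter_upwards [hφ.tendsto q (Ioi_mem_nhds h)] with p hp
    exact iff_of_true hp h

theorem continuous_gcPt : Continuous fun p : Pt => gc p.1 :=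
  continuous_gc.comp continuous_subtype_val

theorem continuous_hcPt : Continuous fun p : Pt => hc p.1 :=
  continuous_hc.comp continuous_subtype_val

/-- Slopes of a branch. -/
theorem exists_branch_slope (y : ℕ → ℕ) : ∃ ξ : ℝ, 0 ≤ ξ ∧
    (∀ k, tubeL (initSeg y k) ≤ ξ ∧ ξ < tubeM (initSeg y k)) ∧
    ∀ s, (∀ k, s ≠ initSeg y k) → ξ < tubeL s ∨ tubeR s ≤ ξ := by
  have hmono : Monotone fun k => tubeL (initSeg y k) := monotone_nat_of_le_succ fun k =>
    tubeL_le_cons _ _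
  have hanti : Antitone fun k => tubeR (initSeg y k) := antitone_nat_of_succ_le fun k =>
    ((tubeR_cons_lt _ _).trans (tubeM_lt_tubeR _)).le
  have hub : ∀ j k, tubeL (initSeg y j) ≤ tubeR (initSeg y k) := fun j k =>
    (hmono (le_max_left j k)).trans (((tubeL_lt_tubeM _).trans (tubeM_lt_tubeR _)).le.trans
      (hanti (le_max_right j k)))
  have hbdd : BddAbove (range fun k => tubeL (initSeg y k)) :=
    ⟨tubeR (initSeg y 0), by rintro _ ⟨j, rfl⟩; exact hub j 0⟩
  have h1 : ∀ k, tubeL (initSeg y k) ≤ ⨆ k, tubeL (initSeg y k) := fun k => le_ciSup hbdd k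
  have h2 : ∀ k, ⨆ k, tubeL (initSeg y k) ≤ tubeR (initSeg y k) := fun k =>
    ciSup_le fun j => hub j k
  have h3 : ∀ k, ⨆ k, tubeL (initSeg y k) < tubeM (initSeg y k) := fun k =>
    (h2 (k + 1)).trans_lt (tubeR_cons_lt _ _)
  refine ⟨⨆ k, tubeL (initSeg y k), (tubeL_nonneg _).trans (h1 0), fun k => ⟨h1 k, h3 k⟩, ?_⟩
  intro s hs
  rcases tube_trichotomy s (initSeg y s.length) with h | h | h | h | h
  · exact absurd h (hs _)
  · have := h.length_lt
    rw [initSeg_length] at this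
    exact absurd this (lt_irrefl _)
  · have := h.length_lt
    rw [initSeg_length] at this
    exact absurd this (lt_irrefl _)
  · exact Or.inr (h.trans (h1 _))
  · exact Or.inl (((h3 _).trans (tubeM_lt_tubeR _)).trans_le h)

theorem exists_branch_cut (y : ℕ → ℕ) : ∃ O : Set Pt, LocConst O ∧ vU ∉ O ∧ vV ∈ O ∧
    (∀ e, (∀ k, e ≠ .inr (initSeg y k, false)) → (ptMap e vU ∈ O ↔ ptMap e vV ∈ O)) ∧
    ∀ k, ptMap (.inr (initSeg y k, false)) vU ∉ O ∧ ptMap (.inr (initSeg y k, false)) vV ∈ O := by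
  obtain ⟨ξ, h0, h1, h2⟩ := exists_branch_slope y
  have hwall : ∀ t m, (ptMap (.inl (t, m)) vU).1 =
      toPt (wallPos t * wallHeight t m) (wallHeight t m) ∧ (ptMap (.inl (t, m)) vV).1 =
      toPt (wallPos t * wallHeight t (m + 1)) (wallHeight t (m + 1)) := cmap_vertex_wall
  have hrung : ∀ s i, (ptMap (.inr (s, i)) vU).1 =
      toPt (rungLeft s i * (1 / rungJ s i)) (1 / rungJ s i) ∧ (ptMap (.inr (s, i)) vV).1 =
      toPt (tubeR s * (1 / rungJ s i)) (1 / rungJ s i) := cmap_vertex_rung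
  have hne : ∀ s, ξ ≠ tubeM s := by
    intro s
    by_cases hs : ∃ k, s = initSeg y k
    · obtain ⟨k, rfl⟩ := hs
      exact (h1 k).2.ne
    · push Not at hs
      rcases h2 s hs with h | h
      · exact (h.trans (tubeL_lt_tubeM s)).ne
      · exact ((tubeM_lt_tubeR s).trans_le h).ne'
  refine ⟨{p | 0 < gc p.1 - ξ * hc p.1}, ?_, ?_, ?_, ?_, ?_⟩
  · rintro q ⟨s, hg, hp, -⟩
    refine eventually_pos_iff (continuous_gcPt.sub (continuous_const.mul continuous_hcPt)) ?_
    change gc q.1 - ξ * hc q.1 ≠ 0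
    rw [hg, ← sub_mul]
    exact mul_ne_zero (sub_ne_zero.2 (hne s).symm) hp.ne'
  · simp only [mem_ofPred_eq, vU, gc_ptU]
    linarith
  · simp only [mem_ofPred_eq, vV, gc_ptV]
    linarith [(h1 0).2, tubeM_lt_tubeR (initSeg y 0), tubeR_le_one (initSeg y 0)]
  · rintro (⟨t, m⟩ | ⟨s, i⟩) he
    · simp only [mem_ofPred_eq, hwall, gc_toPt, hc_toPt, ← sub_mul]
      rw [mul_pos_iff_of_pos_right (wallHeight_pos _ _),
        mul_pos_iff_of_pos_right (wallHeight_pos _ _)]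
    · simp only [mem_ofPred_eq, hrung, gc_toPt, hc_toPt, ← sub_mul]
      rw [mul_pos_iff_of_pos_right (rungH_pos _ _), mul_pos_iff_of_pos_right (rungH_pos _ _),
        sub_pos, sub_pos]
      have hRR : rungLeft s i < tubeR s := by
        have := rungWd_pos s i
        rw [rungLeft]; linarith
      by_cases hs : ∃ k, s = initSeg y k
      · obtain ⟨k, rfl⟩ := hs
        cases i
        · exact absurd rfl (he k)
        · rw [rungLeft_true]
          exact iff_of_true (h1 k).2 ((h1 k).2.trans (tubeM_lt_tubeR _))
      · push Not at hs
        rcases h2 s hs with h | h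
        · have := h.trans_le (tubeL_le_rungLeft s i)
          exact iff_of_true this (this.trans hRR)
        · exact iff_of_false (not_lt.2 (hRR.le.trans h)) (not_lt.2 h)
  · intro k
    simp only [mem_ofPred_eq, hrung, gc_toPt, hc_toPt, ← sub_mul, rungLeft_false]
    rw [mul_pos_iff_of_pos_right (rungH_pos _ _), mul_pos_iff_of_pos_right (rungH_pos _ _),
      sub_pos, sub_pos, not_lt]
    exact ⟨(h1 k).1, (h1 k).2.trans (tubeM_lt_tubeR _)⟩

/-! ### Boxes around points of the exceptional segments -/

theorem exists_rat_not_reciprocal {a b : ℝ} (hab : a < b) :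
    ∃ r : ℚ, a < r ∧ (r : ℝ) < b ∧ ∀ k : ℕ, (r : ℝ) ≠ 1 / (2 * k + 4) := by
  obtain ⟨r, h1, h2⟩ := exists_rat_btwn hab
  by_cases h : ∃ k : ℕ, (r : ℝ) = 1 / (2 * k + 4)
  · obtain ⟨k, hk⟩ := h
    have hlt : (1 : ℝ) / (2 * k + 5) < r := by
      rw [hk]
      exact one_div_lt_one_div_of_lt (by positivity) (by linarith)
    obtain ⟨r', h3, h4⟩ := exists_rat_btwn (max_lt h1 hlt)
    refine ⟨r', (le_max_left _ _).trans_lt h3, h4.trans h2, fun j hj => ?_⟩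
    have h5 := (le_max_right _ _).trans_lt h3
    rw [hj, one_div_lt_one_div (by positivity) (by positivity)] at h5
    rw [hj, hk, one_div_lt_one_div (by positivity) (by positivity)] at h4
    have h6 : 2 * j + 4 < 2 * k + 5 := by exact_mod_cast h5
    have h7 : 2 * k + 4 < 2 * j + 4 := by exact_mod_cast h4
    omega
  · push Not at h
    exact ⟨r, h1, h2, h⟩

theorem hc_ne_of_mem_ptQ {q : Pt} (hq : q ∈ ptQ) {r : ℚ}
    (hr : ∀ k : ℕ, (r : ℝ) ≠ 1 / (2 * k + 4)) : hc q.1 ≠ r := by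
  obtain ⟨s, hg, hp, hh⟩ := hq
  intro h
  refine q.2.2 (.base _ (Or.inr ⟨s, hg, hp, lt_of_le_of_ne hh ?_, r, h⟩))
  rw [h]
  exact hr _

theorem tubeM_rational (s : List ℕ) : ∃ q : ℚ, tubeM s = q := by
  obtain ⟨⟨p, hp⟩, ⟨q, hq⟩⟩ := tube_rational s
  exact ⟨p + q / 2, by rw [tubeM, hp, hq]; push_cast; ring⟩

theorem exists_box {q : Pt} (hq : q ∈ ptQ) {ε : ℝ} (hε : 0 < ε) :
    ∃ O : Set Pt, LocConst O ∧ q ∈ O ∧ ∀ p ∈ O, dist p q < ε := by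
  obtain ⟨s, hg, hp, hh⟩ := id hq
  set h₀ := hc q.1 with hh₀
  obtain ⟨α, hα1, hα2, hα3⟩ := exists_rat_not_reciprocal
    (show h₀ - ε / 4 < h₀ by linarith)
  obtain ⟨β, hβ1, hβ2, hβ3⟩ := exists_rat_not_reciprocal (show h₀ < h₀ + ε / 4 by linarith)
  obtain ⟨κ, hκi, hκ1, hκ2⟩ := exists_irrational_btwn (show (0 : ℝ) < ε / 4 by linarith)
  have hM0 := tubeM_pos s
  have hM1 := (tubeM_lt_tubeR s).trans_le (tubeR_le_one s)
  obtain ⟨ms, hms⟩ := tubeM_rational s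
  refine ⟨{p | 0 < hc p.1 - α ∧ 0 < β - hc p.1 ∧
    0 < κ * hc p.1 - |gc p.1 - tubeM s * hc p.1|}, ?_, ?_, ?_⟩
  · intro q' hq'
    have e1 := eventually_pos_iff (q := q') (continuous_hcPt.sub (continuous_const (y := (α : ℝ))))
      (sub_ne_zero.2 (hc_ne_of_mem_ptQ hq' hα3))
    have e2 := eventually_pos_iff (q := q') ((continuous_const (y := (β : ℝ))).sub continuous_hcPt)
      (sub_ne_zero.2 (hc_ne_of_mem_ptQ hq' hβ3).symm)
    have e3 := eventually_pos_iff (q := q') (φ := fun p : Pt =>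
      κ * hc p.1 - |gc p.1 - tubeM s * hc p.1|) ((continuous_const.mul continuous_hcPt).sub
        (continuous_gcPt.sub (continuous_const.mul continuous_hcPt)).abs) (by
      obtain ⟨s', hg', hp', hh'⟩ := hq'
      obtain ⟨ms', hms'⟩ := tubeM_rational s'
      rw [hg', ← sub_mul, abs_mul, abs_of_pos hp', ← sub_mul]
      refine mul_ne_zero (sub_ne_zero.2 fun h => hκi ⟨|ms' - ms|, ?_⟩) hp'.ne'
      rw [h, hms, hms']; push_cast; rfl)
    filter_upwards [e1, e2, e3] with p h1 h2 h3
    exact and_congr h1 (and_congr h2 h3)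
  · refine ⟨by linarith, by linarith, ?_⟩
    rw [hg, sub_self, abs_zero, sub_zero]
    positivity
  · rintro p ⟨h1, h2, h3⟩
    have hp1 : hc p.1 ≤ 1 := by
      simp only [hc]; linarith [p.2.1.1]
    have hd := dist_toPt_le (gc p.1) (hc p.1) (gc q.1) (hc q.1)
    rw [toPt_gc_hc, toPt_gc_hc] at hd
    refine (show dist p q = dist p.1 q.1 from rfl) ▸ hd.trans_lt ?_
    have a1 : |hc p.1 - hc q.1| < ε / 4 := by rw [abs_lt]; constructor <;> linarith
    have a2 : |gc p.1 - tubeM s * hc p.1| < ε / 4 := by nlinarith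
    have a3 : |tubeM s * (hc p.1 - hc q.1)| ≤ |hc p.1 - hc q.1| := by
      rw [abs_mul, abs_of_pos hM0]
      exact mul_le_of_le_one_left (abs_nonneg _) hM1.le
    rw [hg]
    rw [abs_lt] at a1 a2
    have a3' := abs_le.1 (a3.trans (abs_le.2 ⟨a1.1.le, a1.2.le⟩))
    refine max_lt ?_ ?_
    · rw [abs_lt]
      constructor <;> linarith
    · have : |hc p.1 - hc q.1| < ε / 4 := abs_lt.2 a1
      linarith

/-! ### Infinite addresses -/

theorem exists_infinite_address (e : ℕ → Edge) :
    ∃ z : ℕ → Pt, ∀ i, z i = ptMap (e i) (z (i + 1)) := by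
  have : CompactSpace triB := isCompact_iff_compactSpace.1 isCompact_triB
  let F : ℕ → Set (ℕ → triB) := fun n => {z | ∀ i < n, (z i).1 = cmap (e i) (z (i + 1)).1}
  have hclosed : ∀ n, IsClosed (F n) := by
    intro n
    have : F n = ⋂ i, ⋂ _ : i < n, {z : ℕ → triB | (z i).1 = cmap (e i) (z (i + 1)).1} := by
      ext z; simp [F]
    rw [this]
    refine isClosed_iInter fun i => isClosed_iInter fun _ => isClosed_eq ?_ ?_
    · exact continuous_subtype_val.comp (continuous_apply i)
    · exact (continuous_cmap _).comp (continuous_subtype_val.comp (continuous_apply (i + 1)))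
  have hne : ∀ n, ∀ e : ℕ → Edge, ∃ z : ℕ → triB, ∀ i < n, (z i).1 = cmap (e i) (z (i + 1)).1 := by
    intro n
    induction n with
    | zero => exact fun e => ⟨fun _ => ⟨ptU, ptU_mem⟩, fun i hi => by omega⟩
    | succ n ih =>
      intro e
      obtain ⟨z, hz⟩ := ih fun i => e (i + 1)
      refine ⟨fun i => Nat.casesOn i ⟨cmap (e 0) (z 0), cmap_mem _ (z 0).2⟩ z, ?_⟩
      rintro (_ | i) hi
      · rfl
      · exact hz i (by omega)
  obtain ⟨z, hz⟩ := IsCompact.nonempty_iInter_of_sequence_nonempty_isCompact_isClosed F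
    (fun n z hz i hi => hz i (by omega)) (fun n => hne n e) (hclosed 0).isCompact hclosed
  have hz' : ∀ i, (z i).1 = cmap (e i) (z (i + 1)).1 := fun i =>
    mem_iInter.1 hz (i + 1) i (Nat.lt_succ_self i)
  refine ⟨fun i => ⟨z i, (z i).2, ?_⟩, fun i => Subtype.ext (hz' i)⟩
  have := not_inD_of_infinite_address (z := fun j => (z (i + j)).1) (e := fun j => e (i + j))
    (fun j => (z (i + j)).2) fun j => hz' (i + j)
  simpa using this

/-! ### The cell sets -/

/-- One step of the recursive description of the cell sets. -/
def cellStep (on : List Edge → Prop) (Z : List Edge → Set Pt) :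
    (List Edge → Set Pt) →o (List Edge → Set Pt) where
  toFun P a := {z | z ∈ Z a ∨ on a ∧ (z ∈ ptQ ∨ ∃ e w, w ∈ P (e :: a) ∧ ptMap e w = z)}
  monotone' := by
    intro P P' h a z hz
    exact hz.imp_right fun hz => ⟨hz.1, hz.2.imp_right fun ⟨e, w, hw, he⟩ => ⟨e, w, h _ hw, he⟩⟩

/-- The cell sets, in local coordinates. Cells which are not on only contain finitely many points;
the others contain the exceptional segments and the cell sets of all subcells. -/
def cellSet (on : List Edge → Prop) (Z : List Edge → Set Pt) : List Edge → Set Pt :=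
  (cellStep on Z).gfp

/-- The union of the part of `O` on the exceptional segments, and of pieces of subcells. -/
def glue (O : Set Pt) (G : Edge → Set Pt) : Set Pt :=
  {z | z ∈ ptQ ∧ z ∈ O ∨ ∃ e w, w ∈ G e ∧ ptMap e w = z}

theorem isClosed_glue {O : Set Pt} {G : Edge → Set Pt} (hG : ∀ e, IsClosed (G e))
    (hports : ∀ e, (G e).Nonempty → ptMap e vU ∈ O ∨ ptMap e vV ∈ O) (hO : LocConst O) :
    IsClosed (glue O G) := by
  rw [← isOpen_compl_iff, isOpen_iff_mem_nhds]
  intro z hz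
  have hnot : ∀ e, z ∉ ptMap e '' G e := fun e ⟨w, hw, he⟩ => hz (Or.inr ⟨e, w, hw, he⟩)
  have hfin : ∀ E : Set Edge, E.Finite → ∀ᶠ p in 𝓝 z, ∀ e ∈ E, p ∉ ptMap e '' G e :=
    fun E hE => hE.eventually_all.2 fun e _ =>
      (isClosed_image_ptMap e (hG e)).isOpen_compl.mem_nhds (hnot e)
  by_cases hzQ : z ∈ ptQ
  · have hzO : z ∉ O := fun h => hz (Or.inl ⟨hzQ, h⟩)
    obtain ⟨ε, hε, hball⟩ := Metric.eventually_nhds_iff.1 (hO z hzQ)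
    have hball' : ∀ p, dist p z < ε → p ∉ O := fun p hp h => hzO ((hball hp).1 h)
    filter_upwards [hfin _ (finite_edgeSize (half_pos hε)),
      Metric.ball_mem_nhds z (half_pos hε)] with p hp1 hp2
    rw [Metric.mem_ball] at hp2
    rintro (⟨-, h⟩ | ⟨e, w, hw, he⟩)
    · exact hball' p (by linarith) h
    · have hlt : edgeSize e < ε / 2 := by
        by_contra hge
        exact hp1 e (not_lt.1 hge) ⟨w, hw, he⟩
      have hv : ∀ v, ptMap e v ∉ O := fun v => by
        refine hball' _ ?_
        have h1 := dist_ptMap_le_size e v w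
        rw [he] at h1
        linarith [dist_triangle (ptMap e v) p z]
      exact (hports e ⟨w, hw⟩).elim (hv _) (hv _)
  · obtain ⟨E, hE, hev⟩ := locally_finite_ptMap hzQ
    filter_upwards [hev, hfin E hE] with p hp1 hp2
    rintro (⟨h, -⟩ | ⟨e, w, hw, he⟩)
    · exact hp1.1 h
    · exact hp2 e (hp1.2 e w he) ⟨w, hw, he⟩

section

variable {on : List Edge → Prop} {Z : List Edge → Set Pt}

theorem mem_cellSet {a : List Edge} {z : Pt} : z ∈ cellSet on Z a ↔
    z ∈ Z a ∨ on a ∧ (z ∈ ptQ ∨ ∃ e w, w ∈ cellSet on Z (e :: a) ∧ ptMap e w = z) := by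
  conv_lhs => rw [cellSet, ← OrderHom.map_gfp]
  rfl

theorem subset_cellSet {P : List Edge → Set Pt}
    (h : ∀ a, ∀ z ∈ P a, z ∈ Z a ∨ on a ∧ (z ∈ ptQ ∨ ∃ e w, w ∈ P (e :: a) ∧ ptMap e w = z))
    (a : List Edge) : P a ⊆ cellSet on Z a :=
  OrderHom.le_gfp (cellStep on Z) (a := P) h a

theorem ptMap_mem_cellSet {a : List Edge} (ha : on a) {e : Edge} {w : Pt}
    (hw : w ∈ cellSet on Z (e :: a)) : ptMap e w ∈ cellSet on Z a :=
  mem_cellSet.2 (Or.inr ⟨ha, Or.inr ⟨e, w, hw, rfl⟩⟩)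

theorem mem_cellSet_of_ptQ {a : List Edge} (ha : on a) {z : Pt} (hz : z ∈ ptQ) :
    z ∈ cellSet on Z a := mem_cellSet.2 (Or.inr ⟨ha, Or.inl hz⟩)

theorem finite_cellSet (hZ : ∀ a, (Z a).Finite) {a : List Edge} (ha : ¬ on a) :
    (cellSet on Z a).Finite :=
  (hZ a).subset fun _ hz => (mem_cellSet.1 hz).resolve_right fun h => ha h.1

theorem vertex_mem_cellSet (hon : ∀ a, on a → ∀ w, on (.inl w :: a)) {a : List Edge} (ha : on a)
    {z : Pt} (hz : IsVertex z) : z ∈ cellSet on Z a := by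
  refine subset_cellSet (P := fun a => {z | on a ∧ IsVertex z}) ?_ a ⟨ha, hz⟩
  rintro a z ⟨ha, rfl | rfl⟩
  · exact Or.inr ⟨ha, Or.inr ⟨_, vU, ⟨hon a ha _, Or.inl rfl⟩, ptMap_none_vU⟩⟩
  · exact Or.inr ⟨ha, Or.inr ⟨_, vU, ⟨hon a ha _, Or.inl rfl⟩, ptMap_root_vU⟩⟩

theorem isClosed_cellSet (hZ : ∀ a, (Z a).Finite) (a : List Edge) :
    IsClosed (cellSet on Z a) := by
  refine isClosed_of_closure_subset (subset_cellSet (P := fun a => closure (cellSet on Z a)) ?_ a)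
  intro a z hz
  by_cases ha : on a
  · have hc : IsClosed (Z a ∪ glue univ fun e => closure (cellSet on Z (e :: a))) :=
      (hZ a).isClosed.union (isClosed_glue (fun e => isClosed_closure)
        (fun e _ => Or.inl (mem_univ _)) fun q _ => Eventually.of_forall fun p => Iff.rfl)
    refine (closure_minimal ?_ hc hz).imp_right fun h => ⟨ha, h.imp_left And.left⟩
    intro w hw
    refine (mem_cellSet.1 hw).imp_right fun h => h.2.imp (fun h => ⟨h, mem_univ _⟩) ?_
    rintro ⟨e, w, hw, he⟩
    exact ⟨e, w, subset_closure hw, he⟩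
  · rw [(finite_cellSet hZ ha).isClosed.closure_eq] at hz
    exact Or.inl ((mem_cellSet.1 hz).resolve_right fun h => ha h.1)

/-- Relatively clopen subsets of a cell set. -/
def Clop (on : List Edge → Prop) (Z : List Edge → Set Pt) (a : List Edge) (G : Set Pt) : Prop :=
  G ⊆ cellSet on Z a ∧ IsClosed G ∧ IsClosed (cellSet on Z a \ G)

theorem Clop.diff {a : List Edge} {G : Set Pt} (h : Clop on Z a G) :
    Clop on Z a (cellSet on Z a \ G) :=
  ⟨sdiff_subset, h.2.2, by rw [sdiff_sdiff_cancel_left h.1]; exact h.2.1⟩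

theorem clop_of_finite (hZ : ∀ a, (Z a).Finite) {a : List Edge} (ha : ¬ on a) {G : Set Pt}
    (hG : G ⊆ cellSet on Z a) : Clop on Z a G :=
  ⟨hG, ((finite_cellSet hZ ha).subset hG).isClosed,
    ((finite_cellSet hZ ha).subset sdiff_subset).isClosed⟩

theorem clop_glue (hZ : ∀ a, (Z a).Finite) {a : List Edge} (ha : on a) {O : Set Pt}
    (hO : LocConst O) {G : Edge → Set Pt} (hG : ∀ e, Clop on Z (e :: a) (G e))
    (hcons : ∀ e z, IsVertex z → z ∈ cellSet on Z (e :: a) → (z ∈ G e ↔ ptMap e z ∈ O))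
    (hall : ∀ e, ptMap e vU ∈ O → ptMap e vV ∈ O → G e = cellSet on Z (e :: a))
    (hnone : ∀ e, ptMap e vU ∉ O → ptMap e vV ∉ O → G e = ∅) :
    Clop on Z a (glue O G) ∧
      (∀ e z, z ∈ cellSet on Z (e :: a) → (ptMap e z ∈ glue O G ↔ z ∈ G e)) ∧
      ∀ q ∈ ptQ, (q ∈ glue O G ↔ q ∈ O) := by
  have hmem : ∀ e z, z ∈ cellSet on Z (e :: a) → (ptMap e z ∈ glue O G ↔ z ∈ G e) := by
    intro e z hz
    refine ⟨?_, fun h => Or.inr ⟨e, z, h, rfl⟩⟩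
    rintro (⟨h, hO⟩ | ⟨e', w, hw, he⟩)
    · exact (hcons e z (Or.inl (ptMap_mem_ptQ h)) hz).2 hO
    · by_cases hee : e' = e
      · subst hee
        rwa [← ptMap_injective _ he]
      · obtain ⟨h1, h2⟩ := ptMap_incidence hee he
        have h3 := (hcons e' w h1 ((hG e').1 hw)).1 hw
        rw [he] at h3
        exact (hcons e z h2 hz).2 h3
  have hQ : ∀ q ∈ ptQ, (q ∈ glue O G ↔ q ∈ O) := by
    intro q hq
    refine ⟨?_, fun h => Or.inl ⟨hq, h⟩⟩
    rintro (⟨-, h⟩ | ⟨e, w, hw, rfl⟩)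
    · exact h
    · exact (hcons e w (Or.inl (ptMap_mem_ptQ hq)) ((hG e).1 hw)).1 hw
  refine ⟨⟨?_, ?_, ?_⟩, hmem, hQ⟩
  · rintro z (⟨h, -⟩ | ⟨e, w, hw, rfl⟩)
    · exact mem_cellSet_of_ptQ ha h
    · exact ptMap_mem_cellSet ha ((hG e).1 hw)
  · refine isClosed_glue (fun e => (hG e).2.1) (fun e he => ?_) hO
    by_contra hcon
    push Not at hcon
    rw [hnone e hcon.1 hcon.2] at he
    exact not_nonempty_empty he
  · have h1 : IsClosed (glue Oᶜ fun e => cellSet on Z (e :: a) \ G e) := by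
      refine isClosed_glue (fun e => (hG e).2.2) (fun e he => ?_) hO.compl
      by_contra hcon
      simp only [mem_compl_iff, not_or, not_not] at hcon
      rw [hall e hcon.1 hcon.2, sdiff_self] at he
      exact not_nonempty_empty he
    convert ((hZ a).subset (sdiff_subset (t := glue O G))).isClosed.union h1 using 1
    ext z
    constructor
    · rintro ⟨hz, hzG⟩
      rcases mem_cellSet.1 hz with h | ⟨-, h | ⟨e, w, hw, rfl⟩⟩
      · exact Or.inl ⟨h, hzG⟩
      · exact Or.inr (Or.inl ⟨h, fun h' => hzG ((hQ z h).2 h')⟩)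
      · exact Or.inr (Or.inr ⟨e, w, ⟨hw, fun h => hzG ((hmem e w hw).2 h)⟩, rfl⟩)
    · rintro (⟨h, hzG⟩ | ⟨h, hzO⟩ | ⟨e, w, ⟨hw, hwG⟩, rfl⟩)
      · exact ⟨mem_cellSet.2 (Or.inl h), hzG⟩
      · exact ⟨mem_cellSet_of_ptQ ha h, fun h' => hzO ((hQ z h).1 h')⟩
      · exact ⟨ptMap_mem_cellSet ha hw, fun h => hwG ((hmem e w hw).1 h)⟩

theorem exists_clop (hZ : ∀ a, (Z a).Finite) {a : List Edge} (ha : on a) {O : Set Pt}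
    (hO : LocConst O) (R : Edge → Set Pt → Prop)
    (hG : ∀ e, on (e :: a) → ¬ (ptMap e vU ∈ O ↔ ptMap e vV ∈ O) → ∃ G, Clop on Z (e :: a) G ∧
      (∀ z, IsVertex z → (z ∈ G ↔ ptMap e z ∈ O)) ∧ R e G) :
    ∃ G, Clop on Z a G ∧
      (∀ e z, IsVertex z → z ∈ cellSet on Z (e :: a) → (ptMap e z ∈ G ↔ ptMap e z ∈ O)) ∧
      (∀ q ∈ ptQ, (q ∈ G ↔ q ∈ O)) ∧
      ∀ z ∈ G, z ∈ O ∧ (z ∈ ptQ ∨ ∃ e w, IsVertex w ∧ ptMap e w = z) ∨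
        (∃ e w, ptMap e vU ∈ O ∧ ptMap e vV ∈ O ∧ ptMap e w = z) ∨
        ∃ e w G', R e G' ∧ w ∈ G' ∧ ptMap e w = z := by
  have key : ∀ e, ∃ G, Clop on Z (e :: a) G ∧
      (∀ z, IsVertex z → z ∈ cellSet on Z (e :: a) → (z ∈ G ↔ ptMap e z ∈ O)) ∧
      (ptMap e vU ∈ O → ptMap e vV ∈ O → G = cellSet on Z (e :: a)) ∧
      (ptMap e vU ∉ O → ptMap e vV ∉ O → G = ∅) ∧
      ∀ w ∈ G, IsVertex w ∧ ptMap e w ∈ O ∨ (ptMap e vU ∈ O ∧ ptMap e vV ∈ O) ∨ R e G := by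
    intro e
    by_cases hU : ptMap e vU ∈ O <;> by_cases hV : ptMap e vV ∈ O
    · refine ⟨cellSet on Z (e :: a), ⟨Subset.rfl, isClosed_cellSet hZ _, by simp⟩, ?_,
        fun _ _ => rfl, fun h => absurd hU h, fun w _ => Or.inr (Or.inl ⟨hU, hV⟩)⟩
      rintro z (rfl | rfl) hz
      · exact iff_of_true hz hU
      · exact iff_of_true hz hV
    rotate_right
    · refine ⟨∅, ⟨empty_subset _, isClosed_empty, by simpa using isClosed_cellSet hZ _⟩, ?_,
        fun h => absurd h hU, fun _ _ => rfl, fun w hw => absurd hw (notMem_empty w)⟩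
      rintro z (rfl | rfl) hz
      · exact iff_of_false (notMem_empty _) hU
      · exact iff_of_false (notMem_empty _) hV
    all_goals
      have hne : ¬ (ptMap e vU ∈ O ↔ ptMap e vV ∈ O) := by tauto
      by_cases hoe : on (e :: a)
      · obtain ⟨G, h1, h2, h3⟩ := hG e hoe hne
        exact ⟨G, h1, fun z hz _ => h2 z hz, by tauto, by tauto, fun _ _ => Or.inr (Or.inr h3)⟩
      · refine ⟨{z | z ∈ cellSet on Z (e :: a) ∧ IsVertex z ∧ ptMap e z ∈ O},
          clop_of_finite hZ hoe fun z hz => hz.1, ?_, by tauto, by tauto,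
          fun w hw => Or.inl hw.2⟩
        exact fun z hz hzK => ⟨fun h => h.2.2, fun h => ⟨hzK, hz, h⟩⟩
  choose G h1 h2 h3 h4 h5 using key
  obtain ⟨g1, g2, g3⟩ := clop_glue hZ ha hO h1 h2 h3 h4
  refine ⟨glue O G, g1, fun e z hz hzK => (g2 e z hzK).trans (h2 e z hz hzK), g3, ?_⟩
  rintro z (⟨h, hO⟩ | ⟨e, w, hw, rfl⟩)
  · exact Or.inl ⟨hO, Or.inl h⟩
  · rcases h5 e w hw with h | h | h
    · exact Or.inl ⟨h.2, Or.inr ⟨e, w, h.1, rfl⟩⟩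
    · exact Or.inr (Or.inl ⟨e, w, h.1, h.2, rfl⟩)
    · exact Or.inr (Or.inr ⟨e, w, G e, h, hw, rfl⟩)

theorem clop_image (hZ : ∀ a, (Z a).Finite) {a : List Edge} (ha : on a) {e : Edge} {G : Set Pt}
    (hG : Clop on Z (e :: a) G) (hQ : ∀ w ∈ G, ptMap e w ∉ ptQ)
    (hinc : ∀ w ∈ G, ∀ e' w', ptMap e' w' = ptMap e w → e' = e) :
    Clop on Z a (ptMap e '' G) := by
  classical
  refine ⟨?_, isClosed_image_ptMap e hG.2.1, ?_⟩
  · rintro _ ⟨w, hw, rfl⟩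
    exact ptMap_mem_cellSet ha (hG.1 hw)
  · have h1 : IsClosed (glue univ fun e' => cellSet on Z (e' :: a) \ {w | e' = e ∧ w ∈ G}) := by
      refine isClosed_glue (fun e' => ?_) (fun _ _ => Or.inl (mem_univ _))
        fun q _ => Eventually.of_forall fun p => Iff.rfl
      by_cases hee : e' = e
      · subst hee
        simpa using hG.2.2
      · simpa [hee] using isClosed_cellSet hZ _
    convert ((hZ a).subset (sdiff_subset (t := ptMap e '' G))).isClosed.union h1 using 1
    ext z
    constructor
    · rintro ⟨hz, hzG⟩
      rcases mem_cellSet.1 hz with h | ⟨-, h | ⟨e', w, hw, rfl⟩⟩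
      · exact Or.inl ⟨h, hzG⟩
      · exact Or.inr (Or.inl ⟨h, mem_univ _⟩)
      · refine Or.inr (Or.inr ⟨e', w, ⟨hw, ?_⟩, rfl⟩)
        rintro ⟨rfl, hwG⟩
        exact hzG ⟨w, hwG, rfl⟩
    · rintro (⟨h, hzG⟩ | ⟨h, -⟩ | ⟨e', w, ⟨hw, hwG⟩, rfl⟩)
      · exact ⟨mem_cellSet.2 (Or.inl h), hzG⟩
      · refine ⟨mem_cellSet_of_ptQ ha h, ?_⟩
        rintro ⟨w, hw, rfl⟩
        exact hQ w hw h
      · refine ⟨ptMap_mem_cellSet ha hw, ?_⟩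
        rintro ⟨w', hw', he⟩
        have := hinc w' hw' e' w he.symm
        subst this
        rw [ptMap_injective _ he] at hw'
        exact hwG ⟨rfl, hw'⟩

theorem clop_singleton (hZ : ∀ a, (Z a).Finite) {a : List Edge} {z : Pt}
    (hz : z ∈ cellSet on Z a) (hQ : z ∉ ptQ) (hne : ∀ e, ∀ w ∈ cellSet on Z (e :: a), ptMap e w ≠ z) :
    Clop on Z a {z} := by
  by_cases ha : on a
  · refine ⟨singleton_subset_iff.2 hz, isClosed_singleton, ?_⟩
    have h1 : IsClosed (glue univ fun e' => cellSet on Z (e' :: a)) :=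
      isClosed_glue (fun e' => isClosed_cellSet hZ _) (fun _ _ => Or.inl (mem_univ _))
        fun q _ => Eventually.of_forall fun p => Iff.rfl
    convert ((hZ a).subset (sdiff_subset (t := {z}))).isClosed.union h1 using 1
    ext w
    constructor
    · rintro ⟨hw, hwz⟩
      rcases mem_cellSet.1 hw with h | ⟨-, h | h⟩
      · exact Or.inl ⟨h, hwz⟩
      · exact Or.inr (Or.inl ⟨h, mem_univ _⟩)
      · exact Or.inr (Or.inr h)
    · rintro (⟨h, hwz⟩ | ⟨h, -⟩ | ⟨e, w, hw, rfl⟩)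
      · exact ⟨mem_cellSet.2 (Or.inl h), hwz⟩
      · refine ⟨mem_cellSet_of_ptQ ha h, ?_⟩
        rintro rfl
        exact hQ h
      · exact ⟨ptMap_mem_cellSet ha hw, hne e w hw⟩
  · exact clop_of_finite hZ ha (singleton_subset_iff.2 hz)

end

/-! ### Positions attached to cells -/

/-- The position attached to a cell, if the cell is on. -/
noncomputable def cellPos (C : ℕ → Set ((ℕ → Bool) × (ℕ → ℕ))) (x : ℕ → Bool) :
    List Edge → Option (List ℕ × ℕ)
  | [] => some ([], 0)
  | .inl _ :: a => (cellPos C x a).map fun _ => ([], 0)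
  | .inr (_, true) :: a => (cellPos C x a).map fun _ => ([], 0)
  | .inr (s, false) :: a => (cellPos C x a).bind fun p => childPos C x p s

/-- A cell is on if it has a position attached to it. -/
def CellOn (C : ℕ → Set ((ℕ → Bool) × (ℕ → ℕ))) (x : ℕ → Bool) (a : List Edge) : Prop :=
  ∃ p, cellPos C x a = some p

theorem cellPos_locally_constant (C : ℕ → Set ((ℕ → Bool) × (ℕ → ℕ))) (x : ℕ → Bool)
    (a : List Edge) : ∃ N, ∀ x' : ℕ → Bool, (∀ i < N, x' i = x i) →
      cellPos C x' a = cellPos C x a := by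
  induction a with
  | nil => exact ⟨0, fun _ _ => rfl⟩
  | cons e a ih =>
    obtain ⟨N, hN⟩ := ih
    rcases e with w | ⟨s, _ | _⟩
    · exact ⟨N, fun x' h => by simp only [cellPos, hN x' h]⟩
    · cases hp : cellPos C x a with
      | none => exact ⟨N, fun x' h => by simp only [cellPos, hN x' h, hp, Option.bind_none]⟩
      | some p =>
        obtain ⟨M, hM⟩ := childPos_locally_constant C p s
        refine ⟨max N M, fun x' h => ?_⟩
        simp only [cellPos, hN x' fun i hi => h i (lt_max_of_lt_left hi), hp, Option.bind_some]
        exact hM x x' fun i hi => h i (lt_max_of_lt_right hi)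
    · exact ⟨N, fun x' h => by simp only [cellPos, hN x' h]⟩

section

variable {C : ℕ → Set ((ℕ → Bool) × (ℕ → ℕ))} {x : ℕ → Bool} {Z : List Edge → Set Pt}
  {a : List Edge}

theorem cellPos_wall {p : List ℕ × ℕ} (h : cellPos C x a = some p) (w : Option (List ℕ) × ℕ) :
    cellPos C x (.inl w :: a) = some ([], 0) := by
  simp only [cellPos, h, Option.map_some]

theorem CellOn.wall (h : CellOn C x a) (w : Option (List ℕ) × ℕ) : CellOn C x (.inl w :: a) :=
  h.elim fun _ h => ⟨_, cellPos_wall h w⟩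

theorem CellOn.of_cons {e : Edge} (h : CellOn C x (e :: a)) : CellOn C x a := by
  obtain ⟨p, hp⟩ := h
  cases hq : cellPos C x a with
  | some q => exact ⟨q, hq⟩
  | none => rcases e with w | ⟨s, _ | _⟩ <;> simp [cellPos, hq] at hp

theorem vertex_mem (h : CellOn C x a) {z : Pt} (hz : IsVertex z) :
    z ∈ cellSet (CellOn C x) Z a := vertex_mem_cellSet (fun _ h => h.wall) h hz

/-- Cells with a winning position can be cut between their two vertices. -/
theorem WinPos.exists_cut (hZ : ∀ a, (Z a).Finite) {p : List ℕ × ℕ} (h : WinPos C x p) :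
    ∀ a, cellPos C x a = some p → ∃ G, Clop (CellOn C x) Z a G ∧ vU ∉ G ∧ vV ∈ G := by
  induction h with
  | intro p y h ih =>
    intro a ha
    have hon : CellOn C x a := ⟨p, ha⟩
    obtain ⟨O, hO, hU, hV, hout, hin⟩ := exists_branch_cut y
    obtain ⟨G, hG, hv, -, -⟩ := exists_clop hZ hon hO (fun _ _ => True) (by
      intro e ⟨q, hq⟩ hne
      obtain ⟨k, rfl⟩ : ∃ k, e = .inr (initSeg y k, false) := by
        by_contra hcon
        push Not at hcon
        exact hne (hout e hcon)
      obtain ⟨G, hG, hGU, hGV⟩ := ih k q (by simpa [cellPos, ha] using hq) _ hq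
      refine ⟨G, hG, ?_, trivial⟩
      rintro z (rfl | rfl)
      · exact iff_of_false hGU (hin k).1
      · exact iff_of_true hGV (hin k).2)
    refine ⟨G, hG, ?_, ?_⟩
    · have := hv (.inl (none, 0)) vU (Or.inl rfl) (vertex_mem (hon.wall _) (Or.inl rfl))
      rw [ptMap_none_vU] at this
      exact fun h => hU (this.1 h)
    · have := hv (.inl (some [], 0)) vU (Or.inl rfl) (vertex_mem (hon.wall _) (Or.inl rfl))
      rw [ptMap_root_vU] at this
      exact this.2 hV

theorem Clop.lift (hZ : ∀ a, (Z a).Finite) (ha : CellOn C x a) {e : Edge} {G : Set Pt}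
    (hG : Clop (CellOn C x) Z (e :: a) G) (hV : vV ∉ G)
    (hU : vU ∈ G → ptMap e vU ∉ ptQ ∧ ∀ e' w', ptMap e' w' = ptMap e vU → e' = e) :
    Clop (CellOn C x) Z a (ptMap e '' G) := by
  refine clop_image hZ ha hG ?_ ?_
  · intro w hw hq
    obtain rfl := ptMap_mem_ptQ hq
    exact (hU hw).1 hq
  · intro w hw e' w' h
    by_contra hne
    rcases (ptMap_incidence hne h).2 with rfl | rfl
    · exact hne ((hU hw).2 e' w' h)
    · exact hV hw

theorem exists_small_vU (hZ : ∀ a, (Z a).Finite) (hW : WinPos C x ([], 0)) (n : ℕ) :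
    ∀ a, CellOn C x a → ∃ G, Clop (CellOn C x) Z a G ∧ vU ∈ G ∧ vV ∉ G ∧
      ∀ z ∈ G, dist z vU ≤ (1 / 2) ^ n := by
  have lift : ∀ a G, CellOn C x a → Clop (CellOn C x) Z (.inl (none, 0) :: a) G → vU ∈ G →
      vV ∉ G → Clop (CellOn C x) Z a (ptMap (.inl (none, 0)) '' G) ∧
        vU ∈ ptMap (.inl (none, 0)) '' G ∧ vV ∉ ptMap (.inl (none, 0)) '' G := by
    intro a G ha hG hU hV
    refine ⟨hG.lift hZ ha hV fun _ => ?_, ⟨vU, hU, ptMap_none_vU⟩, ?_⟩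
    · rw [ptMap_none_vU]
      exact ⟨vU_notMem_ptQ, fun e' w' h => (ptMap_eq_vU h).1⟩
    · rintro ⟨w, -, h⟩
      exact absurd (ptMap_eq_vV h).1 (by simp)
  induction n with
  | zero =>
    intro a ha
    obtain ⟨p, hp⟩ := id ha
    obtain ⟨G, hG, hU, hV⟩ := hW.exists_cut hZ _ (cellPos_wall hp (none, 0))
    obtain ⟨h1, h2, h3⟩ := lift a _ ha hG.diff ⟨vertex_mem (ha.wall _) (Or.inl rfl), hU⟩
      fun h => h.2 hV
    exact ⟨_, h1, h2, h3, fun z _ => (Pt.dist_le_one z vU).trans_eq (pow_zero _).symm⟩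
  | succ n ih =>
    intro a ha
    obtain ⟨G, hG, hU, hV, hd⟩ := ih _ (ha.wall (none, 0))
    obtain ⟨h1, h2, h3⟩ := lift a _ ha hG hU hV
    refine ⟨_, h1, h2, h3, ?_⟩
    rintro _ ⟨w, hw, rfl⟩
    have h4 := dist_ptMap_le_half (.inl (none, 0)) w vU
    rw [ptMap_none_vU] at h4
    rw [pow_succ]
    linarith [hd w hw]

theorem exists_small_vV (hZ : ∀ a, (Z a).Finite) (hW : WinPos C x ([], 0)) (n : ℕ)
    (ha : CellOn C x a) : ∃ G, Clop (CellOn C x) Z a G ∧ vV ∈ G ∧ vU ∉ G ∧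
      ∀ z ∈ G, dist z vV ≤ (1 / 2) ^ n := by
  obtain ⟨G, hG, hU, hV, hd⟩ := exists_small_vU hZ hW n _ (ha.wall (some [], 0))
  refine ⟨_, hG.lift hZ ha hV fun _ => ?_, ⟨vU, hU, ptMap_root_vU⟩, ?_, ?_⟩
  · rw [ptMap_root_vU]
    exact ⟨vV_notMem_ptQ, fun e' w' h => (ptMap_eq_vV h).1⟩
  · rintro ⟨w, -, h⟩
    exact absurd (ptMap_eq_vU h).1 (by simp)
  · rintro _ ⟨w, hw, rfl⟩
    have h4 := dist_ptMap_le_half (.inl (some [], 0)) w vU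
    rw [ptMap_root_vU] at h4
    linarith [hd w hw, dist_nonneg (x := w) (y := vU)]

/-- Every set which is locally constant along the exceptional segments can be approximated by a
relatively clopen set. -/
theorem exists_clop_near (hZ : ∀ a, (Z a).Finite) (hW : WinPos C x ([], 0)) (ha : CellOn C x a)
    {O : Set Pt} (hO : LocConst O) {ε : ℝ} (hε : 0 < ε) :
    ∃ G, Clop (CellOn C x) Z a G ∧ (∀ z, IsVertex z → (z ∈ G ↔ z ∈ O)) ∧
      (∀ q ∈ ptQ, (q ∈ G ↔ q ∈ O)) ∧
      (∀ e z, IsVertex z → z ∈ cellSet (CellOn C x) Z (e :: a) →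
        (ptMap e z ∈ G ↔ ptMap e z ∈ O)) ∧
      ∀ z ∈ G, z ∈ O ∨ (∃ e w, ptMap e vU ∈ O ∧ ptMap e vV ∈ O ∧ ptMap e w = z) ∨
        ∃ e v, IsVertex v ∧ ptMap e v ∈ O ∧ dist z (ptMap e v) < ε := by
  obtain ⟨n, hn⟩ := exists_pow_lt_of_lt_one hε (show (1 / 2 : ℝ) < 1 by norm_num)
  obtain ⟨G, hG, hv, hq, hz⟩ := exists_clop hZ ha hO
    (fun e G => ∃ v, IsVertex v ∧ ptMap e v ∈ O ∧ ∀ w ∈ G, dist w v < ε) (by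
    intro e hoe hne
    by_cases hU : ptMap e vU ∈ O
    · have hV : ptMap e vV ∉ O := fun h => hne (iff_of_true hU h)
      obtain ⟨G, hG, h1, h2, h3⟩ := exists_small_vU hZ hW n _ hoe
      refine ⟨G, hG, ?_, vU, Or.inl rfl, hU, fun w hw => (h3 w hw).trans_lt hn⟩
      rintro z (rfl | rfl)
      · exact iff_of_true h1 hU
      · exact iff_of_false h2 hV
    · have hV : ptMap e vV ∈ O := by_contra fun h => hne (iff_of_false hU h)
      obtain ⟨G, hG, h1, h2, h3⟩ := exists_small_vV hZ hW n hoe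
      refine ⟨G, hG, ?_, vV, Or.inr rfl, hV, fun w hw => (h3 w hw).trans_lt hn⟩
      rintro z (rfl | rfl)
      · exact iff_of_false h2 hU
      · exact iff_of_true h1 hV)
  refine ⟨G, hG, ?_, hq, hv, ?_⟩
  · rintro z (rfl | rfl)
    · have := hv (.inl (none, 0)) vU (Or.inl rfl) (vertex_mem (ha.wall _) (Or.inl rfl))
      rwa [ptMap_none_vU] at this
    · have := hv (.inl (some [], 0)) vU (Or.inl rfl) (vertex_mem (ha.wall _) (Or.inl rfl))
      rwa [ptMap_root_vU] at this
  · intro z hzG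
    rcases hz z hzG with h | h | ⟨e, w, G', ⟨v, hv, hvO, hd⟩, hw, rfl⟩
    · exact Or.inl h.1
    · exact Or.inr (Or.inl h)
    · refine Or.inr (Or.inr ⟨e, v, hv, hvO, ?_⟩)
      have := dist_ptMap_le_half e w v
      linarith [hd w hw, dist_nonneg (x := w) (y := v)]

theorem exists_small_clop_ptQ (hZ : ∀ a, (Z a).Finite) (hW : WinPos C x ([], 0))
    (ha : CellOn C x a) {q : Pt} (hq : q ∈ ptQ) {ε : ℝ} (hε : 0 < ε) :
    ∃ G, Clop (CellOn C x) Z a G ∧ q ∈ G ∧ ∀ w ∈ G, dist w q < ε := by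
  set S : Set Pt := ((fun e => ptMap e vU) '' {e | ε / 2 ≤ edgeSize e} ∪
    (fun e => ptMap e vV) '' {e | ε / 2 ≤ edgeSize e}) \ {q} with hS
  have hfin : S.Finite := (((finite_edgeSize (half_pos hε)).image _).union
    ((finite_edgeSize (half_pos hε)).image _)).subset sdiff_subset
  obtain ⟨δ, hδ, hball⟩ := Metric.mem_nhds_iff.1
    (hfin.isClosed.isOpen_compl.mem_nhds (show q ∈ Sᶜ from fun h => h.2 rfl))
  obtain ⟨O, hO, hqO, hOd⟩ := exists_box hq (lt_min hδ (half_pos hε))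
  obtain ⟨G, hG, -, hGQ, -, hz⟩ := exists_clop_near hZ hW ha hO (half_pos hε)
  refine ⟨G, hG, (hGQ q hq).2 hqO, fun z hzG => ?_⟩
  rcases hz z hzG with h | ⟨e, w, h1, h2, rfl⟩ | ⟨e, v, -, h1, h2⟩
  · linarith [hOd z h, min_le_right δ (ε / 2)]
  · have hlt : edgeSize e < ε / 2 := by
      by_contra hge
      push Not at hge
      have e1 : ptMap e vU = q := by
        by_contra hne
        exact hball ((hOd _ h1).trans_le (min_le_left _ _)) ⟨Or.inl ⟨e, hge, rfl⟩, hne⟩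
      have e2 : ptMap e vV = q := by
        by_contra hne
        exact hball ((hOd _ h2).trans_le (min_le_left _ _)) ⟨Or.inr ⟨e, hge, rfl⟩, hne⟩
      exact vU_ne_vV (ptMap_injective e (e1.trans e2.symm))
    linarith [hOd _ h1, min_le_right δ (ε / 2), dist_ptMap_le_size e w vU,
      dist_triangle (ptMap e w) (ptMap e vU) q]
  · linarith [hOd _ h1, min_le_right δ (ε / 2), dist_triangle z (ptMap e v) q]

theorem exists_small_clop_port (hZ : ∀ a, (Z a).Finite) (hW : WinPos C x ([], 0))
    (ha : CellOn C x a) {e : Edge} {v : Pt} (hv : IsVertex v)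
    (hvK : v ∈ cellSet (CellOn C x) Z (e :: a)) (hQ : ptMap e v ∉ ptQ) {ε : ℝ} (hε : 0 < ε) :
    ∃ G, Clop (CellOn C x) Z a G ∧ ptMap e v ∈ G ∧ ∀ w ∈ G, dist w (ptMap e v) < ε := by
  obtain ⟨G, hG, -, -, hp, hz⟩ := exists_clop_near hZ hW ha
    (locConst_of_finite (finite_singleton (ptMap e v)) (by rintro _ rfl; exact hQ)) hε
  refine ⟨G, hG, (hp e v hv hvK).2 rfl, fun z hzG => ?_⟩
  rcases hz z hzG with h | ⟨e', w, h1, h2, -⟩ | ⟨e', v', -, h1, h2⟩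
  · rw [mem_singleton_iff.1 h, dist_self]
    exact hε
  · exact absurd (ptMap_injective e' (h1.trans h2.symm)) vU_ne_vV
  · rwa [mem_singleton_iff.1 h1] at h2

theorem exists_clop_avoiding (hZ : ∀ a, (Z a).Finite) (hW : WinPos C x ([], 0))
    (ha : CellOn C x a) {z : Pt} (hz : z ∈ cellSet (CellOn C x) Z a) (hv : ¬ IsVertex z) :
    ∃ G, Clop (CellOn C x) Z a G ∧ z ∈ G ∧ vU ∉ G ∧ vV ∉ G := by
  have hU : 0 < dist z vU := dist_pos.2 fun h => hv (Or.inl h)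
  have hV : 0 < dist z vV := dist_pos.2 fun h => hv (Or.inr h)
  obtain ⟨G, hG, hvert, -, -, hzG⟩ := exists_clop_near hZ hW ha
    (locConst_of_finite (O := {vU, vV}) (by simp) (by
      rintro _ (rfl | rfl)
      exacts [vU_notMem_ptQ, vV_notMem_ptQ])) (lt_min hU hV)
  refine ⟨_, hG.diff, ⟨hz, fun h => ?_⟩, fun h => h.2 ((hvert _ (Or.inl rfl)).2 (by simp)),
    fun h => h.2 ((hvert _ (Or.inr rfl)).2 (by simp))⟩
  rcases hzG z h with h | ⟨e', w, h1, h2, -⟩ | ⟨e', v', -, h1, h2⟩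
  · exact hv h
  · rcases h2 with h2 | h2
    · exact vU_ne_vV (ptMap_eq_vU h2).2.symm
    · exact vU_ne_vV (ptMap_eq_vV h2).2.symm
  · rcases h1 with h1 | h1
    · rw [h1] at h2
      exact (h2.trans_le (min_le_left _ _)).false
    · rw [mem_singleton_iff.1 h1] at h2
      exact (h2.trans_le (min_le_right _ _)).false

theorem exists_small_clop_avoiding (hZ : ∀ a, (Z a).Finite) (hW : WinPos C x ([], 0)) (n : ℕ) :
    ∀ a, CellOn C x a → ∀ z ∈ cellSet (CellOn C x) Z a, ¬ IsVertex z →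
      ∃ G, Clop (CellOn C x) Z a G ∧ z ∈ G ∧ vU ∉ G ∧ vV ∉ G ∧
        ∀ w ∈ G, dist w z ≤ (1 / 2) ^ n := by
  induction n with
  | zero =>
    intro a ha z hz hv
    obtain ⟨G, h1, h2, h3, h4⟩ := exists_clop_avoiding hZ hW ha hz hv
    exact ⟨G, h1, h2, h3, h4, fun w _ => (Pt.dist_le_one w z).trans_eq (pow_zero _).symm⟩
  | succ n ih =>
    intro a ha z hz hv
    set ε := min ((1 / 2 : ℝ) ^ (n + 1)) (min (dist z vU) (dist z vV)) with hεdef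
    have hε : 0 < ε := lt_min (by positivity) (lt_min (dist_pos.2 fun h => hv (Or.inl h))
      (dist_pos.2 fun h => hv (Or.inr h)))
    have small : (∃ G, Clop (CellOn C x) Z a G ∧ z ∈ G ∧ ∀ w ∈ G, dist w z < ε) →
        ∃ G, Clop (CellOn C x) Z a G ∧ z ∈ G ∧ vU ∉ G ∧ vV ∉ G ∧
          ∀ w ∈ G, dist w z ≤ (1 / 2) ^ (n + 1) := by
      rintro ⟨G, h1, h2, h3⟩
      refine ⟨G, h1, h2, fun h => ?_, fun h => ?_, fun w hw => (h3 w hw).le.trans (min_le_left _ _)⟩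
      · exact absurd (h3 _ h) (not_lt.2 (((min_le_right _ _).trans (min_le_left _ _)).trans_eq
          (dist_comm _ _)))
      · exact absurd (h3 _ h) (not_lt.2 (((min_le_right _ _).trans (min_le_right _ _)).trans_eq
          (dist_comm _ _)))
    by_cases hQ : z ∈ ptQ
    · exact small (exists_small_clop_ptQ hZ hW ha hQ hε)
    by_cases hpre : ∃ e, ∃ w ∈ cellSet (CellOn C x) Z (e :: a), ptMap e w = z
    · obtain ⟨e, w, hw, rfl⟩ := hpre
      by_cases hvw : IsVertex w
      · exact small (exists_small_clop_port hZ hW ha hvw hw hQ hε)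
      · obtain ⟨G, h1, h2, h3, h4, h5⟩ : ∃ G, Clop (CellOn C x) Z (e :: a) G ∧ w ∈ G ∧ vU ∉ G ∧
            vV ∉ G ∧ ∀ w' ∈ G, dist w' w ≤ (1 / 2) ^ n := by
          by_cases hoe : CellOn C x (e :: a)
          · exact ih _ hoe w hw hvw
          · refine ⟨{w}, clop_of_finite hZ hoe (singleton_subset_iff.2 hw), rfl,
              fun h => hvw (Or.inl h.symm), fun h => hvw (Or.inr h.symm), ?_⟩
            rintro _ rfl
            rw [dist_self]
            positivity
        have vert : ∀ v, IsVertex v → v ∈ ptMap e '' G → False := by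
          rintro v hv' ⟨w', hw', rfl⟩
          have : w' = vU := hv'.elim (fun h => (ptMap_eq_vU h).2) fun h => (ptMap_eq_vV h).2
          exact h3 (this ▸ hw')
        refine ⟨ptMap e '' G, h1.lift hZ ha h4 fun h => absurd h h3, ⟨w, h2, rfl⟩,
          vert _ (Or.inl rfl), vert _ (Or.inr rfl), ?_⟩
        rintro _ ⟨w', hw', rfl⟩
        rw [pow_succ]
        linarith [h5 w' hw', dist_ptMap_le_half e w' w]
    · refine small ⟨{z}, clop_singleton hZ hz hQ (fun e w hw h => hpre ⟨e, w, hw, h⟩), rfl, ?_⟩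
      rintro _ rfl
      rwa [dist_self]

/-- If player I wins then the cell sets are zero-dimensional. -/
theorem exists_small_clop (hZ : ∀ a, (Z a).Finite) (hW : WinPos C x ([], 0)) (ha : CellOn C x a)
    {z : Pt} (hz : z ∈ cellSet (CellOn C x) Z a) {ε : ℝ} (hε : 0 < ε) :
    ∃ G, Clop (CellOn C x) Z a G ∧ z ∈ G ∧ ∀ w ∈ G, dist w z < ε := by
  obtain ⟨n, hn⟩ := exists_pow_lt_of_lt_one hε (show (1 / 2 : ℝ) < 1 by norm_num)
  by_cases hv : IsVertex z
  · rcases hv with rfl | rfl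
    · obtain ⟨G, h1, h2, -, h3⟩ := exists_small_vU hZ hW n a ha
      exact ⟨G, h1, h2, fun w hw => (h3 w hw).trans_lt hn⟩
    · obtain ⟨G, h1, h2, -, h3⟩ := exists_small_vV hZ hW n ha
      exact ⟨G, h1, h2, fun w hw => (h3 w hw).trans_lt hn⟩
  · obtain ⟨G, h1, h2, -, -, h3⟩ := exists_small_clop_avoiding hZ hW n a ha z hz hv
    exact ⟨G, h1, h2, fun w hw => (h3 w hw).trans_lt hn⟩

/-! ### Cells with a losing position -/

theorem exists_branch_change {M : Option (List ℕ) → Prop} (h0 : ¬ (M none ↔ M (some [])))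
    (hlim : ∀ s, (∀ n, M (some (n :: s)) ↔ M (some (0 :: s))) →
      (M (some (0 :: s)) ↔ M (some s))) :
    ∃ y : ℕ → ℕ, ∀ k, ¬ (M (leftWall (initSeg y k)) ↔ M (some (initSeg y k))) := by
  have step : ∀ s, ¬ (M (leftWall s) ↔ M (some s)) →
      ∃ n, ¬ (M (leftWall (n :: s)) ↔ M (some (n :: s))) := by
    intro s hs
    by_contra hcon
    push Not at hcon
    have h1 : ∀ n, M (some (n :: s)) ↔ M (leftWall s) := by
      intro n
      induction n with
      | zero => exact (hcon 0).symm
      | succ n ih => exact (hcon (n + 1)).symm.trans ih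
    exact hs ((h1 0).symm.trans (hlim s fun n => (h1 n).trans (h1 0).symm))
  choose! f hf using step
  let S : ℕ → List ℕ := fun k => Nat.rec [] (fun _ s => f s :: s) k
  have hS : ∀ k, initSeg (fun k => f (S k)) k = S k := by
    intro k
    induction k with
    | zero => rfl
    | succ k ih => rw [initSeg, ih]
  refine ⟨fun k => f (S k), fun k => ?_⟩
  rw [hS]
  induction k with
  | zero => exact h0
  | succ k ih => exact hf _ ih

theorem exists_separated_subcell (hW : ¬ WinPos C x ([], 0)) {p : List ℕ × ℕ}
    (ha : cellPos C x a = some p) (hp : ¬ WinPos C x p) {G : Set Pt}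
    (hG : Clop (CellOn C x) Z a G) (hsep : ¬ (vU ∈ G ↔ vV ∈ G)) :
    ∃ e q, cellPos C x (e :: a) = some q ∧ ¬ WinPos C x q ∧
      ¬ (ptMap e vU ∈ G ↔ ptMap e vV ∈ G) := by
  by_contra hcon
  push Not at hcon
  have hon : CellOn C x a := ⟨p, ha⟩
  have wall : ∀ t m, ptMap (.inl (t, m)) vU ∈ G ↔ ptMap (.inl (t, 0)) vU ∈ G := by
    intro t m
    induction m with
    | zero => rfl
    | succ m ih =>
      rw [← ptMap_wall_consecutive, ← ih]
      exact (hcon _ _ (cellPos_wall ha _) hW).symm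
  let M : Option (List ℕ) → Prop := fun t => ptMap (.inl (t, 0)) vU ∈ G
  obtain ⟨y, hy⟩ := exists_branch_change (M := M)
    (by simpa only [M, ptMap_none_vU, ptMap_root_vU] using hsep) (by
    intro s hs
    have h1 : ptMap (.inr (s, true)) vU ∈ G ↔ M (some s) := by
      obtain ⟨m, hm⟩ := ptMap_rung_right s true
      rw [hcon (.inr (s, true)) ([], 0) (by simp [cellPos, ha]) hW, hm, wall]
    rw [← h1]
    by_cases h : M (some (0 :: s))
    · exact iff_of_true h (hG.2.1.mem_of_tendsto (tendsto_ptMap_wall s)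
        (Eventually.of_forall fun n => (hs n).2 h))
    · refine iff_of_false h (hG.2.2.mem_of_tendsto (tendsto_ptMap_wall s)
        (Eventually.of_forall fun n => ⟨?_, fun h' => h ((hs n).1 h')⟩)).2
      exact ptMap_mem_cellSet hon (vertex_mem (hon.wall _) (Or.inl rfl)))
  refine hp (.intro p y fun k q hq => ?_)
  by_contra hlose
  have h1 := hcon (.inr (initSeg y k, false)) q (by simpa [cellPos, ha] using hq) hlose
  obtain ⟨m, hm⟩ := ptMap_rung_right (initSeg y k) false
  obtain ⟨m', hm'⟩ := ptMap_rung_left (initSeg y k)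
  rw [hm, hm', wall _ m, wall _ m'] at h1
  exact hy k h1

/-- The preimage of a relatively clopen set in a subcell. -/
theorem Clop.preimage (hZ : ∀ a, (Z a).Finite) (ha : CellOn C x a) {G : Set Pt}
    (hG : Clop (CellOn C x) Z a G) (e : Edge) :
    Clop (CellOn C x) Z (e :: a) (cellSet (CellOn C x) Z (e :: a) ∩ ptMap e ⁻¹' G) := by
  refine ⟨inter_subset_left, (isClosed_cellSet hZ _).inter (hG.2.1.preimage (continuous_ptMap e)),
    ?_⟩
  convert (isClosed_cellSet hZ (e :: a)).inter (hG.2.2.preimage (continuous_ptMap e)) using 1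
  ext z
  constructor
  · rintro ⟨h1, h2⟩
    exact ⟨h1, ptMap_mem_cellSet ha h1, fun h => h2 ⟨h1, h⟩⟩
  · rintro ⟨h1, h2⟩
    exact ⟨h1, fun h => h2.2 h.2⟩

/-- The map of a cell into the whole triangle. -/
noncomputable def cellMap : List Edge → Pt → Pt
  | [] => id
  | e :: a => cellMap a ∘ ptMap e

theorem dist_cellMap_le (a : List Edge) (z w : Pt) :
    dist (cellMap a z) (cellMap a w) ≤ (1 / 2) ^ a.length * dist z w := by
  induction a generalizing z w with
  | nil => simp [cellMap]
  | cons e a ih =>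
    refine (ih _ _).trans ?_
    rw [List.length_cons, pow_succ, mul_assoc]
    exact mul_le_mul_of_nonneg_left (dist_ptMap_le_half e z w) (by positivity)

theorem cellMap_mem_cellSet (ha : CellOn C x a) {w : Pt} (hw : w ∈ cellSet (CellOn C x) Z a) :
    cellMap a w ∈ cellSet (CellOn C x) Z [] := by
  induction a generalizing w with
  | nil => exact hw
  | cons e a ih => exact ih ha.of_cons (ptMap_mem_cellSet ha.of_cons hw)

theorem Clop.preimage_cellMap (hZ : ∀ a, (Z a).Finite) (ha : CellOn C x a) {G : Set Pt}
    (hG : Clop (CellOn C x) Z [] G) :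
    Clop (CellOn C x) Z a (cellSet (CellOn C x) Z a ∩ cellMap a ⁻¹' G) := by
  induction a with
  | nil => simpa [cellMap, inter_eq_right.2 hG.1] using hG
  | cons e a ih =>
    convert (ih ha.of_cons).preimage hZ ha.of_cons e using 1
    ext z
    exact ⟨fun h => ⟨h.1, ptMap_mem_cellSet ha.of_cons h.1, h.2⟩, fun h => ⟨h.1, h.2.2⟩⟩

/-- If player I does not win, then the two vertices are in the same quasi-component. -/
theorem Clop.vU_mem_iff_vV_mem (hZ : ∀ a, (Z a).Finite) (hW : ¬ WinPos C x ([], 0)) {G : Set Pt}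
    (hG : Clop (CellOn C x) Z [] G) : vU ∈ G ↔ vV ∈ G := by
  by_contra hsep
  let Bad : List Edge → Prop := fun a => ∃ p, cellPos C x a = some p ∧ ¬ WinPos C x p ∧
    ¬ (cellMap a vU ∈ G ↔ cellMap a vV ∈ G)
  have step : ∀ a, Bad a → ∃ e, Bad (e :: a) := by
    rintro a ⟨p, ha, hp, hs⟩
    have hon : CellOn C x a := ⟨p, ha⟩
    have hport : ∀ z ∈ cellSet (CellOn C x) Z a,
        (z ∈ cellSet (CellOn C x) Z a ∩ cellMap a ⁻¹' G ↔ cellMap a z ∈ G) :=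
      fun z hz => ⟨fun h => h.2, fun h => ⟨hz, h⟩⟩
    have hvert : ∀ z, IsVertex z → z ∈ cellSet (CellOn C x) Z a := fun z hz => vertex_mem hon hz
    obtain ⟨e, q, he, hq, hs'⟩ := exists_separated_subcell hW ha hp
      (hG.preimage_cellMap hZ hon) (by
        rwa [hport _ (hvert _ (Or.inl rfl)), hport _ (hvert _ (Or.inr rfl))])
    have hvert' : ∀ z, IsVertex z → z ∈ cellSet (CellOn C x) Z (e :: a) :=
      fun z hz => vertex_mem ⟨q, he⟩ hz
    rw [hport _ (ptMap_mem_cellSet hon (hvert' _ (Or.inl rfl))),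
      hport _ (ptMap_mem_cellSet hon (hvert' _ (Or.inr rfl)))] at hs'
    exact ⟨e, q, he, hq, hs'⟩
  have h0 : Bad [] := ⟨([], 0), rfl, hW, hsep⟩
  have : Nonempty Edge := ⟨.inl (none, 0)⟩
  choose! f hf using step
  let A : ℕ → List Edge := fun n => Nat.rec [] (fun _ a => f a :: a) n
  have hA : ∀ n, Bad (A n) := by
    intro n
    induction n with
    | zero => exact h0
    | succ n ih => exact hf _ ih
  have hon : ∀ n, CellOn C x (A n) := fun n => (hA n).imp fun _ h => h.1
  have hlen : ∀ n, (A n).length = n := by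
    intro n
    induction n with
    | zero => rfl
    | succ n ih => exact congrArg Nat.succ ih
  obtain ⟨z, hz⟩ := exists_infinite_address fun n => f (A n)
  have hz0 : ∀ n, cellMap (A n) (z n) = z 0 := by
    intro n
    induction n with
    | zero => rfl
    | succ n ih => rw [← ih, hz n]; rfl
  have hz0K : z 0 ∈ cellSet (CellOn C x) Z [] := by
    refine subset_cellSet (P := fun b => {w | ∃ n, b = A n ∧ w = z n}) ?_ [] ⟨0, rfl, rfl⟩
    rintro _ _ ⟨n, rfl, rfl⟩
    exact Or.inr ⟨hon n, Or.inr ⟨f (A n), z (n + 1), ⟨n + 1, rfl, rfl⟩, (hz n).symm⟩⟩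
  have hport : ∀ v, Tendsto (fun n => cellMap (A n) v) atTop (𝓝 (z 0)) := by
    intro v
    refine tendsto_iff_dist_tendsto_zero.2 (squeeze_zero (fun _ => dist_nonneg) (fun n => ?_)
      (tendsto_pow_atTop_nhds_zero_of_lt_one (r := (1 / 2 : ℝ)) (by norm_num) (by norm_num)))
    rw [← hz0 n]
    refine (dist_cellMap_le _ _ _).trans ?_
    rw [hlen]
    exact mul_le_of_le_one_right (by positivity) (Pt.dist_le_one _ _)
  have hmem : ∀ n v, IsVertex v → cellMap (A n) v ∈ cellSet (CellOn C x) Z [] :=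
    fun n v hv => cellMap_mem_cellSet (hon n) (vertex_mem (hon n) hv)
  by_cases hzG : z 0 ∈ G
  · have hev : ∀ v, IsVertex v → ∀ᶠ n in atTop, cellMap (A n) v ∈ G := fun v hv =>
      ((hport v).eventually (hG.2.2.isOpen_compl.mem_nhds fun h => h.2 hzG)).mono
        fun n hn => by_contra fun h => hn ⟨hmem n v hv, h⟩
    obtain ⟨n, h1, h2⟩ := ((hev _ (Or.inl rfl)).and (hev _ (Or.inr rfl))).exists
    exact (hA n).elim fun _ h => h.2.2 (iff_of_true h1 h2)
  · have hev : ∀ v, IsVertex v → ∀ᶠ n in atTop, cellMap (A n) v ∉ G := fun v hv =>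
      (hport v).eventually (hG.2.1.isOpen_compl.mem_nhds hzG)
    obtain ⟨n, h1, h2⟩ := ((hev _ (Or.inl rfl)).and (hev _ (Or.inr rfl))).exists
    exact (hA n).elim fun _ h => h.2.2 (iff_of_false h1 h2)

end

/-! ### Embedding into the cube -/

/-- The rational numbers, as a subfield of the real numbers. -/
noncomputable abbrev ratField : Subfield ℝ := (Rat.castHom ℝ).fieldRange

theorem irrational_of_notMem_ratField {r : ℝ} (h : r ∉ ratField) : Irrational r := h

theorem half_mem_ratField {r : ℝ} (h : r ∈ ratField) : r / 2 ∈ ratField :=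
  div_mem h (ofNat_mem ratField 2)

theorem tube_mem_ratField (s : List ℕ) :
    tubeW s ∈ ratField ∧ tubeM s ∈ ratField ∧ tubeR s ∈ ratField := by
  obtain ⟨⟨p, hp⟩, ⟨q, hq⟩⟩ := tube_rational s
  have h1 : tubeL s ∈ ratField := ⟨p, hp.symm⟩
  have h2 : tubeW s ∈ ratField := ⟨q, hq.symm⟩
  exact ⟨h2, add_mem h1 (half_mem_ratField h2), add_mem h1 h2⟩

theorem wall_mem_ratField (t : Option (List ℕ)) (m : ℕ) : wallPos t ∈ ratField ∧
    wallWidth t ∈ ratField ∧ wallHeight t m ∈ ratField ∧ wallLen t m ∈ ratField := by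
  have hH : ∀ m, wallHeight t m ∈ ratField := fun m =>
    div_mem (natCast_mem _ _) (add_mem (mul_mem (natCast_mem _ _) (natCast_mem _ _))
      (natCast_mem _ _))
  refine ⟨?_, ?_, hH m, sub_mem (hH m) (hH _)⟩
  · cases t with
    | none => exact zero_mem _
    | some s => exact (tube_mem_ratField s).2.2
  · cases t with
    | none => exact one_mem _
    | some s => exact (tube_mem_ratField s).1

theorem rung_mem_ratField (s : List ℕ) (i : Bool) : rungLeft s i ∈ ratField ∧
    rungWd s i ∈ ratField ∧ (1 / rungJ s i : ℝ) ∈ ratField := by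
  have h : rungWd s i ∈ ratField := by
    cases i
    · exact (tube_mem_ratField s).1
    · exact half_mem_ratField (tube_mem_ratField s).1
  exact ⟨sub_mem (tube_mem_ratField s).2.2 h, h, div_mem (one_mem _) (natCast_mem _ _)⟩

theorem toPt_mem_ratField {g h : ℝ} (hg : g ∈ ratField) (hh : h ∈ ratField) :
    (toPt g h).1 ∈ ratField ∧ (toPt g h).2 ∈ ratField :=
  ⟨add_mem hg (half_mem_ratField (sub_mem (one_mem _) hh)),
    div_mem (sub_mem (one_mem _) hh) (ofNat_mem ratField 4)⟩

theorem InD.mem_ratField {z : ℝ × ℝ} (h : InD z) : z.1 ∈ ratField ∧ z.2 ∈ ratField := by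
  induction h with
  | base z hz =>
    rcases hz with rfl | ⟨s, hg, -, -, q, hq⟩
    · exact toPt_mem_ratField (zero_mem _) (zero_mem _)
    · have h1 : hc z ∈ ratField := ⟨q, hq.symm⟩
      rw [← toPt_gc_hc z, hg]
      exact toPt_mem_ratField (mul_mem (tube_mem_ratField s).2.1 h1) h1
  | map e z _ ih =>
    obtain ⟨h1, h2⟩ := ih
    rcases e with ⟨t, m⟩ | ⟨s, i⟩
    · obtain ⟨a1, a2, a3, a4⟩ := wall_mem_ratField t m
      have a5 := sub_mem a3 (mul_mem h1 a4)
      exact toPt_mem_ratField (sub_mem (mul_mem a1 a5)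
        (mul_mem h2 (div_mem (mul_mem a4 a2) (ofNat_mem ratField 8)))) a5
    · obtain ⟨a1, a2, a3⟩ := rung_mem_ratField s i
      have a4 := add_mem a3 (mul_mem h2 (pow_mem a3 2))
      exact toPt_mem_ratField (add_mem (mul_mem a1 a4) (mul_mem (mul_mem h1 a2) a3)) a4

theorem exists_cube_embedding : ∃ j : Pt → ↥cubeMinusQ5, IsClosedEmbedding j := by
  have hR : (ratField : Set ℝ).Countable := by
    rw [RingHom.coe_fieldRange]
    exact countable_range _
  have hRR : {z : ℝ × ℝ | z.1 ∈ ratField ∧ z.2 ∈ ratField}.Countable :=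
    (hR.prod hR).mono fun z hz => hz
  obtain ⟨g, hg, hg01, hgD, hgE⟩ := exists_continuous_rational_irrational
    (D := {z | InD z}) (E := {z | (z.1 ∈ ratField ∧ z.2 ∈ ratField) ∧ ¬ InD z})
    (hRR.mono fun z hz => InD.mem_ratField hz) (hRR.mono fun z hz => hz.1) fun z hz h => h.2 hz
  let j₀ : Pt → Fin 5 → Icc (0 : ℝ) 1 := fun z =>
    ![⟨z.1.1, by linarith [z.2.1.1, z.2.1.2.1], by linarith [z.2.1.1, z.2.1.2.2]⟩,
      ⟨z.1.2, z.2.1.1, by linarith [z.2.1.1, z.2.1.2.1, z.2.1.2.2]⟩, ⟨g z.1, hg01 _⟩, 0, 0]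
  have hj₀ : ∀ z, j₀ z ∈ cubeMinusQ5 := by
    intro z
    by_cases h1 : z.1.1 ∈ ratField
    · by_cases h2 : z.1.2 ∈ ratField
      · exact ⟨2, hgE z.1 ⟨⟨h1, h2⟩, z.2.2⟩⟩
      · exact ⟨1, irrational_of_notMem_ratField h2⟩
    · exact ⟨0, irrational_of_notMem_ratField h1⟩
  refine ⟨fun z => ⟨j₀ z, hj₀ z⟩, .of_continuous_injective_isClosedMap ?_ ?_ ?_⟩
  · refine Continuous.subtype_mk (continuous_pi fun i => ?_) _
    fin_cases i
    · exact Continuous.subtype_mk (continuous_fst.comp continuous_subtype_val) _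
    · exact Continuous.subtype_mk (continuous_snd.comp continuous_subtype_val) _
    · exact Continuous.subtype_mk (hg.comp continuous_subtype_val) _
    · exact continuous_const
    · exact continuous_const
  · intro z w h
    have h' : j₀ z = j₀ w := congrArg Subtype.val h
    exact Subtype.ext (Prod.ext (congrArg Subtype.val (congrFun h' 0))
      (congrArg Subtype.val (congrFun h' 1)))
  · intro A hA
    obtain ⟨A', hA', rfl⟩ := isClosed_induced_iff.1 hA
    let c : Fin 5 → ↥cubeMinusQ5 → ℝ := fun i y => (y.1 i : ℝ)
    have hc : ∀ i, Continuous (c i) := fun i =>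
      continuous_subtype_val.comp ((continuous_apply i).comp continuous_subtype_val)
    have hcl : IsClosed {y | (c 0 y, c 1 y) ∈ A' ∩ triB ∧ c 2 y = g (c 0 y, c 1 y) ∧
        c 3 y = 0 ∧ c 4 y = 0} :=
      ((hA'.inter isCompact_triB.isClosed).preimage ((hc 0).prodMk (hc 1))).inter
        ((isClosed_eq (hc 2) (hg.comp ((hc 0).prodMk (hc 1)))).inter
          ((isClosed_eq (hc 3) continuous_const).inter (isClosed_eq (hc 4) continuous_const)))
    convert hcl using 1
    ext y
    constructor
    · rintro ⟨z, hz, rfl⟩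
      exact ⟨⟨hz, z.2.1⟩, rfl, rfl, rfl⟩
    · rintro ⟨⟨h1, h2⟩, h3, h4, h5⟩
      have hnD : ¬ InD (c 0 y, c 1 y) := by
        intro hD
        obtain ⟨i, hi⟩ := y.2
        have h0 := hD.mem_ratField
        obtain ⟨q, hq⟩ := hgD _ hD
        fin_cases i
        · exact hi h0.1
        · exact hi h0.2
        · exact hi ⟨q, (h3.trans hq).symm⟩
        · exact hi ⟨0, by simpa using h4.symm⟩
        · exact hi ⟨0, by simpa using h5.symm⟩
      refine ⟨⟨(c 0 y, c 1 y), h2, hnD⟩, h1, Subtype.ext (funext fun i => Subtype.ext ?_)⟩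
      fin_cases i
      · rfl
      · rfl
      · exact h3.symm
      · exact h4.symm
      · exact h5.symm

/-! ### Continuity and the reduction -/

theorem continuous_vietoris {T Y : Type*} [TopologicalSpace T] [MetricSpace Y] [CompactSpace Y]
    {K : T → Set Y} (h : ∀ t, ∀ ε > 0, ∀ᶠ t' in 𝓝 t,
      (∀ y ∈ K t, ∃ y' ∈ K t', dist y y' < ε) ∧ ∀ y' ∈ K t', ∃ y ∈ K t, dist y' y < ε) :
    @Continuous T (Set Y) _ (vietoris Y) fun t => closure (K t) := by
  refine continuous_generateFrom_iff.2 ?_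
  rintro _ (⟨U, hU, rfl⟩ | ⟨U, hU, rfl⟩)
  · refine isOpen_iff_mem_nhds.2 fun t (ht : closure (K t) ⊆ U) => ?_
    obtain ⟨δ, hδ, hsub⟩ := isClosed_closure.isCompact.exists_cthickening_subset_open hU ht
    filter_upwards [h t δ hδ] with t' ht'
    refine (closure_minimal (fun y hy => ?_) Metric.isClosed_cthickening).trans hsub
    obtain ⟨y', hy', hd⟩ := ht'.2 y hy
    exact Metric.mem_cthickening_of_dist_le y y' δ _ (subset_closure hy') hd.le
  · refine isOpen_iff_mem_nhds.2 fun t (ht : (closure (K t) ∩ U).Nonempty) => ?_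
    obtain ⟨y, hyU, hy⟩ := (closure_inter_open_nonempty_iff hU).1 ht
    obtain ⟨ε, hε, hball⟩ := Metric.isOpen_iff.1 hU y hy
    filter_upwards [h t ε hε] with t' ht'
    obtain ⟨y', hy', hd⟩ := ht'.1 y hyU
    exact ⟨y', subset_closure hy', hball (by rwa [Metric.mem_ball, dist_comm])⟩

theorem exists_finite_nets {Y : Type*} [MetricSpace Y] [CompactSpace Y] (ι : Pt → Y) :
    ∃ Z : List Edge → Set Pt, (∀ a, (Z a).Finite) ∧ ∀ a w, ∃ z ∈ Z a,
      dist (ι (cellMap a w)) (ι (cellMap a z)) < (1 / 2) ^ Encodable.encode a := by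
  have key : ∀ a : List Edge, ∃ S : Set Pt, S.Finite ∧ ∀ w, ∃ z ∈ S,
      dist (ι (cellMap a w)) (ι (cellMap a z)) < (1 / 2) ^ Encodable.encode a := by
    intro a
    obtain ⟨t, hts, ht, hcov⟩ := Metric.finite_approx_of_totallyBounded
      (isCompact_univ.totallyBounded.subset (subset_univ (range (ι ∘ cellMap a))))
      ((1 / 2) ^ Encodable.encode a) (by positivity)
    have : Nonempty Pt := ⟨vU⟩
    choose! f hf using show ∀ y ∈ t, ∃ z, ι (cellMap a z) = y from fun y hy => hts hy
    refine ⟨f '' t, ht.image f, fun w => ?_⟩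
    obtain ⟨y, hy, hd⟩ := mem_iUnion₂.1 (hcov ⟨w, rfl⟩)
    refine ⟨f y, ⟨y, hy, rfl⟩, ?_⟩
    have : ι (cellMap a (f y)) = y := hf y hy
    rwa [this]
  choose Z h1 h2 using key
  exact ⟨Z, h1, h2⟩

section

variable {C : ℕ → Set ((ℕ → Bool) × (ℕ → ℕ))} {Z : List Edge → Set Pt}

theorem exists_near_of_cellPos_eq {Y : Type*} [MetricSpace Y] {ι : Pt → Y}
    (hZ : ∀ a w, ∃ z ∈ Z a,
      dist (ι (cellMap a w)) (ι (cellMap a z)) < (1 / 2) ^ Encodable.encode a)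
    {x x' : ℕ → Bool} {N : ℕ}
    (h : ∀ a, Encodable.encode a < N → cellPos C x a = cellPos C x' a) {z : Pt}
    (hz : z ∈ cellSet (CellOn C x) Z []) :
    ∃ z' ∈ cellSet (CellOn C x') Z [], dist (ι z) (ι z') < (1 / 2) ^ N := by
  by_cases hex : ∃ e a w, CellOn C x' a ∧ ¬ CellOn C x' (e :: a) ∧ CellOn C x (e :: a) ∧
      cellMap (e :: a) w = z
  · obtain ⟨e, a, w, h1, h2, h3, rfl⟩ := hex
    obtain ⟨z', hz', hd⟩ := hZ (e :: a) w
    refine ⟨_, cellMap_mem_cellSet h1 (ptMap_mem_cellSet h1 (mem_cellSet.2 (Or.inl hz'))),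
      hd.trans_le (pow_le_pow_of_le_one (by norm_num) (by norm_num) (not_lt.1 fun hlt => h2 ?_))⟩
    rwa [CellOn, ← h _ hlt]
  · refine ⟨z, subset_cellSet (P := fun b => {w | w ∈ cellSet (CellOn C x) Z b ∧
      cellMap b w = z ∧ (CellOn C x b → CellOn C x' b)}) ?_ [] ⟨hz, rfl, fun _ => ⟨_, rfl⟩⟩, ?_⟩
    · rintro b w ⟨hw, rfl, hb⟩
      refine (mem_cellSet.1 hw).imp_right fun h => ⟨hb h.1, h.2.imp_right ?_⟩
      rintro ⟨e, w', hw', rfl⟩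
      refine ⟨e, w', ⟨hw', rfl, fun hon => ?_⟩, rfl⟩
      by_contra hoff
      exact hex ⟨e, b, w', hb h.1, hoff, hon, rfl⟩
    · rw [dist_self]
      positivity

theorem eventually_cellPos_eq (x : ℕ → Bool) (N : ℕ) :
    ∀ᶠ x' in 𝓝 x, ∀ a, Encodable.encode a < N → cellPos C x' a = cellPos C x a := by
  have hfin : {a : List Edge | Encodable.encode a < N}.Finite :=
    (finite_Iio N).preimage (Encodable.encode_injective.injOn)
  refine hfin.eventually_all.2 fun a _ => ?_
  obtain ⟨M, hM⟩ := cellPos_locally_constant C x a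
  have : ∀ᶠ x' in 𝓝 x, ∀ i ∈ Iio M, x' i = x i := (finite_Iio M).eventually_all.2 fun i _ =>
    (continuous_apply i).continuousAt.eventually (isOpen_discrete {x i} |>.mem_nhds rfl)
  exact this.mono fun x' h => hM x' h

/-- The cell set of a point is zero-dimensional if and only if player I wins. -/
theorem dimLE_cellSet_iff (hZ : ∀ a, (Z a).Finite) (x : ℕ → Bool) :
    DimLE ↥(cellSet (CellOn C x) Z []) 0 ↔ WinPos C x ([], 0) := by
  have hon : CellOn C x [] := ⟨_, rfl⟩
  constructor
  · intro h
    by_contra hW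
    obtain ⟨G, hG, hu, hv⟩ := h.exists_separation
      (u := ⟨vU, vertex_mem hon (Or.inl rfl)⟩) (v := ⟨vV, vertex_mem hon (Or.inr rfl)⟩)
      fun h => vU_ne_vV (congrArg Subtype.val h)
    have hcm := (isClosed_cellSet (on := CellOn C x) hZ []).isClosedEmbedding_subtypeVal.isClosedMap
    have hclop : Clop (CellOn C x) Z [] (Subtype.val '' G) := by
      refine ⟨fun z ⟨w, _, hw⟩ => hw ▸ w.2, hcm _ hG.isClosed, ?_⟩
      convert hcm _ hG.compl.isClosed using 1
      ext z
      constructor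
      · rintro ⟨hz, hzG⟩
        exact ⟨⟨z, hz⟩, fun h => hzG ⟨_, h, rfl⟩, rfl⟩
      · rintro ⟨w, hw, rfl⟩
        refine ⟨w.2, ?_⟩
        rintro ⟨w', hw', he⟩
        exact hw (Subtype.ext he ▸ hw')
    obtain ⟨w, hw, he⟩ := (hclop.vU_mem_iff_vV_mem hZ hW).1 ⟨_, hu, rfl⟩
    exact hv ((Subtype.ext he : w = ⟨vV, _⟩) ▸ hw)
  · intro hW
    refine DimLE.of_clopen_basis fun z O hO hz => ?_
    obtain ⟨ε, hε, hball⟩ := Metric.isOpen_iff.1 hO z hz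
    obtain ⟨G, hG, hzG, hd⟩ := exists_small_clop hZ hW hon z.2 hε
    refine ⟨Subtype.val ⁻¹' G, ⟨hG.2.1.preimage continuous_subtype_val, ?_⟩, hzG,
      fun w hw => hball (hd w hw)⟩
    rw [← isClosed_compl_iff]
    convert hG.2.2.preimage continuous_subtype_val using 1
    ext w
    exact ⟨fun h => ⟨w.2, h⟩, fun h => h.2⟩

end

/-- The set `F₀([0,1]⁵ ∖ ℚ⁵)` of all closed zero-dimensional subsets of
`[0,1]⁵ ∖ ℚ⁵` is `Game Σ⁰₂`-hard (for any admissible topology). -/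
theorem F0_cubeMinusQ5_gameSigma2_hard :
    ∀ τ : TopologicalSpace (Cl ↥cubeMinusQ5), IsAdmissible (↥cubeMinusQ5) τ →
      @GameSigmaHard 2 _ τ (F0 ↥cubeMinusQ5) := by
  rintro τ ⟨Y, tY, hcomp, hmet, e, -, rfl⟩ A ⟨B, hB, rfl⟩
  let : MetricSpace Y := metrizableSpaceMetric Y
  obtain ⟨C, hC, rfl⟩ := hB.exists_isClosed
  obtain ⟨j, hj⟩ := exists_cube_embedding
  obtain ⟨Z, hZ, hnet⟩ := exists_finite_nets (e ∘ j)
  refine ⟨fun x => ⟨j '' cellSet (CellOn C x) Z [],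
    hj.isClosedMap _ (isClosed_cellSet hZ [])⟩, ?_, ?_⟩
  · refine continuous_induced_rng.2 (continuous_vietoris
      (K := fun x => e '' (j '' cellSet (CellOn C x) Z [])) fun x ε hε => ?_)
    obtain ⟨N, hN⟩ := exists_pow_lt_of_lt_one hε (show (1 / 2 : ℝ) < 1 by norm_num)
    filter_upwards [eventually_cellPos_eq (C := C) x N] with x' hx'
    constructor
    · rintro _ ⟨_, ⟨z, hz, rfl⟩, rfl⟩
      obtain ⟨z', hz', hd⟩ := exists_near_of_cellPos_eq hnet (fun a ha => (hx' a ha).symm) hz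
      exact ⟨_, ⟨_, ⟨z', hz', rfl⟩, rfl⟩, hd.trans hN⟩
    · rintro _ ⟨_, ⟨z, hz, rfl⟩, rfl⟩
      obtain ⟨z', hz', hd⟩ := exists_near_of_cellPos_eq hnet hx' hz
      exact ⟨_, ⟨_, ⟨z', hz', rfl⟩, rfl⟩, hd.trans hN⟩
  · ext x
    rw [mem_gameOp_iff_winPos hC x, ← dimLE_cellSet_iff hZ x]
    have hom := hj.isEmbedding.homeomorphImage (cellSet (CellOn C x) Z [])
    exact ⟨fun h => h.of_homeomorph hom, fun h => DimLE.of_homeomorph hom.symm h⟩
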